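/- For all integers k ≥ 3 and n ≥ 2, the abelianization of the fundamental group of the unordered configuration space C_{k+1}^{1,n} is isomorphic to the cyclic group ℤ/kℤ if k is even, and to the cyclic group ℤ/2kℤ if k is odd. -/

import Mathlib

noncomputable section

open Module Submodule

/-- Topology on the projectivization (quotient topology). -/
instance (K V : Type*) [DivisionRing K] [AddCommGroup V] [Module K V] [TopologicalSpace V] :
    TopologicalSpace (Projectivization K V) :=
  inferInstanceAs (TopologicalSpace (Quotient (projectivizationSetoid K V)))

/-- The complex projective space `ℂP^n`. -/
abbrev CP (n : ℕ) := Projectivization ℂ (Fin (n + 1) → ℂ)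

/-- `Fconf k i n` is the ordered configuration space `F_k^{i,n}` of `k` pairwise distinct
points of `ℂP^n` whose projective span has dimension `i` (i.e. the span of representative
vectors has linear dimension `i + 1`). -/
def Fconf (k i n : ℕ) : Set (Fin k → CP n) :=
  {x | Function.Injective x ∧
    finrank ℂ (span ℂ (Set.range fun j => (x j).rep)) = i + 1}

/-- The equivalence relation on `F_k^{i,n}` identifying tuples differing by a
permutation of the coordinates. -/
def permSetoid (k i n : ℕ) : Setoid (Fconf k i n) where
  r x y := ∃ σ : Equiv.Perm (Fin k), (y : Fin k → CP n) = (x : Fin k → CP n) ∘ σ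
  iseqv := by
    constructor
    · intro x; exact ⟨Equiv.refl _, rfl⟩
    · rintro x y ⟨σ, h⟩
      refine ⟨σ.symm, ?_⟩
      funext i
      simp [h]
    · rintro x y z ⟨σ, h⟩ ⟨τ, h'⟩
      exact ⟨τ.trans σ, by rw [h', h]; rfl⟩

/-- `Cconf k i n` is the unordered configuration space `C_k^{i,n} = F_k^{i,n}/Σ_k`. -/
def Cconf (k i n : ℕ) : Type := Quotient (permSetoid k i n)

instance (k i n : ℕ) : TopologicalSpace (Cconf k i n) :=
  inferInstanceAs (TopologicalSpace (Quotient (permSetoid k i n)))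

section

open scoped unitInterval Topology

/-- An additive, homotopy invariant function on the paths of `X`. -/
structure PathCocycle (X : Type*) [TopologicalSpace X] (A : Type*) [AddCommGroup A] where
  toFun : C(I, X) → A
  map_trans : ∀ {p q r : X} (γ : Path p q) (γ' : Path q r),
    toFun (γ.trans γ').toContinuousMap = toFun γ.toContinuousMap + toFun γ'.toContinuousMap
  map_homotopic : ∀ {p q : X} (γ γ' : Path p q), γ.Homotopic γ' →
    toFun γ.toContinuousMap = toFun γ'.toContinuousMap

namespace PathCocycle

variable {X Y A B : Type*} [TopologicalSpace X] [TopologicalSpace Y] [AddCommGroup A]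
  [AddCommGroup B]

/-- A function on points whose differences compute a path cocycle. -/
def IsPotential (c : PathCocycle X A) (e : X → A) : Prop :=
  ∀ γ : C(I, X), c.toFun γ = e (γ 1) - e (γ 0)

/-- The pullback of a path cocycle along a continuous map. -/
def comap (c : PathCocycle Y A) (f : C(X, Y)) : PathCocycle X A where
  toFun γ := c.toFun (f.comp γ)
  map_trans γ γ' := by
    have h := c.map_trans (γ.map f.continuous) (γ'.map f.continuous)
    rw [← Path.map_trans] at h
    exact h
  map_homotopic γ γ' h := c.map_homotopic (γ.map f.continuous) (γ'.map f.continuous) (h.map f)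

/-- The image of a path cocycle under a homomorphism of coefficients. -/
def mapCoeff (c : PathCocycle X A) (f : A →+ B) : PathCocycle X B where
  toFun γ := f (c.toFun γ)
  map_trans γ γ' := by rw [c.map_trans, map_add]
  map_homotopic γ γ' h := by rw [c.map_homotopic γ γ' h]

theorem exists_isPotential [SimplyConnectedSpace X] (c : PathCocycle X A) :
    ∃ e, c.IsPotential e := by
  obtain ⟨x₀⟩ := (inferInstance : Nonempty X)
  refine ⟨fun x => c.toFun (PathConnectedSpace.somePath x₀ x).toContinuousMap, fun γ => ?_⟩
  let γ' : Path (γ 0) (γ 1) := ⟨γ, rfl, rfl⟩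
  have h := c.map_homotopic _ _ (SimplyConnectedSpace.paths_homotopic
    ((PathConnectedSpace.somePath x₀ (γ 0)).trans γ') (PathConnectedSpace.somePath x₀ (γ 1)))
  rw [c.map_trans] at h
  simp only
  rw [← h]
  exact (add_sub_cancel_left _ _).symm

theorem map_const (c : PathCocycle X A) (x : X) : c.toFun (ContinuousMap.const I x) = 0 := by
  have h := c.map_trans (Path.refl x) (Path.refl x)
  rw [Path.refl_trans_refl] at h
  exact left_eq_add.mp h

instance : ContractibleSpace I := (convex_Icc (0 : ℝ) 1).contractibleSpace ⟨0, by simp⟩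

instance : SimplyConnectedSpace (I × I) :=
  haveI : ContractibleSpace (I × I) := (Homeomorph.Set.prod _ _).symm.contractibleSpace_iff.mpr
    (((convex_Icc (0 : ℝ) 1).prod (convex_Icc (0 : ℝ) 1)).contractibleSpace ⟨(0, 0), by simp⟩)
  inferInstance

/-- The affine path between two points of the unit interval. -/
def segI (s t : I) : C(I, I) where
  toFun u := ⟨AffineMap.lineMap (s : ℝ) (t : ℝ) (u : ℝ),
    (convex_Icc (0 : ℝ) 1).lineMap_mem s.2 t.2 u.2⟩
  continuous_toFun := by
    refine Continuous.subtype_mk ?_ _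
    exact AffineMap.lineMap_continuous.comp continuous_subtype_val

theorem isPotential_of_locally (c : PathCocycle X A) (e : X → A)
    (h : ∀ x, ∃ U ∈ 𝓝 x, ∀ γ : C(I, X), (∀ t, γ t ∈ U) → c.toFun γ = e (γ 1) - e (γ 0)) :
    c.IsPotential e := by
  intro γ
  obtain ⟨E, hE⟩ := (c.comap γ).exists_isPotential
  have hloc : IsLocallyConstant fun t : I => E t - e (γ t) := by
    rw [IsLocallyConstant.iff_eventually_eq]
    intro t₀
    obtain ⟨U, hU, hUe⟩ := h (γ t₀)
    obtain ⟨ε, hε, hball⟩ := Metric.mem_nhds_iff.mp (γ.continuous.continuousAt.preimage_mem_nhds hU)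
    filter_upwards [Metric.ball_mem_nhds t₀ hε] with t ht
    have h1 := hE (segI t₀ t)
    have h2 := hUe (γ.comp (segI t₀ t)) (by
      intro u
      apply hball
      have : ((segI t₀ t u : I) : ℝ) ∈ Metric.ball (t₀ : ℝ) ε :=
        (convex_ball (t₀ : ℝ) ε).lineMap_mem (Metric.mem_ball_self hε) ht u.2
      exact this)
    have e0 : segI t₀ t 0 = t₀ := by ext; simp [segI]
    have e1 : segI t₀ t 1 = t := by ext; simp [segI]
    have h3 : (c.comap γ).toFun (segI t₀ t) = c.toFun (γ.comp (segI t₀ t)) := rfl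
    rw [h3, h2] at h1
    simp only [ContinuousMap.comp_apply, e0, e1] at h1
    rw [sub_eq_sub_iff_sub_eq_sub, ← h1]
  have h1 := hE (ContinuousMap.id I)
  have h2 := hloc.apply_eq_of_isPreconnected isPreconnected_univ (Set.mem_univ 0) (Set.mem_univ 1)
  have h3 : (c.comap γ).toFun (ContinuousMap.id I) = c.toFun γ := rfl
  rw [h3] at h1
  rw [h1]
  simp only [ContinuousMap.id_apply] at h2 ⊢
  rw [sub_eq_sub_iff_sub_eq_sub] at h2
  rw [← neg_inj, neg_sub, neg_sub]
  exact h2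

/-- The two ways around a square have the same value. -/
theorem square (c : PathCocycle X A) (H : C(I × I, X)) :
    c.toFun (H.comp ⟨fun t => (0, t), by fun_prop⟩)
        + c.toFun (H.comp ⟨fun t => (t, 1), by fun_prop⟩)
      = c.toFun (H.comp ⟨fun t => (t, 0), by fun_prop⟩)
        + c.toFun (H.comp ⟨fun t => (1, t), by fun_prop⟩) := by
  obtain ⟨E, hE⟩ := (c.comap H).exists_isPotential
  have h1 := hE ⟨fun t => (0, t), by fun_prop⟩
  have h2 := hE ⟨fun t => (t, 1), by fun_prop⟩
  have h3 := hE ⟨fun t => (t, 0), by fun_prop⟩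
  have h4 := hE ⟨fun t => (1, t), by fun_prop⟩
  simp only [comap, ContinuousMap.coe_mk] at h1 h2 h3 h4
  rw [h1, h2, h3, h4]
  abel

/-- The path cocycle of a homomorphism from the fundamental group to an abelian group. -/
theorem exists_of_hom [PathConnectedSpace X] (x : X)
    (φ : FundamentalGroup X x →* Multiplicative A) :
    ∃ c : PathCocycle X A, ∀ γ : Path x x,
      Multiplicative.toAdd (φ (FundamentalGroup.fromPath (Path.Homotopic.Quotient.mk γ)))
        = c.toFun γ.toContinuousMap := by
  let κ : ∀ y, Path.Homotopic.Quotient x y := fun y =>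
    Path.Homotopic.Quotient.mk (PathConnectedSpace.somePath x y)
  let w : Path.Homotopic.Quotient x x → A := fun γ =>
    Multiplicative.toAdd (φ (FundamentalGroup.fromPath γ))
  have hw : ∀ γ γ', w (γ.trans γ') = w γ + w γ' := by
    intro γ γ'
    have : FundamentalGroup.fromPath (γ.trans γ')
      = FundamentalGroup.fromPath γ' * FundamentalGroup.fromPath γ := rfl
    simp only [w]
    rw [this, map_mul, toAdd_mul, add_comm]
  let v : ∀ {p q : X}, Path.Homotopic.Quotient p q → A := fun {p q} γ =>
    w (((κ p).trans γ).trans (κ q).symm)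
  have hv : ∀ {p q r : X} (γ : Path.Homotopic.Quotient p q) (γ' : Path.Homotopic.Quotient q r),
      v (γ.trans γ') = v γ + v γ' := by
    intro p q r γ γ'
    simp only [v]
    rw [← hw]
    congr 1
    simp [← Path.Homotopic.Quotient.trans_assoc _ (κ q)]
  have hcast : ∀ {p q : X} (γ : Path p q),
      v (Path.Homotopic.Quotient.mk (⟨γ.toContinuousMap, rfl, rfl⟩ :
        Path (γ.toContinuousMap 0) (γ.toContinuousMap 1))) = v (Path.Homotopic.Quotient.mk γ) := by
    rintro p q ⟨γ, rfl, rfl⟩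
    rfl
  refine ⟨⟨fun γ => v (Path.Homotopic.Quotient.mk (⟨γ, rfl, rfl⟩ : Path (γ 0) (γ 1))), ?_, ?_⟩, ?_⟩
  · intro p q r γ γ'
    rw [hcast, hcast, hcast, Path.Homotopic.Quotient.mk_trans, hv]
  · intro p q γ γ' h
    rw [hcast, hcast, Path.Homotopic.Quotient.eq.mpr h]
  · intro γ
    simp only
    rw [hcast]
    have h1 : w ((κ x).trans (κ x).symm) = 0 := by
      have := hw (.refl x) (.refl x)
      simp only [Path.Homotopic.Quotient.refl_trans, left_eq_add] at this
      simpa using this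
    rw [hw] at h1
    simp only [v]
    rw [hw, hw, add_right_comm, h1, zero_add]
end PathCocycle

end

/-- The configurations `z` for which every difference `z j - z i` with `i < j` lies in the open
half plane prescribed by `ω i j`. -/
def wedge {m : ℕ} (ω : Fin m → Fin m → ℂ) : Set (Fin m → ℂ) :=
  {z | ∀ i j, i < j → 0 < (ω i j * (z j - z i)).re}

theorem convex_wedge {m : ℕ} (ω : Fin m → Fin m → ℂ) : Convex ℝ (wedge ω) := by
  intro x hx y hy a b ha hb hab i j hij
  have h1 := hx i j hij
  have h2 := hy i j hij
  have h3 : (ω i j * ((a • x + b • y) j - (a • x + b • y) i)).re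
      = a * (ω i j * (x j - x i)).re + b * (ω i j * (y j - y i)).re := by
    simp [Complex.mul_re]
    ring
  rw [h3]
  rcases ha.eq_or_lt with rfl | ha
  · have : b = 1 := by linarith
    subst this
    linarith
  · have := mul_pos ha h1
    have := mul_nonneg hb h2.le
    linarith

theorem isOpen_wedge {m : ℕ} (ω : Fin m → Fin m → ℂ) : IsOpen (wedge ω) := by
  have : wedge ω = ⋂ i, ⋂ j, {z | i < j → 0 < (ω i j * (z j - z i)).re} := by
    ext z; simp [wedge]
  rw [this]
  refine isOpen_iInter_of_finite fun i => isOpen_iInter_of_finite fun j => ?_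
  by_cases h : i < j
  · simp only [h, true_imp_iff]
    exact isOpen_lt continuous_const (Complex.continuous_re.comp (by fun_prop))
  · simp [h]

theorem injective_of_mem_wedge {m : ℕ} {ω : Fin m → Fin m → ℂ} {z : Fin m → ℂ}
    (hz : z ∈ wedge ω) : Function.Injective z := by
  intro i j hij
  by_contra hne
  rcases lt_or_gt_of_ne hne with h | h
  · have := hz i j h
    simp [hij] at this
  · have := hz j i h
    simp [hij] at this

/-- Configurations whose points are ordered by real part, then by imaginary part. -/
def LexSorted {m : ℕ} (z : Fin m → ℂ) : Prop :=
  ∀ i j, i < j → (z i).re < (z j).re ∨ ((z i).re = (z j).re ∧ (z i).im < (z j).im)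

/-- The configuration whose `l`-th point has real part `σ l` and imaginary part `l`. -/
def stair {m : ℕ} (σ : Equiv.Perm (Fin m)) (l : Fin m) : ℂ := ⟨((σ l : ℕ) : ℝ), ((l : ℕ) : ℝ)⟩

/-- The permutation sorting the points by real part, then by imaginary part. -/
def lexSort {m : ℕ} (z : Fin m → ℂ) : Equiv.Perm (Fin m) :=
  Tuple.sort fun i => toLex ((z i).re, (z i).im)

theorem lexSorted_comp_lexSort {m : ℕ} {z : Fin m → ℂ} (hz : Function.Injective z) :
    LexSorted (z ∘ lexSort z) := by
  intro i j hij
  have h := Tuple.monotone_sort (fun i => toLex ((z i).re, (z i).im)) hij.le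
  rcases Prod.Lex.toLex_le_toLex.mp h with h | h
  · exact Or.inl h
  · refine Or.inr ⟨h.1, lt_of_le_of_ne h.2 fun h' => ?_⟩
    exact hij.ne ((lexSort z).injective (hz (Complex.ext h.1 h')))

theorem comp_perm_comp_lexSort {m : ℕ} (z : Fin m → ℂ) (σ : Equiv.Perm (Fin m)) :
    (z ∘ σ) ∘ lexSort (z ∘ σ) = z ∘ lexSort z := by
  have h := Tuple.comp_perm_comp_sort_eq_comp_sort (σ := σ)
    (f := fun i => toLex ((z i).re, (z i).im))
  funext i
  have := congrFun h i
  simp only [Function.comp_apply, EmbeddingLike.apply_eq_iff_eq, Prod.mk.injEq] at this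
  exact Complex.ext this.1 this.2

theorem LexSorted.injective {m : ℕ} {z : Fin m → ℂ} (hz : LexSorted z) : Function.Injective z := by
  intro i j hij
  by_contra hne
  rcases lt_or_gt_of_ne hne with h | h
  · rcases hz i j h with h | h <;> simp [hij] at h
  · rcases hz j i h with h | h <;> simp [hij] at h

theorem LexSorted.lexSort_eq {m : ℕ} {z : Fin m → ℂ} (hz : LexSorted z) : lexSort z = 1 := by
  refine ((Tuple.sort_eq_refl_iff_monotone).mpr ?_)
  refine monotone_iff_forall_lt.mpr fun i j hij => ?_
  rw [Prod.Lex.toLex_le_toLex]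
  rcases hz i j hij with h | h
  · exact Or.inl h
  · exact Or.inr ⟨h.1, h.2.le⟩

/-- A function on pairs of configurations of points in the plane, behaving like the variation
of a symmetric homotopy invariant along straight segments. -/
structure SegmentCocycle (k : ℕ) (A : Type*) [AddCommGroup A] where
  t : (Fin (k + 1) → ℂ) → (Fin (k + 1) → ℂ) → A
  add : ∀ ω p q r, p ∈ wedge ω → q ∈ wedge ω → r ∈ wedge ω → t p q + t q r = t p r
  perm : ∀ σ : Equiv.Perm (Fin (k + 1)), ∀ p q, t (p ∘ σ) (q ∘ σ) = t p q
  sorted : ∀ p, LexSorted p → t p (stair 1) = 0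

theorem lexSorted_of_re {m : ℕ} {z : Fin m → ℂ} (h : ∀ i j, i < j → (z i).re < (z j).re) :
    LexSorted z := fun i j hij => Or.inl (h i j hij)

theorem re_stair {m : ℕ} (σ : Equiv.Perm (Fin m)) (l : Fin m) :
    (stair σ l).re = ((σ l : ℕ) : ℝ) := rfl

theorem im_stair {m : ℕ} (σ : Equiv.Perm (Fin m)) (l : Fin m) :
    (stair σ l).im = ((l : ℕ) : ℝ) := rfl

/-- The configurations with increasing imaginary parts. -/
abbrev imChamber (m : ℕ) : Set (Fin m → ℂ) := wedge fun _ _ => -Complex.I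

theorem mem_imChamber {m : ℕ} {z : Fin m → ℂ} :
    z ∈ imChamber m ↔ ∀ i j, i < j → (z i).im < (z j).im := by
  simp [wedge]

/-- The configurations with increasing real parts. -/
abbrev reChamber (m : ℕ) : Set (Fin m → ℂ) := wedge fun _ _ => 1

theorem mem_reChamber {m : ℕ} {z : Fin m → ℂ} :
    z ∈ reChamber m ↔ ∀ i j, i < j → (z i).re < (z j).re := by
  simp [wedge]

theorem stair_mem_imChamber {m : ℕ} (σ : Equiv.Perm (Fin m)) : stair σ ∈ imChamber m := by
  rw [mem_imChamber]
  intro i j hij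
  simpa [im_stair] using hij

theorem stair_one_mem_reChamber {m : ℕ} : stair (1 : Equiv.Perm (Fin m)) ∈ reChamber m := by
  rw [mem_reChamber]
  intro i j hij
  simpa [re_stair] using hij

/-- The set of pairs of values which a permutation lists in the wrong order. -/
def inversions {m : ℕ} (σ : Equiv.Perm (Fin m)) : Finset (Fin m × Fin m) :=
  Finset.univ.filter fun x => x.1 < x.2 ∧ σ.symm x.2 < σ.symm x.1

theorem mem_inversions {m : ℕ} {σ : Equiv.Perm (Fin m)} {x : Fin m × Fin m} :
    x ∈ inversions σ ↔ x.1 < x.2 ∧ σ.symm x.2 < σ.symm x.1 := by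
  simp [inversions]

/-- The transposition of two neighbours. -/
abbrev adjSwap {k : ℕ} (i : Fin k) : Equiv.Perm (Fin (k + 1)) := Equiv.swap i.castSucc i.succ

theorem adjSwap_lt {k : ℕ} (i : Fin k) {j l : Fin (k + 1)} (h : j < l)
    (hne : ¬ (j = i.castSucc ∧ l = i.succ)) : adjSwap i j < adjSwap i l := by
  simp only [adjSwap, Equiv.swap_apply_def]
  simp only [Fin.ext_iff, Fin.lt_def, Fin.val_castSucc, Fin.val_succ] at *
  split_ifs <;> (try simp only [Fin.val_castSucc, Fin.val_succ]) <;> omega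

theorem card_inversions_adjSwap_mul {k : ℕ} (i : Fin k) (σ : Equiv.Perm (Fin (k + 1)))
    (h : σ.symm i.castSucc < σ.symm i.succ) :
    (inversions (adjSwap i * σ)).card = (inversions σ).card + 1 := by
  have hsymm : ∀ x, (adjSwap i * σ).symm x = σ.symm (adjSwap i x) := fun x => rfl
  have hss : ∀ x, adjSwap i (adjSwap i x) = x := fun x => Equiv.swap_apply_self _ _ x
  have hs : adjSwap i i.succ = i.castSucc := Equiv.swap_apply_right _ _
  have hc : adjSwap i i.castSucc = i.succ := Equiv.swap_apply_left _ _
  have : inversions (adjSwap i * σ) = insert (i.castSucc, i.succ)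
      ((inversions σ).map ((adjSwap i).prodCongr (adjSwap i)).toEmbedding) := by
    ext ⟨j, l⟩
    simp only [Finset.mem_insert, Finset.mem_map_equiv, mem_inversions, hsymm, Prod.mk.injEq]
    have e : ((adjSwap i).prodCongr (adjSwap i)).symm (j, l) = (adjSwap i j, adjSwap i l) := by
      simp [adjSwap]
    rw [e]
    by_cases hjl : j = i.castSucc ∧ l = i.succ
    · obtain ⟨rfl, rfl⟩ := hjl
      simp [hs, hc, h]
    · simp only [hjl, false_or]
      constructor
      · rintro ⟨h1, h2⟩
        exact ⟨adjSwap_lt i h1 hjl, h2⟩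
      · rintro ⟨h1, h2⟩
        refine ⟨?_, h2⟩
        have := adjSwap_lt i h1 (by
          rintro ⟨h3, h4⟩
          rw [h3, h4] at h2
          exact lt_asymm h h2)
        rwa [hss, hss] at this
  rw [this, Finset.card_insert_of_notMem, Finset.card_map]
  simp only [Finset.mem_map_equiv, mem_inversions]
  have e : ((adjSwap i).prodCongr (adjSwap i)).symm (i.castSucc, i.succ)
      = (i.succ, i.castSucc) := by
    simp [adjSwap]
  rw [e]
  rintro ⟨h1, -⟩
  exact lt_asymm h1 (Fin.castSucc_lt_succ)

namespace SegmentCocycle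

variable {k : ℕ} {A : Type*} [AddCommGroup A] (c : SegmentCocycle k A)

theorem self {ω p} (hp : p ∈ wedge ω) : c.t p p = 0 := by
  simpa using c.add ω p p p hp hp hp

theorem swap_add {ω p q} (hp : p ∈ wedge ω) (hq : q ∈ wedge ω) : c.t p q + c.t q p = 0 := by
  rw [c.add ω p q p hp hq hp, c.self hp]

theorem reChamber_eq_zero {p q} (hp : p ∈ reChamber (k + 1)) (hq : q ∈ reChamber (k + 1)) :
    c.t p q = 0 := by
  have h1 := c.sorted p (lexSorted_of_re (mem_reChamber.mp hp))
  have h2 := c.sorted q (lexSorted_of_re (mem_reChamber.mp hq))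
  have h3 := c.add _ p q _ hp hq stair_one_mem_reChamber
  rw [h1, h2, add_zero] at h3
  exact h3

/-- Configurations ordered by real part in the same way are connected by a segment of value
zero. -/
theorem eq_zero_of_comp (σ : Equiv.Perm (Fin (k + 1))) {p q} (hp : p ∘ σ ∈ reChamber (k + 1))
    (hq : q ∘ σ ∈ reChamber (k + 1)) : c.t p q = 0 := by
  rw [← c.perm σ]
  exact c.reChamber_eq_zero hp hq

/-- The value of the segment from `stair 1` to `stair σ`. -/
def val (σ : Equiv.Perm (Fin (k + 1))) : A := c.t (stair 1) (stair σ)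

theorem stair_comp_symm_mem {m : ℕ} (σ : Equiv.Perm (Fin m)) : stair σ ∘ σ.symm ∈ reChamber m := by
  rw [mem_reChamber]
  intro i j hij
  simpa [re_stair] using hij

theorem eq_val {p} (hp : p ∈ imChamber (k + 1)) (σ : Equiv.Perm (Fin (k + 1)))
    (hσ : p ∘ σ.symm ∈ reChamber (k + 1)) : c.t (stair 1) p = c.val σ := by
  rw [← c.add _ (stair 1) (stair σ) p (stair_mem_imChamber _) (stair_mem_imChamber _) hp,
    c.eq_zero_of_comp σ.symm (stair_comp_symm_mem σ) hσ, add_zero, val]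

theorem val_one : c.val 1 = 0 := c.self stair_one_mem_reChamber

theorem val_adjSwap_mul (i : Fin k) (σ : Equiv.Perm (Fin (k + 1)))
    (h : σ.symm i.castSucc < σ.symm i.succ) :
    c.val (adjSwap i * σ) = c.val σ + c.val (adjSwap i) := by
  let ω : Fin (k + 1) → Fin (k + 1) → ℂ := fun j l =>
    if j = i.castSucc ∧ l = i.succ then -Complex.I else 1
  have hω : ∀ z : Fin (k + 1) → ℂ, (z i.castSucc).im < (z i.succ).im →
      (∀ j l, j < l → ¬ (j = i.castSucc ∧ l = i.succ) → (z j).re < (z l).re) → z ∈ wedge ω := by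
    intro z h1 h2 j l hjl
    by_cases hc : j = i.castSucc ∧ l = i.succ
    · simp only [ω, hc]
      simpa using h1
    · simp only [ω, hc]
      simpa using h2 j l hjl hc
  have hss : ∀ x, adjSwap i (adjSwap i x) = x := fun x => Equiv.swap_apply_self _ _ x
  have m1 : stair σ ∘ σ.symm ∈ wedge ω := by
    refine hω _ ?_ fun j l hjl _ => ?_
    · simpa [im_stair] using h
    · simpa [re_stair] using hjl
  have m2 : stair (adjSwap i * σ) ∘ σ.symm ∈ wedge ω := by
    refine hω _ ?_ fun j l hjl hc => ?_
    · simpa [im_stair] using h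
    · simpa [re_stair] using adjSwap_lt i hjl hc
  have m3 : stair (1 : Equiv.Perm (Fin (k + 1))) ∈ wedge ω := by
    refine hω _ ?_ fun j l hjl _ => ?_
    · simp [im_stair]
    · simpa [re_stair] using hjl
  have m4 : stair (adjSwap i) ∈ wedge ω := by
    refine hω _ ?_ fun j l hjl hc => ?_
    · simp [im_stair]
    · simpa [re_stair] using adjSwap_lt i hjl hc
  have e1 := c.add ω _ _ _ m1 m3 m2
  have e2 := c.add ω _ _ _ m3 m4 m2
  rw [c.reChamber_eq_zero (stair_comp_symm_mem σ) stair_one_mem_reChamber, zero_add] at e1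
  rw [c.eq_zero_of_comp (adjSwap i) (p := stair (adjSwap i)), add_zero] at e2
  · rw [val, ← c.add _ (stair 1) (stair σ) _ (stair_mem_imChamber _) (stair_mem_imChamber _)
      (stair_mem_imChamber _), ← c.perm σ.symm (stair σ), ← e1, ← e2, val, val]
  · have := stair_comp_symm_mem (adjSwap i)
    rwa [Equiv.symm_swap] at this
  · rw [mem_reChamber]
    intro j l hjl
    simp only [Function.comp_apply, re_stair, Equiv.Perm.coe_mul, Equiv.apply_symm_apply, hss]
    simpa using hjl

theorem val_adjSwap_succ {i : ℕ} (h : i + 1 < k) :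
    c.val (adjSwap (⟨i, by omega⟩ : Fin k)) = c.val (adjSwap (⟨i + 1, h⟩ : Fin k)) := by
  set s := adjSwap (⟨i, by omega⟩ : Fin k) with hs
  set s' := adjSwap (⟨i + 1, h⟩ : Fin k) with hs'
  have hsv : ∀ x : Fin (k + 1), (s x : ℕ) = if (x : ℕ) = i then i + 1 else if (x : ℕ) = i + 1 then i
      else x := by
    intro x
    simp only [hs, adjSwap, Equiv.swap_apply_def, Fin.ext_iff, Fin.val_castSucc, Fin.val_succ]
    split_ifs <;> simp
  have hsv' : ∀ x : Fin (k + 1), (s' x : ℕ) = if (x : ℕ) = i + 1 then i + 2 else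
      if (x : ℕ) = i + 2 then i + 1 else x := by
    intro x
    simp only [hs', adjSwap, Equiv.swap_apply_def, Fin.ext_iff, Fin.val_castSucc, Fin.val_succ]
    split_ifs <;> simp
  have hsymm : s.symm = s := Equiv.symm_swap _ _
  have hsymm' : s'.symm = s' := Equiv.symm_swap _ _
  have h1 : c.val (s' * s) = c.val s + c.val s' := by
    refine c.val_adjSwap_mul _ _ ?_
    rw [hsymm, Fin.lt_def, hsv, hsv]
    simp only [Fin.val_castSucc, Fin.val_succ]
    split_ifs <;> omega
  have h2 : c.val (s * (s' * s)) = c.val (s' * s) + c.val s := by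
    refine c.val_adjSwap_mul _ _ ?_
    have : (s' * s).symm = s * s' := by
      rw [← Equiv.Perm.inv_def, mul_inv_rev, Equiv.Perm.inv_def, Equiv.Perm.inv_def, hsymm, hsymm']
    rw [this, Fin.lt_def, Equiv.Perm.mul_apply, Equiv.Perm.mul_apply, hsv, hsv, hsv', hsv']
    simp
  have h3 : c.val (s * s') = c.val s' + c.val s := by
    refine c.val_adjSwap_mul _ _ ?_
    rw [hsymm', Fin.lt_def, hsv', hsv']
    simp
  have h4 : c.val (s' * (s * s')) = c.val (s * s') + c.val s' := by
    refine c.val_adjSwap_mul _ _ ?_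
    have : (s * s').symm = s' * s := by
      rw [← Equiv.Perm.inv_def, mul_inv_rev, Equiv.Perm.inv_def, Equiv.Perm.inv_def, hsymm, hsymm']
    rw [this, Fin.lt_def, Equiv.Perm.mul_apply, Equiv.Perm.mul_apply, hsv', hsv', hsv, hsv]
    simp only [Fin.val_castSucc, Fin.val_succ]
    split_ifs <;> omega
  have h5 : s * (s' * s) = s' * (s * s') := by
    have e : (⟨i + 1, h⟩ : Fin k).castSucc = (⟨i, by omega⟩ : Fin k).succ := rfl
    rw [hs, hs', adjSwap, adjSwap, e, ← mul_assoc, ← mul_assoc,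
      Equiv.swap_mul_swap_mul_swap (by simp [Fin.ext_iff]) (by simp [Fin.ext_iff]; omega),
      Equiv.swap_comm, Equiv.swap_comm (⟨i, by omega⟩ : Fin k).succ (⟨i + 1, h⟩ : Fin k).succ,
      Equiv.swap_mul_swap_mul_swap (by simp [Fin.ext_iff]) (by simp [Fin.ext_iff]; omega),
      Equiv.swap_comm]
  rw [h5, h4, h3, h1] at h2
  have : c.val s' + c.val s + c.val s' = c.val s' + c.val s + c.val s := by
    rw [h2, add_comm (c.val s)]
  exact (add_left_cancel this).symm

/-- The value of an adjacent transposition. -/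
def gen (hk : 0 < k) : A := c.val (adjSwap (⟨0, hk⟩ : Fin k))

theorem val_adjSwap (hk : 0 < k) (i : Fin k) : c.val (adjSwap i) = c.gen hk := by
  obtain ⟨i, hi⟩ := i
  induction i with
  | zero => rfl
  | succ i ih => rw [← c.val_adjSwap_succ hi, ih]

theorem val_eq (hk : 0 < k) (σ : Equiv.Perm (Fin (k + 1))) :
    c.val σ = (inversions σ).card • c.gen hk := by
  have key : ∀ (i : Fin k) (σ : Equiv.Perm (Fin (k + 1))),
      c.val σ = (inversions σ).card • c.gen hk →
        c.val (adjSwap i * σ) = (inversions (adjSwap i * σ)).card • c.gen hk := by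
    intro i σ h
    have hne : σ.symm i.castSucc ≠ σ.symm i.succ := fun h =>
      (Fin.castSucc_lt_succ (i := i)).ne (σ.symm.injective h)
    rcases lt_or_gt_of_ne hne with hlt | hlt
    · rw [c.val_adjSwap_mul i σ hlt, card_inversions_adjSwap_mul i σ hlt, h, c.val_adjSwap hk i,
        add_smul, one_smul]
    · have hlt' : (adjSwap i * σ).symm i.castSucc < (adjSwap i * σ).symm i.succ := by
        have hsymm : ∀ x, (adjSwap i * σ).symm x = σ.symm (adjSwap i x) := fun x => rfl
        rw [hsymm, hsymm]
        simpa [adjSwap] using hlt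
      have e : adjSwap i * (adjSwap i * σ) = σ := by rw [← mul_assoc, Equiv.swap_mul_self, one_mul]
      have h1 := c.val_adjSwap_mul i _ hlt'
      have h2 := card_inversions_adjSwap_mul i _ hlt'
      rw [e] at h1 h2
      rw [h1, h2, c.val_adjSwap hk i, add_smul, one_smul] at h
      exact add_right_cancel h
  have hmem : σ ∈ Submonoid.closure (Set.range fun i : Fin k => adjSwap i) := by
    rw [Equiv.Perm.mclosure_swap_castSucc_succ]
    trivial
  induction hmem using Submonoid.closure_induction_left with
  | one =>
    have : inversions (1 : Equiv.Perm (Fin (k + 1))) = ∅ := by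
      ext x
      rw [mem_inversions]
      simp only [Finset.notMem_empty, iff_false]
      rintro ⟨h1, h2⟩
      exact lt_asymm h1 h2
    rw [c.val_one, this]
    simp
  | mul_left x hx y _ ih =>
    obtain ⟨i, rfl⟩ := hx
    exact key i y ih

end SegmentCocycle

/-- The cone of configurations compatible with the order of the points of `z`. -/
def lexCone {m : ℕ} (z : Fin m → ℂ) : Set (Fin m → ℂ) :=
  wedge fun i j => if (z i).re < (z j).re then 1 else -Complex.I

theorem mem_lexCone {m : ℕ} {z w : Fin m → ℂ} (hz : LexSorted z) :
    w ∈ lexCone z ↔ ∀ i j, i < j → ((z i).re < (z j).re → (w i).re < (w j).re) ∧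
      ((z i).re = (z j).re → (w i).im < (w j).im) := by
  refine forall₂_congr fun i j => imp_congr_right fun hij => ?_
  rcases hz i j hij with h | h
  · simp [h, h.ne]
  · simp [h]

theorem LexSorted.mem_lexCone_self {m : ℕ} {z : Fin m → ℂ} (hz : LexSorted z) : z ∈ lexCone z := by
  rw [mem_lexCone hz]
  intro i j hij
  refine ⟨id, fun h => ?_⟩
  rcases hz i j hij with h' | h'
  · exact absurd h h'.ne
  · exact h'.2

theorem LexSorted.stair_one_mem_lexCone {m : ℕ} {z : Fin m → ℂ} (hz : LexSorted z) :
    stair 1 ∈ lexCone z := by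
  rw [mem_lexCone hz]
  intro i j hij
  constructor <;> simpa [re_stair, im_stair] using fun _ => hij

namespace SegmentCocycle

variable {k : ℕ} {A : Type*} [AddCommGroup A] (c : SegmentCocycle k A)

theorem eq_zero_of_mem_lexCone {z p : Fin (k + 1) → ℂ} (hz : LexSorted z) (hp : p ∈ lexCone z)
    (hc : ∀ σ, c.val σ = 0) : c.t p (stair 1) = 0 := by
  have hpi := injective_of_mem_wedge hp
  have hp' := (mem_lexCone hz).mp hp
  set τ := lexSort p with hτ
  have hs : LexSorted (p ∘ τ) := lexSorted_comp_lexSort hpi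
  have hmono : ∀ i j, (p i).re < (p j).re → τ.symm i < τ.symm j := by
    intro i j hij
    by_contra hle
    rcases (not_lt.mp hle).eq_or_lt with h | h
    · rw [τ.symm.injective h] at hij
      exact lt_irrefl _ hij
    · have := hs _ _ h
      simp only [Function.comp_apply, Equiv.apply_symm_apply] at this
      rcases this with h' | h'
      · exact lt_asymm h' hij
      · exact hij.ne h'.1.symm
  have h1 : stair τ.symm ∈ lexCone z := by
    rw [mem_lexCone hz]
    intro i j hij
    refine ⟨fun h => ?_, fun _ => ?_⟩
    · simpa [re_stair] using hmono _ _ ((hp' i j hij).1 h)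
    · simpa [im_stair] using hij
  have h2 : stair τ.symm ∘ τ ∈ lexCone (p ∘ τ) := by
    rw [mem_lexCone hs]
    intro i j hij
    refine ⟨fun _ => ?_, fun h => ?_⟩
    · simpa [re_stair] using hij
    · simp only [Function.comp_apply, im_stair, Nat.cast_lt, Fin.val_fin_lt] at h ⊢
      by_contra hle
      have hlt : τ j < τ i := lt_of_le_of_ne (not_lt.mp hle) fun h => hij.ne' (τ.injective h)
      have hq := hs i j hij
      simp only [Function.comp_apply, h, lt_self_iff_false, true_and, false_or] at hq
      rcases hz _ _ hlt with h' | h'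
      · exact ((hp' _ _ hlt).1 h').ne h.symm
      · exact lt_asymm hq ((hp' _ _ hlt).2 h'.1)
  have e1 : c.t p (stair τ.symm) = 0 := by
    rw [← c.perm τ]
    have h3 := c.add _ _ _ _ hs.mem_lexCone_self h2 hs.stair_one_mem_lexCone
    have h4 : stair τ.symm ∘ τ ∈ reChamber (k + 1) := stair_comp_symm_mem τ.symm
    rw [c.sorted _ hs, c.reChamber_eq_zero h4 stair_one_mem_reChamber, add_zero] at h3
    exact h3
  have e2 : c.t (stair τ.symm) (stair 1) = 0 := by
    have := c.swap_add (stair_mem_imChamber 1) (stair_mem_imChamber τ.symm)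
    rw [← val, hc, zero_add] at this
    exact this
  rw [← c.add _ _ _ _ hp h1 hz.stair_one_mem_lexCone, e1, e2, add_zero]

/-- If all elementary values vanish then the cocycle vanishes locally. -/
theorem exists_convex_eq_zero (hc : ∀ σ, c.val σ = 0) {z : Fin (k + 1) → ℂ}
    (hz : Function.Injective z) :
    ∃ C : Set (Fin (k + 1) → ℂ), Convex ℝ C ∧ IsOpen C ∧ z ∈ C ∧ (∀ w ∈ C, Function.Injective w) ∧
      ∀ p ∈ C, ∀ q ∈ C, c.t p q = 0 := by
  set τ := lexSort z
  have hs : LexSorted (z ∘ τ) := lexSorted_comp_lexSort hz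
  refine ⟨{w | w ∘ τ ∈ lexCone (z ∘ τ)}, ?_, ?_, hs.mem_lexCone_self, ?_, ?_⟩
  · intro x hx y hy a b ha hb hab
    exact (convex_wedge _) hx hy ha hb hab
  · exact (isOpen_wedge _).preimage (by fun_prop)
  · intro w hw
    have := injective_of_mem_wedge hw
    exact (Equiv.injective_comp τ w).mp this
  · intro p hp q hq
    have h := c.add _ _ _ _ hp hq hs.stair_one_mem_lexCone
    rw [c.eq_zero_of_mem_lexCone hs hp hc, c.eq_zero_of_mem_lexCone hs hq hc, add_zero,
      c.perm] at h
    exact h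

end SegmentCocycle

theorem card_inversions_revPerm (m : ℕ) :
    2 * (inversions (Fin.revPerm : Equiv.Perm (Fin m))).card = m * (m - 1) := by
  have h1 : (inversions (Fin.revPerm : Equiv.Perm (Fin m)))
      = (Finset.univ : Finset (Fin m × Fin m)).filter fun x => x.1 < x.2 := by
    ext x
    simp [mem_inversions]
  have h2 : ((Finset.univ : Finset (Fin m × Fin m)).filter fun x => x.2 < x.1).card
      = ((Finset.univ : Finset (Fin m × Fin m)).filter fun x => x.1 < x.2).card := by
    refine Finset.card_bij (fun x _ => x.swap) ?_ ?_ ?_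
    · intro x hx; simpa using hx
    · intro x _ y _ h; exact Prod.swap_injective h
    · intro x hx; exact ⟨x.swap, by simpa using hx, by simp⟩
  have h3 : (Finset.univ : Finset (Fin m)).offDiag
      = ((Finset.univ : Finset (Fin m × Fin m)).filter fun x => x.1 < x.2)
        ∪ ((Finset.univ : Finset (Fin m × Fin m)).filter fun x => x.2 < x.1) := by
    ext x
    simp [lt_or_lt_iff_ne]
  have h4 := congrArg Finset.card h3
  rw [Finset.offDiag_card, Finset.card_union_of_disjoint, h2, ← h1] at h4
  · simp only [Finset.card_univ, Fintype.card_fin] at h4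
    rw [Nat.mul_sub, mul_one]
    omega
  · rw [Finset.disjoint_left]
    intro x hx hx'
    simp only [Finset.mem_filter, Finset.mem_univ, true_and] at hx hx'
    exact lt_asymm hx hx'

theorem finRotate_symm_zero (k : ℕ) : (finRotate (k + 1)).symm 0 = Fin.last k := by
  rw [Equiv.symm_apply_eq]
  simp

theorem finRotate_symm_succ {k : ℕ} (i : Fin k) :
    (finRotate (k + 1)).symm i.succ = i.castSucc := by
  rw [Equiv.symm_apply_eq]
  simp

theorem card_inversions_finRotate (k : ℕ) :
    (inversions (finRotate (k + 1))).card = k := by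
  have : inversions (finRotate (k + 1)) = (Finset.univ : Finset (Fin k)).image
      fun i => (0, i.succ) := by
    ext ⟨a, b⟩
    simp only [mem_inversions, Finset.mem_image, Finset.mem_univ, true_and, Prod.mk.injEq]
    constructor
    · rintro ⟨h1, h2⟩
      obtain ⟨j, rfl⟩ := Fin.exists_succ_eq.mpr (Fin.ne_zero_of_lt h1)
      refine ⟨j, ?_, rfl⟩
      by_contra ha
      obtain ⟨i, rfl⟩ := Fin.exists_succ_eq.mpr (Ne.symm ha)
      rw [finRotate_symm_succ, finRotate_symm_succ] at h2
      simp at h1 h2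
      exact lt_asymm h1 h2
    · rintro ⟨i, rfl, rfl⟩
      rw [finRotate_symm_succ, finRotate_symm_zero]
      exact ⟨Fin.succ_pos i, Fin.castSucc_lt_last i⟩
  rw [this, Finset.card_image_of_injective _ (fun i j h => by simpa using h)]
  simp

theorem card_inversions_symm {m : ℕ} (σ : Equiv.Perm (Fin m)) :
    (inversions σ.symm).card = (inversions σ).card := by
  refine Finset.card_bij (fun x _ => (σ x.2, σ x.1)) ?_ ?_ ?_
  · intro x hx
    simp only [mem_inversions, Equiv.symm_symm, Equiv.symm_apply_apply] at hx ⊢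
    exact ⟨hx.2, hx.1⟩
  · intro x _ y _ h
    simp only [Prod.mk.injEq, EmbeddingLike.apply_eq_iff_eq] at h
    exact Prod.ext h.2 h.1
  · intro x hx
    refine ⟨(σ.symm x.2, σ.symm x.1), ?_, by simp⟩
    simp only [mem_inversions, Equiv.symm_symm, Equiv.apply_symm_apply] at hx ⊢
    exact ⟨hx.2, hx.1⟩

/-- Equally spaced points on the real line, symmetric about the origin. -/
def realLine (k : ℕ) (l : Fin (k + 1)) : ℂ := ⟨2 * ((l : ℕ) : ℝ) - k, 0⟩

/-- The points `l + l i` for `l < k`, together with `w`. -/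
def withLast (k : ℕ) (w : ℂ) : Fin (k + 1) → ℂ := Function.update (stair 1) (Fin.last k) w

theorem withLast_castSucc {k : ℕ} (w : ℂ) (i : Fin k) :
    withLast k w i.castSucc = ⟨((i : ℕ) : ℝ), ((i : ℕ) : ℝ)⟩ := by
  rw [withLast, Function.update_of_ne (Fin.castSucc_lt_last i).ne]
  simp [stair]

theorem withLast_last {k : ℕ} (w : ℂ) : withLast k w (Fin.last k) = w := by
  simp [withLast]

theorem withLast_mem_reChamber {k : ℕ} {w : ℂ} (hw : (k : ℝ) ≤ w.re) :
    withLast k w ∈ reChamber (k + 1) := by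
  rw [mem_reChamber]
  intro i j hij
  obtain ⟨i, rfl⟩ := Fin.exists_castSucc_eq.mpr (Fin.ne_last_of_lt hij)
  induction j using Fin.lastCases with
  | last =>
    rw [withLast_castSucc, withLast_last]
    have : ((i : ℕ) : ℝ) < k := by exact_mod_cast i.2
    exact lt_of_lt_of_le this hw
  | cast j =>
    rw [withLast_castSucc, withLast_castSucc]
    simpa using hij

theorem withLast_mem_imChamber {k : ℕ} {w : ℂ} (hw : (k : ℝ) ≤ w.im) :
    withLast k w ∈ imChamber (k + 1) := by
  rw [mem_imChamber]
  intro i j hij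
  obtain ⟨i, rfl⟩ := Fin.exists_castSucc_eq.mpr (Fin.ne_last_of_lt hij)
  induction j using Fin.lastCases with
  | last =>
    rw [withLast_castSucc, withLast_last]
    have : ((i : ℕ) : ℝ) < k := by exact_mod_cast i.2
    exact lt_of_lt_of_le this hw
  | cast j =>
    rw [withLast_castSucc, withLast_castSucc]
    simpa using hij

theorem withLast_comp_mem_reChamber {k : ℕ} {w : ℂ} (hw : w.re < 0) :
    withLast k w ∘ (finRotate (k + 1)).symm ∈ reChamber (k + 1) := by
  rw [mem_reChamber]
  intro i j hij
  obtain ⟨j, rfl⟩ := Fin.exists_succ_eq.mpr (Fin.ne_zero_of_lt hij)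
  simp only [Function.comp_apply, finRotate_symm_succ, withLast_castSucc]
  induction i using Fin.cases with
  | zero =>
    rw [finRotate_symm_zero, withLast_last]
    exact lt_of_lt_of_le hw (Nat.cast_nonneg _)
  | succ i =>
    rw [finRotate_symm_succ, withLast_castSucc]
    simpa using hij

theorem withLast_comp_mem_imChamber {k : ℕ} {w : ℂ} (hw : w.im < 0) :
    withLast k w ∘ (finRotate (k + 1)).symm ∈ imChamber (k + 1) := by
  rw [mem_imChamber]
  intro i j hij
  obtain ⟨j, rfl⟩ := Fin.exists_succ_eq.mpr (Fin.ne_zero_of_lt hij)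
  simp only [Function.comp_apply, finRotate_symm_succ, withLast_castSucc]
  induction i using Fin.cases with
  | zero =>
    rw [finRotate_symm_zero, withLast_last]
    exact lt_of_lt_of_le hw (Nat.cast_nonneg _)
  | succ i =>
    rw [finRotate_symm_succ, withLast_castSucc]
    simpa using hij

namespace SegmentCocycle

variable {k : ℕ} {A : Type*} [AddCommGroup A] (c : SegmentCocycle k A)

/-- The total value of moving one point around the square containing all the others. -/
theorem square_eq (hk : 0 < k) :
    c.t (withLast k ⟨k, k⟩) (withLast k ⟨-1, k⟩) + c.t (withLast k ⟨-1, k⟩) (withLast k ⟨-1, -1⟩)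
      + c.t (withLast k ⟨-1, -1⟩) (withLast k ⟨k, -1⟩)
      + c.t (withLast k ⟨k, -1⟩) (withLast k ⟨k, k⟩) = (2 * k) • c.gen hk := by
  have h1 : withLast k ⟨k, k⟩ = stair 1 := by
    rw [withLast, Function.update_eq_self_iff]
    simp [stair]
  have e1 : c.t (withLast k ⟨k, k⟩) (withLast k ⟨-1, k⟩) = k • c.gen hk := by
    rw [h1, c.eq_val (withLast_mem_imChamber le_rfl) (finRotate (k + 1))
      (withLast_comp_mem_reChamber (by norm_num)), c.val_eq hk, card_inversions_finRotate]
  have e2 : c.t (withLast k ⟨-1, k⟩) (withLast k ⟨-1, -1⟩) = 0 :=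
    c.eq_zero_of_comp (finRotate (k + 1)).symm (withLast_comp_mem_reChamber (by norm_num))
      (withLast_comp_mem_reChamber (by norm_num))
  have e4 : c.t (withLast k ⟨k, -1⟩) (withLast k ⟨k, k⟩) = 0 :=
    c.reChamber_eq_zero (withLast_mem_reChamber le_rfl) (withLast_mem_reChamber le_rfl)
  have e3 : c.t (withLast k ⟨-1, -1⟩) (withLast k ⟨k, -1⟩) = k • c.gen hk := by
    rw [← c.perm (finRotate (k + 1)).symm]
    have i3 : withLast k ⟨-1, -1⟩ ∘ (finRotate (k + 1)).symm ∈ imChamber (k + 1) :=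
      withLast_comp_mem_imChamber (by norm_num)
    have i4 : withLast k ⟨k, -1⟩ ∘ (finRotate (k + 1)).symm ∈ imChamber (k + 1) :=
      withLast_comp_mem_imChamber (by norm_num)
    rw [← c.add _ _ _ _ i3 (stair_mem_imChamber 1) i4, c.reChamber_eq_zero
      (withLast_comp_mem_reChamber (by norm_num)) stair_one_mem_reChamber, zero_add,
      c.eq_val i4 (finRotate (k + 1)).symm, c.val_eq hk, card_inversions_symm,
      card_inversions_finRotate]
    rw [Equiv.symm_symm, Function.comp_assoc, Equiv.symm_comp_self, Function.comp_id]
    exact withLast_mem_reChamber le_rfl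
  rw [e1, e2, e3, e4, add_zero, add_zero, two_mul, add_smul]

/-- The total value of a full rotation. -/
theorem rotation_eq (hk : 0 < k) :
    c.t (realLine k) (Complex.I • realLine k) + c.t (Complex.I • realLine k) (-realLine k)
      + c.t (-realLine k) (-(Complex.I • realLine k))
      + c.t (-(Complex.I • realLine k)) (realLine k) = ((k + 1) * k) • c.gen hk := by
  have r0 : realLine k ∈ reChamber (k + 1) := by
    rw [mem_reChamber]; intro i j hij; simpa [realLine] using hij
  have hneg : realLine k ∘ Fin.revPerm = - realLine k := by
    funext l
    have h : ((Fin.rev l : Fin (k + 1)) : ℕ) + l = k := by rw [Fin.val_rev]; omega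
    have h' : (((Fin.rev l : Fin (k + 1)) : ℕ) : ℝ) + ((l : ℕ) : ℝ) = k := by exact_mod_cast h
    apply Complex.ext
    · simp only [Function.comp_apply, Fin.revPerm_apply, realLine, Pi.neg_apply, Complex.neg_re]
      linarith
    · simp [realLine]
  have hnegI : (Complex.I • realLine k) ∘ Fin.revPerm = -(Complex.I • realLine k) := by
    rw [← smul_neg, ← hneg]
    rfl
  have hs : LexSorted (Complex.I • realLine k) := by
    intro i j hij
    right
    simpa [realLine] using hij
  have i1 : Complex.I • realLine k ∈ imChamber (k + 1) := by
    rw [mem_imChamber]; intro i j hij; simpa [realLine] using hij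
  have hI : c.t (stair 1) (Complex.I • realLine k) = 0 := by
    have := c.swap_add (stair_mem_imChamber 1) i1
    rwa [c.sorted _ hs, add_zero] at this
  have e1 : c.t (realLine k) (Complex.I • realLine k) = 0 := by
    rw [← c.add (fun _ _ => 1 - Complex.I) (realLine k) (stair 1), hI, c.sorted, add_zero]
    · exact lexSorted_of_re (mem_reChamber.mp r0)
    · intro i j hij; simpa [realLine] using hij
    · intro i j hij
      have : ((i : ℕ) : ℝ) < ((j : ℕ) : ℝ) := by exact_mod_cast hij
      simp [stair]
      linarith
    · intro i j hij; simpa [realLine] using hij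
  have e2 : c.t (Complex.I • realLine k) (-realLine k) = c.val Fin.revPerm := by
    rw [← c.add (fun _ _ => -1 - Complex.I) (Complex.I • realLine k) (stair Fin.revPerm),
      c.eq_zero_of_comp Fin.revPerm (p := stair Fin.revPerm), add_zero, val,
      ← c.add _ (stair 1) (Complex.I • realLine k) _ (stair_mem_imChamber 1) i1
        (stair_mem_imChamber _), hI, zero_add]
    · exact stair_comp_symm_mem (Fin.revPerm : Equiv.Perm (Fin (k + 1)))
    · rw [← hneg, Function.comp_assoc]
      convert r0
      ext i
      simp
    · intro i j hij; simpa [realLine] using hij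
    · intro i j hij
      have : ((i : ℕ) : ℝ) < ((j : ℕ) : ℝ) := by exact_mod_cast hij
      have h : ∀ l, ((Fin.rev l : Fin (k + 1)) : ℕ) + l = k := by
        intro l
        rw [Fin.val_rev]; omega
      have h' : ∀ l, (((Fin.rev l : Fin (k + 1)) : ℕ) : ℝ) + ((l : ℕ) : ℝ) = k := by
        intro l
        exact_mod_cast h l
      have h1 := h' i
      have h2 := h' j
      simp [stair, -Fin.val_rev]
      linarith
    · intro i j hij; simpa [realLine] using hij
  have e3 : c.t (-realLine k) (-(Complex.I • realLine k)) = 0 := by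
    rw [← e1, ← hneg, ← hnegI, c.perm]
  have e4 : c.t (-(Complex.I • realLine k)) (realLine k) = c.val Fin.revPerm := by
    rw [← e2, ← c.perm Fin.revPerm (Complex.I • realLine k), hnegI, ← hneg, Function.comp_assoc]
    congr 2
    ext i
    simp
  rw [e1, e2, e3, e4, zero_add, add_zero, c.val_eq hk, ← add_smul, ← two_mul,
    card_inversions_revPerm]
  rfl

end SegmentCocycle

section

open scoped Topology

/-- Tuples of vectors representing pairwise distinct points of a projective line. -/
def IsGood {m n : ℕ} (v : Fin m → Fin (n + 1) → ℂ) : Prop :=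
  (∀ j, v j ≠ 0) ∧ (∀ i j, i ≠ j → LinearIndependent ℂ ![v i, v j]) ∧
    finrank ℂ (span ℂ (Set.range v)) = 2

theorem mk_ne_mk_iff {n : ℕ} {v w : Fin (n + 1) → ℂ} (hv : v ≠ 0) (hw : w ≠ 0) :
    Projectivization.mk ℂ v hv ≠ Projectivization.mk ℂ w hw ↔ LinearIndependent ℂ ![v, w] := by
  rw [LinearIndependent.pair_iff' hv, ne_comm, Ne, Projectivization.mk_eq_mk_iff', not_exists]

theorem mk_mem_Fconf_iff {m n : ℕ} {v : Fin m → Fin (n + 1) → ℂ} (hv : ∀ j, v j ≠ 0) :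
    (fun j => Projectivization.mk ℂ (v j) (hv j)) ∈ Fconf m 1 n ↔ IsGood v := by
  have hspan : span ℂ (Set.range fun j => (Projectivization.mk ℂ (v j) (hv j)).rep)
      = span ℂ (Set.range v) := by
    choose a ha using fun j => Projectivization.exists_smul_eq_mk_rep ℂ (v j) (hv j)
    apply le_antisymm
    · rw [span_le]
      rintro _ ⟨j, rfl⟩
      simp only
      rw [← ha j]
      exact smul_mem _ _ (subset_span ⟨j, rfl⟩)
    · rw [span_le]
      rintro _ ⟨j, rfl⟩
      have : v j = (a j)⁻¹ • (Projectivization.mk ℂ (v j) (hv j)).rep := by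
        rw [← ha j, inv_smul_smul]
      rw [this]
      exact smul_mem _ _ (subset_span ⟨j, rfl⟩)
  refine ⟨fun h => ⟨hv, fun i j hij => ?_, hspan ▸ h.2⟩,
    fun h => ⟨fun i j hij => ?_, hspan.symm ▸ h.2.2⟩⟩
  · rw [← mk_ne_mk_iff (hv i) (hv j)]
    exact fun h' => hij (h.1 h')
  · by_contra hne
    exact (mk_ne_mk_iff (hv i) (hv j)).mpr (h.2.1 i j hne) hij

theorem comp_perm_mem_Fconf {m n : ℕ} (σ : Equiv.Perm (Fin m)) {x : Fin m → CP n}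
    (hx : x ∈ Fconf m 1 n) : x ∘ σ ∈ Fconf m 1 n := by
  refine ⟨hx.1.comp σ.injective, ?_⟩
  change finrank ℂ (span ℂ (Set.range ((fun j => (x j).rep) ∘ σ))) = _
  rw [σ.surjective.range_comp]
  exact hx.2

/-- A tuple of vectors in a plane is good once they are pairwise independent. -/
theorem isGood_of_le {m n : ℕ} (hm : 2 ≤ m) {v : Fin m → Fin (n + 1) → ℂ}
    (h : ∀ i j, i ≠ j → LinearIndependent ℂ ![v i, v j])
    (hle : finrank ℂ (span ℂ (Set.range v)) ≤ 2) : IsGood v := by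
  have h01 := h ⟨0, by omega⟩ ⟨1, by omega⟩ (by simp)
  refine ⟨fun j => ?_, h, le_antisymm hle ?_⟩
  · have : Nontrivial (Fin m) := Fin.nontrivial_iff_two_le.mpr hm
    obtain ⟨i, hi⟩ := exists_ne j
    exact (h j i hi.symm).ne_zero 0
  · have h2 := finrank_span_eq_card h01
    refine ((Fintype.card_fin 2).symm.trans h2.symm).le.trans ?_
    apply finrank_mono
    rw [span_le]
    rintro _ ⟨i, rfl⟩
    fin_cases i <;> exact subset_span ⟨_, rfl⟩

theorem isGood_of_mem_plane {m n : ℕ} (hm : 2 ≤ m) {A B : Fin (n + 1) → ℂ} {s t : Fin m → ℂ}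
    (hAB : LinearIndependent ℂ ![A, B]) (hst : ∀ i j, i ≠ j → s i * t j - s j * t i ≠ 0) :
    IsGood fun j => s j • A + t j • B := by
  refine isGood_of_le hm (fun i j hij => ?_) ?_
  · rw [LinearIndependent.pair_iff] at hAB ⊢
    intro a b hab
    have h := hAB (a * s i + b * s j) (a * t i + b * t j) (by
      rw [← hab]; module)
    have hd := hst i j hij
    constructor
    · have : a * (s i * t j - s j * t i) = 0 := by linear_combination t j * h.1 - s j * h.2
      exact (mul_eq_zero.mp this).resolve_right hd
    · have : b * (s i * t j - s j * t i) = 0 := by linear_combination s i * h.2 - t i * h.1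
      exact (mul_eq_zero.mp this).resolve_right hd
  · have h2 : span ℂ (Set.range fun j => s j • A + t j • B) ≤ span ℂ (Set.range ![A, B]) := by
      rw [span_le]
      rintro _ ⟨j, rfl⟩
      exact add_mem (smul_mem _ _ (subset_span ⟨0, rfl⟩)) (smul_mem _ _ (subset_span ⟨1, rfl⟩))
    exact (finrank_mono h2).trans ((finrank_range_le_card ![A, B]).trans_eq (Fintype.card_fin 2))

theorem IsGood.map {m n : ℕ} (hm : 2 ≤ m) {v : Fin m → Fin (n + 1) → ℂ} (hv : IsGood v)
    (f : (Fin (n + 1) → ℂ) →ₗ[ℂ] (Fin (n + 1) → ℂ))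
    (h : ∀ i j, i ≠ j → LinearIndependent ℂ ![f (v i), f (v j)]) : IsGood fun j => f (v j) := by
  refine isGood_of_le hm h ?_
  have : Set.range (fun j => f (v j)) = f '' Set.range v := by
    rw [← Set.range_comp]; rfl
  rw [this, span_image]
  exact (finrank_map_le _ _).trans hv.2.2.le

theorem IsGood.smul_perm {m n : ℕ} {v : Fin m → Fin (n + 1) → ℂ} (hv : IsGood v)
    (σ : Equiv.Perm (Fin m)) (a : Fin m → ℂˣ) : IsGood fun j => a j • v (σ j) := by
  have hne : ∀ j, a j • v (σ j) ≠ 0 := fun j => smul_ne_zero_iff_ne (a j) |>.mpr (hv.1 _)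
  rw [← mk_mem_Fconf_iff hne]
  have h := (mk_mem_Fconf_iff hv.1).mpr hv
  have h2 : (fun j => Projectivization.mk ℂ (a j • v (σ j)) (hne j))
      = (fun j => Projectivization.mk ℂ (v j) (hv.1 j)) ∘ σ := by
    funext j
    simp only [Function.comp_apply]
    rw [Projectivization.mk_eq_mk_iff]
    exact ⟨a j, rfl⟩
  rw [h2]
  exact comp_perm_mem_Fconf σ h

/-- The space of tuples of vectors representing configurations on a line. -/
abbrev GoodTuple (m n : ℕ) := {v : Fin m → Fin (n + 1) → ℂ // IsGood v}

/-- The unordered configuration represented by a tuple of vectors. -/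
def conf {m n : ℕ} (v : GoodTuple m n) : Cconf m 1 n :=
  Quotient.mk (permSetoid m 1 n)
    ⟨fun j => Projectivization.mk ℂ (v.1 j) (v.2.1 j), (mk_mem_Fconf_iff v.2.1).mpr v.2⟩

theorem conf_eq_iff {m n : ℕ} {v w : GoodTuple m n} :
    conf v = conf w ↔
      ∃ (σ : Equiv.Perm (Fin m)) (a : Fin m → ℂˣ), ∀ j, w.1 j = a j • v.1 (σ j) := by
  constructor
  · intro h
    obtain ⟨σ, hσ⟩ := Quotient.exact h
    have h2 : ∀ j, ∃ a : ℂˣ, a • v.1 (σ j) = w.1 j := fun j =>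
      (Projectivization.mk_eq_mk_iff ..).mp (congrFun hσ j)
    choose a ha using h2
    exact ⟨σ, a, fun j => (ha j).symm⟩
  · rintro ⟨σ, a, h⟩
    refine Quotient.sound ⟨σ, ?_⟩
    funext j
    exact (Projectivization.mk_eq_mk_iff ..).mpr ⟨a j, (h j).symm⟩

theorem isOpenQuotientMap_mk' (n : ℕ) :
    IsOpenQuotientMap (Projectivization.mk' ℂ : {v : Fin (n + 1) → ℂ // v ≠ 0} → CP n) := by
  refine ⟨Quotient.mk_surjective, continuous_quotient_mk', fun U hU => ?_⟩
  have hq : Topology.IsQuotientMap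
      (Projectivization.mk' ℂ : {v : Fin (n + 1) → ℂ // v ≠ 0} → CP n) := isQuotientMap_quotient_mk'
  rw [← hq.isOpen_preimage]
  let act : ℂˣ → {v : Fin (n + 1) → ℂ // v ≠ 0} → {v : Fin (n + 1) → ℂ // v ≠ 0} := fun a v =>
    ⟨a • v.1, (smul_ne_zero_iff_ne a).mpr v.2⟩
  have : (Projectivization.mk' ℂ : {v : Fin (n + 1) → ℂ // v ≠ 0} → CP n) ⁻¹'
      ((Projectivization.mk' ℂ : {v : Fin (n + 1) → ℂ // v ≠ 0} → CP n) '' U)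
      = ⋃ a : ℂˣ, act a ⁻¹' U := by
    ext v
    simp only [Set.mem_preimage, Set.mem_image, Set.mem_iUnion]
    constructor
    · rintro ⟨w, hw, h⟩
      obtain ⟨a, ha⟩ := (Projectivization.mk_eq_mk_iff ℂ w.1 v.1 w.2 v.2).mp h
      refine ⟨a, ?_⟩
      have : act a v = w := Subtype.ext ha
      rwa [this]
    · rintro ⟨a, ha⟩
      exact ⟨_, ha, (Projectivization.mk_eq_mk_iff ℂ _ _ _ _).mpr ⟨a, rfl⟩⟩
  rw [this]
  refine isOpen_iUnion fun a => hU.preimage ?_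
  exact (continuous_const_smul a).comp continuous_subtype_val |>.subtype_mk _

theorem isOpenQuotientMap_mk_perm (m n : ℕ) :
    IsOpenQuotientMap (Quotient.mk (permSetoid m 1 n) : Fconf m 1 n → Cconf m 1 n) := by
  refine ⟨Quotient.mk_surjective, continuous_quotient_mk', fun U hU => ?_⟩
  have hq : Topology.IsQuotientMap
      (Quotient.mk (permSetoid m 1 n) : Fconf m 1 n → Cconf m 1 n) := isQuotientMap_quotient_mk'
  rw [← hq.isOpen_preimage]
  have hmem : ∀ (σ : Equiv.Perm (Fin m)) (x : Fconf m 1 n), x.1 ∘ σ ∈ Fconf m 1 n :=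
    fun σ x => comp_perm_mem_Fconf σ x.2
  have : (Quotient.mk (permSetoid m 1 n) : Fconf m 1 n → Cconf m 1 n) ⁻¹'
      ((Quotient.mk (permSetoid m 1 n) : Fconf m 1 n → Cconf m 1 n) '' U)
      = ⋃ σ : Equiv.Perm (Fin m), (fun x => (⟨x.1 ∘ σ, hmem σ x⟩ : Fconf m 1 n)) ⁻¹' U := by
    ext v
    simp only [Set.mem_preimage, Set.mem_image, Set.mem_iUnion]
    constructor
    · rintro ⟨w, hw, h⟩
      obtain ⟨σ, hσ⟩ := Quotient.exact h.symm
      refine ⟨σ, ?_⟩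
      have : (⟨v.1 ∘ σ, hmem σ v⟩ : Fconf m 1 n) = w := Subtype.ext hσ.symm
      rwa [this]
    · rintro ⟨σ, hσ⟩
      exact ⟨_, hσ, (Quotient.sound ⟨σ, rfl⟩ : Quotient.mk (permSetoid m 1 n) v = _).symm⟩
  rw [this]
  refine isOpen_iUnion fun σ => hU.preimage ?_
  refine Continuous.subtype_mk ?_ _
  exact continuous_pi fun j => (continuous_apply (σ j)).comp continuous_subtype_val

theorem isOpenQuotientMap_conf (m n : ℕ) :
    IsOpenQuotientMap (conf : GoodTuple m n → Cconf m 1 n) := by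
  let π : (Fin m → {v : Fin (n + 1) → ℂ // v ≠ 0}) → (Fin m → CP n) :=
    Pi.map fun _ => Projectivization.mk' ℂ
  have hπ : IsOpenQuotientMap π := IsOpenQuotientMap.piMap fun _ => isOpenQuotientMap_mk' n
  have hπ' : IsOpenQuotientMap ((Fconf m 1 n).restrictPreimage π) :=
    ⟨hπ.surjective.restrictPreimage _, hπ.continuous.restrictPreimage,
      hπ.isOpenMap.restrictPreimage _⟩
  let h : GoodTuple m n ≃ₜ π ⁻¹' Fconf m 1 n :=
    { toFun := fun v => ⟨fun j => ⟨v.1 j, v.2.1 j⟩, (mk_mem_Fconf_iff v.2.1).mpr v.2⟩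
      invFun := fun v => ⟨fun j => (v.1 j).1, (mk_mem_Fconf_iff fun j => (v.1 j).2).mp v.2⟩
      left_inv := fun v => rfl
      right_inv := fun v => rfl
      continuous_toFun := by
        refine Continuous.subtype_mk (continuous_pi fun j => Continuous.subtype_mk ?_ _) _
        exact (continuous_apply j).comp continuous_subtype_val
      continuous_invFun := by
        refine Continuous.subtype_mk (continuous_pi fun j => ?_) _
        exact continuous_subtype_val.comp ((continuous_apply j).comp continuous_subtype_val) }
  exact (isOpenQuotientMap_mk_perm m n).comp (hπ'.comp h.isOpenQuotientMap)

end

section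

open scoped Topology

theorem linearIndependent_pair_of_minor_ne_zero {n : ℕ} (h g : Dual ℂ (Fin (n + 1) → ℂ))
    {v w : Fin (n + 1) → ℂ} (hvw : h v * g w - h w * g v ≠ 0) : LinearIndependent ℂ ![v, w] := by
  rw [LinearIndependent.pair_iff]
  intro a b hab
  have h1 : a * h v + b * h w = 0 := by
    have := congrArg h hab
    simpa using this
  have h2 : a * g v + b * g w = 0 := by
    have := congrArg g hab
    simpa using this
  constructor
  · have : a * (h v * g w - h w * g v) = 0 := by linear_combination g w * h1 - h w * h2
    exact (mul_eq_zero.mp this).resolve_right hvw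
  · have : b * (h v * g w - h w * g v) = 0 := by linear_combination h v * h2 - g v * h1
    exact (mul_eq_zero.mp this).resolve_right hvw

/-- A tuple of vectors representing the configuration `x`. -/
def tupleOf {m n : ℕ} (x : Cconf m 1 n) : GoodTuple m n :=
  ((isOpenQuotientMap_conf m n).surjective x).choose

theorem conf_tupleOf {m n : ℕ} (x : Cconf m 1 n) : conf (tupleOf x) = x :=
  ((isOpenQuotientMap_conf m n).surjective x).choose_spec

open Classical in
/-- The image of a configuration under a matrix which is injective on its line. -/
def act {m n : ℕ} (M : Matrix (Fin (n + 1)) (Fin (n + 1)) ℂ) (x : Cconf m 1 n) : Cconf m 1 n :=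
  if h : IsGood fun j => M.mulVec ((tupleOf x).1 j) then conf ⟨_, h⟩ else x

theorem act_conf {m n : ℕ} {M : Matrix (Fin (n + 1)) (Fin (n + 1)) ℂ} {v : GoodTuple m n}
    (h : IsGood fun j => M.mulVec (v.1 j)) : act M (conf v) = conf ⟨_, h⟩ := by
  obtain ⟨σ, a, hσ⟩ := conf_eq_iff.mp (conf_tupleOf (conf v)).symm
  have h2 : ∀ j, M.mulVec ((tupleOf (conf v)).1 j) = a j • M.mulVec (v.1 (σ j)) := by
    intro j
    rw [hσ j, Units.smul_def, Matrix.mulVec_smul, Units.smul_def]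
  have h' : IsGood fun j => M.mulVec ((tupleOf (conf v)).1 j) := by
    simp only [h2]
    exact h.smul_perm σ a
  rw [act, dif_pos h']
  exact (conf_eq_iff.mpr ⟨σ, a, h2⟩).symm

theorem isOpen_isGood_mulVec {m n : ℕ} (hm : 2 ≤ m) :
    IsOpen {p : Matrix (Fin (n + 1)) (Fin (n + 1)) ℂ × GoodTuple m n |
      IsGood fun j => p.1.mulVec (p.2.1 j)} := by
  have : {p : Matrix (Fin (n + 1)) (Fin (n + 1)) ℂ × GoodTuple m n |
      IsGood fun j => p.1.mulVec (p.2.1 j)} = ⋂ i, ⋂ j, {p | i ≠ j →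
        LinearIndependent ℂ ![p.1.mulVec (p.2.1 i), p.1.mulVec (p.2.1 j)]} := by
    ext p
    simp only [Set.mem_iInter]
    exact ⟨fun h i j hij => h.2.1 i j hij, fun h => p.2.2.map hm p.1.mulVecLin h⟩
  rw [this]
  refine isOpen_iInter_of_finite fun i => isOpen_iInter_of_finite fun j => ?_
  by_cases hij : i = j
  · simp [hij]
  · simp only [ne_eq, hij, not_false_eq_true, true_imp_iff]
    have hc : ∀ i, Continuous fun p : Matrix (Fin (n + 1)) (Fin (n + 1)) ℂ × GoodTuple m n =>
        p.1.mulVec (p.2.1 i) := fun i =>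
      continuous_fst.matrix_mulVec ((continuous_apply i).comp
        (continuous_subtype_val.comp continuous_snd))
    have hc2 : Continuous fun p : Matrix (Fin (n + 1)) (Fin (n + 1)) ℂ × GoodTuple m n =>
        ![p.1.mulVec (p.2.1 i), p.1.mulVec (p.2.1 j)] := by
      refine continuous_pi fun l => ?_
      fin_cases l
      · exact hc i
      · exact hc j
    exact isOpen_setOfPred_linearIndependent.preimage hc2

theorem continuousAt_act {m n : ℕ} (hm : 2 ≤ m) {M : Matrix (Fin (n + 1)) (Fin (n + 1)) ℂ}
    {v : GoodTuple m n} (h : IsGood fun j => M.mulVec (v.1 j)) :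
    ContinuousAt (fun p : Matrix (Fin (n + 1)) (Fin (n + 1)) ℂ × Cconf m 1 n => act p.1 p.2)
      (M, conf v) := by
  have hq : IsOpenQuotientMap (Prod.map id conf : Matrix (Fin (n + 1)) (Fin (n + 1)) ℂ ×
    GoodTuple m n → Matrix (Fin (n + 1)) (Fin (n + 1)) ℂ × Cconf m 1 n) :=
    IsOpenQuotientMap.id.prodMap (isOpenQuotientMap_conf m n)
  refine (hq.continuousAt_comp_iff (x := (M, v))).mp ?_
  refine ContinuousOn.continuousAt ?_ ((isOpen_isGood_mulVec hm).mem_nhds (x := (M, v)) h)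
  rw [continuousOn_iff_continuous_domRestrict]
  have : Set.domRestrict {p : Matrix (Fin (n + 1)) (Fin (n + 1)) ℂ × GoodTuple m n |
      IsGood fun j => p.1.mulVec (p.2.1 j)} ((fun p : Matrix (Fin (n + 1)) (Fin (n + 1)) ℂ ×
        Cconf m 1 n => act p.1 p.2) ∘ Prod.map id conf) = fun p => conf ⟨_, p.2⟩ := by
    funext p
    exact act_conf p.2
  rw [this]
  refine (isOpenQuotientMap_conf m n).continuous.comp (Continuous.subtype_mk ?_ _)
  refine continuous_pi fun i => ?_
  exact (continuous_fst.comp continuous_subtype_val).matrix_mulVec ((continuous_apply i).comp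
    (continuous_subtype_val.comp (continuous_snd.comp continuous_subtype_val)))

/-- The tuples of vectors lying in the affine chart `h ≠ 0` and having distinct coordinates
`g / h`. -/
def InChart {m n : ℕ} (h g : Dual ℂ (Fin (n + 1) → ℂ)) (v : Fin m → Fin (n + 1) → ℂ) : Prop :=
  (∀ j, h (v j) ≠ 0) ∧ ∀ i j, i ≠ j → h (v i) * g (v j) - h (v j) * g (v i) ≠ 0

theorem InChart.smul_perm {m n : ℕ} {h g : Dual ℂ (Fin (n + 1) → ℂ)}
    {v : Fin m → Fin (n + 1) → ℂ} (hv : InChart h g v) (σ : Equiv.Perm (Fin m)) (a : Fin m → ℂˣ) :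
    InChart h g fun j => a j • v (σ j) := by
  refine ⟨fun j => ?_, fun i j hij => ?_⟩
  · simpa [Units.smul_def] using hv.1 (σ j)
  · have h1 := hv.2 (σ i) (σ j) (σ.injective.ne hij)
    have h2 : h (a i • v (σ i)) * g (a j • v (σ j)) - h (a j • v (σ j)) * g (a i • v (σ i))
      = (a i * a j) * (h (v (σ i)) * g (v (σ j)) - h (v (σ j)) * g (v (σ i))) := by
      simp only [Units.smul_def, map_smul, smul_eq_mul]
      ring
    rw [h2]
    exact mul_ne_zero (mul_ne_zero (a i).ne_zero (a j).ne_zero) h1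

/-- The configurations lying in an affine chart. -/
def chart (m : ℕ) {n : ℕ} (h g : Dual ℂ (Fin (n + 1) → ℂ)) : Set (Cconf m 1 n) :=
  conf '' {v | InChart h g v.1}

theorem conf_mem_chart {m n : ℕ} {h g : Dual ℂ (Fin (n + 1) → ℂ)} {v : GoodTuple m n} :
    conf v ∈ chart m h g ↔ InChart h g v.1 := by
  constructor
  · rintro ⟨w, hw, hwv⟩
    obtain ⟨σ, a, h⟩ := conf_eq_iff.mp hwv
    have := InChart.smul_perm hw σ a
    rwa [← funext h] at this
  · intro h
    exact ⟨v, h, rfl⟩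

theorem isOpen_chart (m : ℕ) {n : ℕ} (h g : Dual ℂ (Fin (n + 1) → ℂ)) :
    IsOpen (chart m h g) := by
  refine (isOpenQuotientMap_conf m n).isOpenMap _ ?_
  have hh := h.continuous_of_finiteDimensional
  have hg := g.continuous_of_finiteDimensional
  have hc : ∀ j, Continuous fun v : GoodTuple m n => v.1 j := fun j =>
    (continuous_apply j).comp continuous_subtype_val
  have : {v : GoodTuple m n | InChart h g v.1} = (⋂ j, {v | h (v.1 j) ≠ 0}) ∩ ⋂ i, ⋂ j,
      {v | i ≠ j → h (v.1 i) * g (v.1 j) - h (v.1 j) * g (v.1 i) ≠ 0} := by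
    ext v
    simp [InChart]
  rw [this]
  refine IsOpen.inter (isOpen_iInter_of_finite fun j => ?_)
    (isOpen_iInter_of_finite fun i => isOpen_iInter_of_finite fun j => ?_)
  · exact isOpen_ne_fun (hh.comp (hc j)) continuous_const
  · by_cases hij : i = j
    · simp [hij]
    · simp only [ne_eq, hij, not_false_eq_true, true_imp_iff]
      exact isOpen_ne_fun (((hh.comp (hc i)).mul (hg.comp (hc j))).sub
        ((hh.comp (hc j)).mul (hg.comp (hc i)))) continuous_const

/-- The ordered configuration space of the plane. -/
abbrev PlaneConf (m : ℕ) := {z : Fin m → ℂ // Function.Injective z}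

theorem single_zero_one_independent (n : ℕ) :
    LinearIndependent ℂ ![(Pi.single 0 1 : Fin (n + 2 + 1) → ℂ), Pi.single 1 1] := by
  refine linearIndependent_pair_of_minor_ne_zero (LinearMap.proj 0) (LinearMap.proj 1) ?_
  simp

/-- The vectors `(1, z j, 0, …, 0)`. -/
def affTuple {m : ℕ} (hm : 2 ≤ m) (n : ℕ) (z : PlaneConf m) : GoodTuple m (n + 2) :=
  ⟨fun j => (1 : ℂ) • (Pi.single 0 1 : Fin (n + 2 + 1) → ℂ) + z.1 j • Pi.single 1 1,
    isGood_of_mem_plane (s := fun _ => 1) (t := z.1) hm (single_zero_one_independent n)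
      (by
        intro i j hij
        simpa [sub_ne_zero] using z.2.ne hij.symm)⟩

/-- The points of the plane, as a configuration on a projective line. -/
def aff {m : ℕ} (hm : 2 ≤ m) (n : ℕ) (z : PlaneConf m) : Cconf m 1 (n + 2) := conf (affTuple hm n z)

theorem continuous_aff {m : ℕ} (hm : 2 ≤ m) (n : ℕ) : Continuous (aff hm n) := by
  refine (isOpenQuotientMap_conf m (n + 2)).continuous.comp (Continuous.subtype_mk ?_ _)
  refine continuous_pi fun j => ?_
  exact continuous_const.add (((continuous_apply j).comp continuous_subtype_val).smul
    continuous_const)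

theorem aff_eq_of_comp {m : ℕ} (hm : 2 ≤ m) (n : ℕ) {z w : PlaneConf m} (σ : Equiv.Perm (Fin m))
    (h : w.1 = z.1 ∘ σ) : aff hm n w = aff hm n z := by
  refine (conf_eq_iff.mpr ⟨σ, 1, fun j => ?_⟩).symm
  simp [affTuple, h]

/-- The unit upper triangular matrix with the entries of `N` above the diagonal. -/
def triMat {n : ℕ} (N : Matrix (Fin (n + 1)) (Fin (n + 1)) ℂ) :
    Matrix (Fin (n + 1)) (Fin (n + 1)) ℂ :=
  Matrix.of fun i j => if i = j then 1 else if i < j then N i j else 0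

theorem mulVec_triMat_injective {n : ℕ} (N : Matrix (Fin (n + 1)) (Fin (n + 1)) ℂ) :
    Function.Injective (triMat N).mulVec := by
  rw [Matrix.mulVec_injective_iff_isUnit, Matrix.isUnit_iff_isUnit_det,
    Matrix.det_of_isUpperTriangular]
  · simp [triMat]
  · intro i j hij
    simp only [id_eq] at hij
    simp [triMat, hij.ne', hij.le]

theorem continuous_triMat {n : ℕ} :
    Continuous (triMat : Matrix (Fin (n + 1)) (Fin (n + 1)) ℂ → _) := by
  refine continuous_matrix fun i j => ?_
  simp only [triMat, Matrix.of_apply]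
  split_ifs
  · fun_prop
  · exact continuous_id.matrix_elem i j
  · fun_prop

theorem triMat_zero {n : ℕ} : triMat (0 : Matrix (Fin (n + 1)) (Fin (n + 1)) ℂ) = 1 := by
  ext i j
  simp [triMat, Matrix.one_apply]

theorem isGood_triMat {m n : ℕ} (hm : 2 ≤ m) (N : Matrix (Fin (n + 1)) (Fin (n + 1)) ℂ)
    (v : GoodTuple m n) : IsGood fun j => (triMat N).mulVec (v.1 j) := by
  refine v.2.map hm (triMat N).mulVecLin fun i j hij => ?_
  have h := (v.2.2.1 i j hij).map' (triMat N).mulVecLin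
    (LinearMap.ker_eq_bot.mpr (mulVec_triMat_injective N))
  have he : ⇑(triMat N).mulVecLin ∘ ![v.1 i, v.1 j]
      = ![(triMat N).mulVecLin (v.1 i), (triMat N).mulVecLin (v.1 j)] := by
    funext l
    fin_cases l <;> rfl
  rwa [he] at h

theorem continuous_act_triMat {m n : ℕ} (hm : 2 ≤ m) :
    Continuous fun p : Matrix (Fin (n + 1)) (Fin (n + 1)) ℂ × Cconf m 1 n =>
      act (triMat p.1) p.2 := by
  rw [continuous_iff_continuousAt]
  rintro ⟨N, x⟩
  obtain ⟨v, rfl⟩ := (isOpenQuotientMap_conf m n).surjective x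
  exact ContinuousAt.comp (x := (N, conf v))
    (g := fun p : Matrix (Fin (n + 1)) (Fin (n + 1)) ℂ × Cconf m 1 n => act p.1 p.2)
    (f := fun p => (triMat p.1, p.2)) (continuousAt_act hm (isGood_triMat hm N v))
    ((continuous_triMat.comp continuous_fst).prodMk continuous_snd).continuousAt

theorem act_one {m n : ℕ} (x : Cconf m 1 n) : act 1 x = x := by
  obtain ⟨v, rfl⟩ := (isOpenQuotientMap_conf m n).surjective x
  have h : IsGood fun j => (1 : Matrix (Fin (n + 1)) (Fin (n + 1)) ℂ).mulVec (v.1 j) := by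
    simpa using v.2
  rw [act_conf h]
  congr 1
  apply Subtype.ext
  simp

/-- The matrix scaling all but the first two coordinates. -/
def contr (n : ℕ) (u : ℂ) : Matrix (Fin (n + 2 + 1)) (Fin (n + 2 + 1)) ℂ :=
  Matrix.diagonal fun i => if i ≤ 1 then 1 else u

theorem contr_mulVec_zero {n : ℕ} (u : ℂ) (v : Fin (n + 2 + 1) → ℂ) :
    (contr n u).mulVec v 0 = v 0 := by
  simp [contr, Matrix.mulVec_diagonal]

theorem contr_mulVec_one {n : ℕ} (u : ℂ) (v : Fin (n + 2 + 1) → ℂ) :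
    (contr n u).mulVec v 1 = v 1 := by
  simp [contr, Matrix.mulVec_diagonal]

/-- The standard affine chart. -/
abbrev stdChart (m n : ℕ) : Set (Cconf m 1 (n + 2)) := chart m (LinearMap.proj 0) (LinearMap.proj 1)

theorem isGood_contr {m n : ℕ} (hm : 2 ≤ m) (u : ℂ) (v : GoodTuple m (n + 2))
    (hv : InChart (LinearMap.proj 0) (LinearMap.proj 1) v.1) :
    IsGood fun j => (contr n u).mulVec (v.1 j) := by
  refine v.2.map hm (contr n u).mulVecLin fun i j hij => ?_
  refine linearIndependent_pair_of_minor_ne_zero (LinearMap.proj 0) (LinearMap.proj 1) ?_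
  simpa [contr_mulVec_zero, contr_mulVec_one] using hv.2 i j hij

theorem continuousAt_act_contr {m n : ℕ} (hm : 2 ≤ m) (u : ℂ) {x : Cconf m 1 (n + 2)}
    (hx : x ∈ stdChart m n) :
    ContinuousAt (fun p : ℂ × Cconf m 1 (n + 2) => act (contr n p.1) p.2) (u, x) := by
  obtain ⟨v, hv, rfl⟩ := hx
  have hc : Continuous (contr n) := by
    refine continuous_matrix fun i j => ?_
    simp only [contr, Matrix.diagonal_apply]
    split_ifs <;> fun_prop
  exact ContinuousAt.comp (x := (u, conf v))
    (g := fun p : Matrix (Fin (n + 2 + 1)) (Fin (n + 2 + 1)) ℂ × Cconf m 1 (n + 2) => act p.1 p.2)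
    (f := fun p => (contr n p.1, p.2))
    (continuousAt_act hm (isGood_contr hm u v hv))
    ((hc.comp continuous_fst).prodMk continuous_snd).continuousAt

theorem act_contr_one {m n : ℕ} (x : Cconf m 1 (n + 2)) : act (contr n 1) x = x := by
  have : contr n 1 = 1 := by simp [contr]
  rw [this, act_one]

theorem InChart.injective_div {m n : ℕ} {h g : Dual ℂ (Fin (n + 1) → ℂ)}
    {v : Fin m → Fin (n + 1) → ℂ} (hv : InChart h g v) :
    Function.Injective fun j => g (v j) / h (v j) := by
  intro i j hij
  by_contra hne
  have h1 := hv.1 i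
  have h2 := hv.1 j
  simp only at hij
  rw [div_eq_div_iff h1 h2] at hij
  exact hv.2 i j hne (by linear_combination -hij)

theorem act_contr_zero {m n : ℕ} (hm : 2 ≤ m) (v : GoodTuple m (n + 2))
    (hv : InChart (LinearMap.proj 0) (LinearMap.proj 1) v.1) :
    act (contr n 0) (conf v) = aff hm n ⟨_, hv.injective_div⟩ := by
  rw [act_conf (isGood_contr hm 0 v hv)]
  refine (conf_eq_iff.mpr ⟨1, fun j => Units.mk0 _ (hv.1 j), fun j => ?_⟩).symm
  have h0 : v.1 j 0 ≠ 0 := hv.1 j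
  funext i
  simp only [affTuple, contr, Matrix.mulVec_diagonal, Equiv.Perm.coe_one, id_eq, Units.smul_def,
    Units.val_mk0, Pi.smul_apply, Pi.add_apply, smul_eq_mul, LinearMap.proj_apply, Pi.single_apply]
  by_cases hi0 : i = 0
  · subst hi0
    simp
  · by_cases hi1 : i = 1
    · subst hi1
      simp
      field_simp
    · have : ¬ i ≤ 1 := by
        simp only [Fin.ext_iff, Fin.le_def, Fin.val_zero, Fin.val_one] at *
        omega
      simp [hi0, hi1, this]

end

section

open scoped unitInterval Topology

/-- Permutation of the points of a configuration. -/
def permMap {m : ℕ} (τ : Equiv.Perm (Fin m)) : C(PlaneConf m, PlaneConf m) where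
  toFun z := ⟨z.1 ∘ τ, z.2.comp τ.injective⟩
  continuous_toFun := by
    refine Continuous.subtype_mk ?_ _
    exact continuous_pi fun j => (continuous_apply (τ j)).comp continuous_subtype_val

/-- The straight segment between two configurations. -/
def segPath {m : ℕ} (p q : Fin m → ℂ)
    (h : ∀ t : I, Function.Injective (AffineMap.lineMap (k := ℝ) p q (t : ℝ))) :
    C(I, PlaneConf m) where
  toFun t := ⟨_, h t⟩
  continuous_toFun := by
    refine Continuous.subtype_mk ?_ _
    exact AffineMap.lineMap_continuous.comp continuous_subtype_val

namespace PathCocycle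

variable {m : ℕ} {A : Type*} [AddCommGroup A]

open Classical in
/-- The value of a path cocycle on the straight segment between two configurations. -/
def segVal (c : PathCocycle (PlaneConf m) A) (p q : Fin m → ℂ) : A :=
  if h : ∀ t : I, Function.Injective (AffineMap.lineMap (k := ℝ) p q (t : ℝ)) then
    c.toFun (segPath p q h) else 0

theorem segVal_eq (c : PathCocycle (PlaneConf m) A) {p q : Fin m → ℂ}
    (h : ∀ t : I, Function.Injective (AffineMap.lineMap (k := ℝ) p q (t : ℝ))) :
    c.segVal p q = c.toFun (segPath p q h) := dif_pos h

theorem exists_potential_of_convex (c : PathCocycle (PlaneConf m) A) {C : Set (Fin m → ℂ)}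
    (hC : Convex ℝ C) (hinj : ∀ z ∈ C, Function.Injective z) :
    ∃ E : (Fin m → ℂ) → A, (∀ γ : C(I, PlaneConf m), (∀ t, (γ t).1 ∈ C) →
      c.toFun γ = E (γ 1).1 - E (γ 0).1) ∧ ∀ p ∈ C, ∀ q ∈ C, c.segVal p q = E q - E p := by
  classical
  suffices h : ∃ E : (Fin m → ℂ) → A, ∀ γ : C(I, PlaneConf m), (∀ t, (γ t).1 ∈ C) →
      c.toFun γ = E (γ 1).1 - E (γ 0).1 by
    obtain ⟨E, hE⟩ := h
    refine ⟨E, hE, fun p hp q hq => ?_⟩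
    have hmem : ∀ t : I, AffineMap.lineMap (k := ℝ) p q (t : ℝ) ∈ C := fun t =>
      hC.lineMap_mem hp hq t.2
    rw [c.segVal_eq fun t => hinj _ (hmem t), hE _ hmem]
    simp [segPath]
  rcases C.eq_empty_or_nonempty with rfl | hne
  · exact ⟨fun _ => 0, fun γ h => absurd (h 0) (Set.notMem_empty _)⟩
  have : ContractibleSpace C := hC.contractibleSpace hne
  let f : C(C, PlaneConf m) := ⟨fun z => ⟨z.1, hinj z.1 z.2⟩, by fun_prop⟩
  obtain ⟨E, hE⟩ := (c.comap f).exists_isPotential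
  refine ⟨fun z => if h : z ∈ C then E ⟨z, h⟩ else 0, fun γ h => ?_⟩
  have := hE ⟨fun t => ⟨(γ t).1, h t⟩, by fun_prop⟩
  simp only [h, dif_pos]
  exact this

/-- Invariance of a path cocycle under permutation of the points. -/
def PermInvariant (c : PathCocycle (PlaneConf m) A) : Prop :=
  ∀ τ γ, c.toFun ((permMap τ).comp γ) = c.toFun γ

theorem lineMap_comp_perm (p q : Fin m → ℂ) (τ : Equiv.Perm (Fin m)) (t : ℝ) :
    AffineMap.lineMap (k := ℝ) (p ∘ τ) (q ∘ τ) t = AffineMap.lineMap (k := ℝ) p q t ∘ τ := by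
  funext i
  simp [AffineMap.lineMap_apply]

theorem PermInvariant.segVal_comp {c : PathCocycle (PlaneConf m) A} (hc : c.PermInvariant)
    (τ : Equiv.Perm (Fin m)) (p q : Fin m → ℂ) : c.segVal (p ∘ τ) (q ∘ τ) = c.segVal p q := by
  by_cases h : ∀ t : I, Function.Injective (AffineMap.lineMap (k := ℝ) p q (t : ℝ))
  · have h' : ∀ t : I,
        Function.Injective (AffineMap.lineMap (k := ℝ) (p ∘ τ) (q ∘ τ) (t : ℝ)) := fun t => by
      rw [lineMap_comp_perm]
      exact (h t).comp τ.injective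
    rw [c.segVal_eq h, c.segVal_eq h', ← hc τ (segPath p q h)]
    congr 1
  · have h' : ¬ ∀ t : I,
        Function.Injective (AffineMap.lineMap (k := ℝ) (p ∘ τ) (q ∘ τ) (t : ℝ)) := fun h' => by
      refine h fun t => ?_
      have := h' t
      rw [lineMap_comp_perm] at this
      simpa [Function.comp_assoc] using this.comp τ.symm.injective
    rw [segVal, segVal, dif_neg h, dif_neg h']

theorem segVal_self (c : PathCocycle (PlaneConf m) A) (p : Fin m → ℂ) : c.segVal p p = 0 := by
  by_cases h : ∀ t : I, Function.Injective (AffineMap.lineMap (k := ℝ) p p (t : ℝ))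
  · have h0 : Function.Injective p := by simpa using h 0
    rw [c.segVal_eq h, ← c.map_const ⟨p, h0⟩]
    congr 1
    ext1 t
    apply Subtype.ext
    simp [segPath]
  · rw [segVal, dif_neg h]

/-- The value of a path cocycle on the segment from the sorted configuration to `stair 1`. -/
def sortVal (c : PathCocycle (PlaneConf m) A) (z : Fin m → ℂ) : A :=
  c.segVal (z ∘ lexSort z) (stair 1)

theorem sortVal_comp (c : PathCocycle (PlaneConf m) A) (z : Fin m → ℂ) (τ : Equiv.Perm (Fin m)) :
    c.sortVal (z ∘ τ) = c.sortVal z := by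
  rw [sortVal, comp_perm_comp_lexSort, sortVal]

theorem lexSorted_stair_one : LexSorted (stair (1 : Equiv.Perm (Fin m))) :=
  lexSorted_of_re (mem_reChamber.mp stair_one_mem_reChamber)

theorem sortVal_of_lexSorted (c : PathCocycle (PlaneConf m) A) {z : Fin m → ℂ} (hz : LexSorted z) :
    c.sortVal z = c.segVal z (stair 1) := by
  rw [sortVal, hz.lexSort_eq]
  rfl

/-- The segment cocycle of a permutation invariant path cocycle, normalized to vanish on sorted
configurations. -/
def PermInvariant.segmentCocycle {k : ℕ} {c : PathCocycle (PlaneConf (k + 1)) A}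
    (hc : c.PermInvariant) : SegmentCocycle k A where
  t p q := c.segVal p q - c.sortVal p + c.sortVal q
  add ω p q r hp hq hr := by
    obtain ⟨E, -, hE⟩ := c.exists_potential_of_convex (convex_wedge ω)
      fun z hz => injective_of_mem_wedge hz
    rw [hE p hp q hq, hE q hq r hr, hE p hp r hr]
    abel
  perm τ p q := by rw [hc.segVal_comp, sortVal_comp, sortVal_comp]
  sorted p hp := by
    rw [c.sortVal_of_lexSorted hp, c.sortVal_of_lexSorted lexSorted_stair_one, segVal_self,
      sub_self, add_zero]

theorem PermInvariant.isPotential {k : ℕ} {c : PathCocycle (PlaneConf (k + 1)) A}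
    (hc : c.PermInvariant) (h0 : ∀ τ, hc.segmentCocycle.val τ = 0) :
    c.IsPotential fun z => - c.sortVal z.1 := by
  refine c.isPotential_of_locally _ fun z => ?_
  obtain ⟨C, hC, hCo, hzC, hinj, ht⟩ := SegmentCocycle.exists_convex_eq_zero _ h0 z.2
  obtain ⟨E, hE1, hE2⟩ := c.exists_potential_of_convex hC hinj
  refine ⟨_, (hCo.preimage continuous_subtype_val).mem_nhds hzC, fun γ hγ => ?_⟩
  have h1 := ht _ (hγ 0) _ (hγ 1)
  have h2 : c.segVal (γ 0).1 (γ 1).1 - c.sortVal (γ 0).1 + c.sortVal (γ 1).1 = 0 := h1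
  rw [hE2 _ (hγ 0) _ (hγ 1)] at h2
  rw [hE1 γ hγ]
  rw [← sub_eq_zero, ← h2]
  abel
end PathCocycle

/-- The map `aff` as a bundled continuous map. -/
def affMap {m : ℕ} (hm : 2 ≤ m) (n : ℕ) : C(PlaneConf m, Cconf m 1 (n + 2)) :=
  ⟨aff hm n, continuous_aff hm n⟩

theorem permInvariant_comap_aff {m n : ℕ} (hm : 2 ≤ m) {A : Type*} [AddCommGroup A]
    (c : PathCocycle (Cconf m 1 (n + 2)) A) : (c.comap (affMap hm n)).PermInvariant := by
  intro τ γ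
  change c.toFun _ = c.toFun _
  congr 1
  ext1 t
  exact aff_eq_of_comp hm n τ rfl

end

section

open scoped unitInterval Topology

namespace PathCocycle

variable {m n k : ℕ} {A : Type*} [AddCommGroup A]

/-- The value on segments of a family of configurations which contracts. -/
theorem exists_segVal_eq_sub (hm : 2 ≤ m) (c : PathCocycle (Cconf m 1 (n + 2)) A) {W : Set ℂ}
    (P : ℂ → Fin m → ℂ)
    (hP : ∀ w w' (t : ℝ), P (AffineMap.lineMap w w' t) = AffineMap.lineMap (P w) (P w') t)
    (v : W × I → GoodTuple m (n + 2)) (hv : Continuous v)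
    (h0 : ∀ w : W, ∃ h : Function.Injective (P w), conf (v (w, 0)) = aff hm n ⟨P w, h⟩)
    (h1 : ∀ w w' : W, conf (v (w, 1)) = conf (v (w', 1))) :
    ∃ R : ℂ → A, ∀ w w', (∀ t ∈ Set.Icc (0 : ℝ) 1, AffineMap.lineMap w w' t ∈ W) →
      (c.comap (affMap hm n)).segVal (P w) (P w') = R w - R w' := by
  classical
  let F : C(W × I, Cconf m 1 (n + 2)) :=
    ⟨fun x => conf (v x), (isOpenQuotientMap_conf m (n + 2)).continuous.comp hv⟩
  refine ⟨fun w => if hw : w ∈ W then c.toFun (F.comp ⟨fun t => (⟨w, hw⟩, t), by fun_prop⟩) else 0,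
    fun w w' hw => ?_⟩
  have hw0 : w ∈ W := by simpa using hw 0 (by simp)
  have hw1 : w' ∈ W := by simpa using hw 1 (by simp)
  have hinj : ∀ t : I, Function.Injective (AffineMap.lineMap (k := ℝ) (P w) (P w') (t : ℝ)) := by
    intro t
    rw [← hP]
    exact (h0 ⟨_, hw t t.2⟩).1
  let H : C(I × I, Cconf m 1 (n + 2)) := F.comp
    ⟨fun x => (⟨AffineMap.lineMap w w' (x.1 : ℝ), hw x.1 x.1.2⟩, x.2), by
      refine Continuous.prodMk (Continuous.subtype_mk ?_ _) continuous_snd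
      exact AffineMap.lineMap_continuous.comp (continuous_subtype_val.comp continuous_fst)⟩
  have hsq := c.square H
  have e1 : H.comp ⟨fun t => (t, 1), by fun_prop⟩
      = ContinuousMap.const I (conf (v (⟨w, hw0⟩, 1))) := by
    ext1 t
    exact h1 _ _
  have e2 : H.comp ⟨fun t => (t, 0), by fun_prop⟩ = (affMap hm n).comp (segPath _ _ hinj) := by
    ext1 t
    obtain ⟨h, h'⟩ := h0 ⟨_, hw t t.2⟩
    refine h'.trans ?_
    change aff hm n _ = aff hm n _
    congr 1
    exact Subtype.ext (hP w w' t)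
  have e3 : H.comp ⟨fun t => (0, t), by fun_prop⟩
      = F.comp ⟨fun t => (⟨w, hw0⟩, t), by fun_prop⟩ := by
    ext1 t
    simp [H]
  have e4 : H.comp ⟨fun t => (1, t), by fun_prop⟩
      = F.comp ⟨fun t => (⟨w', hw1⟩, t), by fun_prop⟩ := by
    ext1 t
    simp [H]
  rw [e1, e2, e3, e4, c.map_const, add_zero] at hsq
  rw [segVal_eq _ hinj]
  simp only [hw0, hw1, dif_pos]
  rw [hsq]
  exact (add_sub_cancel_right _ _).symm

theorem exists_segVal_rotation (hm : 2 ≤ m) (c : PathCocycle (Cconf m 1 (n + 2)) A)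
    {z : Fin m → ℂ} (hz : Function.Injective z) :
    ∃ R : ℂ → A, ∀ w w', (∀ t ∈ Set.Icc (0 : ℝ) 1, AffineMap.lineMap w w' t ≠ (0 : ℂ)) →
      (c.comap (affMap hm n)).segVal (w • z) (w' • z) = R w - R w' := by
  let B : {w : ℂ | w ≠ 0} × I → Fin (n + 2 + 1) → ℂ := fun x =>
    ((1 - ((x.2 : ℝ) : ℂ)) * x.1.1) • Pi.single 1 1 + ((x.2 : ℝ) : ℂ) • Pi.single 2 1
  have hB1 : ∀ x, B x 1 = (1 - ((x.2 : ℝ) : ℂ)) * x.1.1 := by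
    intro x
    have : (2 : Fin (n + 2 + 1)) ≠ 1 := by
      simp [Fin.ext_iff, Nat.mod_eq_of_lt (show 2 < n + 2 + 1 by omega)]
    simp [B, this.symm]
  have hB2 : ∀ x, B x 2 = ((x.2 : ℝ) : ℂ) := by
    intro x
    have : (2 : Fin (n + 2 + 1)) ≠ 1 := by
      simp [Fin.ext_iff, Nat.mod_eq_of_lt (show 2 < n + 2 + 1 by omega)]
    simp [B, this]
  have hB0 : ∀ x, B x 0 = 0 := by
    intro x
    have : (2 : Fin (n + 2 + 1)) ≠ 0 := by
      simp [Fin.ext_iff, Nat.mod_eq_of_lt (show 2 < n + 2 + 1 by omega)]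
    simp [B, this.symm]
  have hBc : Continuous B := by
    fun_prop
  have hli : ∀ x, LinearIndependent ℂ ![Pi.single 0 1, B x] := by
    intro x
    by_cases hx : ((x.2 : ℝ) : ℂ) = 0
    · refine linearIndependent_pair_of_minor_ne_zero (LinearMap.proj 0) (LinearMap.proj 1) ?_
      have : x.1.1 ≠ 0 := x.1.2
      simpa [hB1, hB0, hx] using this
    · refine linearIndependent_pair_of_minor_ne_zero (LinearMap.proj 0) (LinearMap.proj 2) ?_
      simpa [hB2, hB0] using hx
  have hst : ∀ i j, i ≠ j → (1 : ℂ) * z j - 1 * z i ≠ 0 := by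
    intro i j hij
    simpa [sub_ne_zero] using hz.ne hij.symm
  refine c.exists_segVal_eq_sub hm (fun w => w • z) ?_
    (fun x => ⟨_, isGood_of_mem_plane (s := fun _ => 1) (t := z) hm (hli x) hst⟩) ?_ ?_ ?_
  · intro w w' t
    funext i
    simp [AffineMap.lineMap_apply]
    ring
  · refine Continuous.subtype_mk (continuous_pi fun i => ?_) _
    fun_prop
  · intro w
    refine ⟨fun i j hij => hz (smul_right_injective ℂ w.2 hij), ?_⟩
    refine congrArg conf (Subtype.ext ?_)
    funext i
    simp [affTuple, B, smul_smul, mul_comm]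
  · intro w w'
    refine congrArg conf (Subtype.ext ?_)
    simp [B]

theorem exists_segVal_withLast (hk : 0 < k) (hm : 2 ≤ k + 1)
    (c : PathCocycle (Cconf (k + 1) 1 (n + 2)) A) :
    ∃ R : ℂ → A, ∀ w w', (∀ t ∈ Set.Icc (0 : ℝ) 1, ∀ l : Fin k, ∀ r ∈ Set.Icc (0 : ℝ) 1,
        AffineMap.lineMap w w' t ≠ (⟨r * l, r * l⟩ : ℂ)) →
      (c.comap (affMap hm n)).segVal (withLast k w) (withLast k w') = R w - R w' := by
  let W : Set ℂ := {w | ∀ l : Fin k, ∀ r ∈ Set.Icc (0 : ℝ) 1, w ≠ (⟨r * l, r * l⟩ : ℂ)}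
  let s : W × I → Fin (k + 1) → ℂ := fun x => Function.update 1 (Fin.last k) (1 - ((x.2 : ℝ) : ℂ))
  have hs1 : ∀ x (l : Fin k), s x l.castSucc = 1 := by
    intro x l
    simp [s]
  have hs2 : ∀ x, s x (Fin.last k) = 1 - ((x.2 : ℝ) : ℂ) := by
    intro x
    simp [s]
  have hs : Continuous s := by
    refine continuous_pi fun i => ?_
    induction i using Fin.lastCases with
    | last => simp only [hs2]; fun_prop
    | cast i => simp only [hs1]; fun_prop
  have hl : Continuous fun x : W × I => withLast k x.1.1 := by
    refine continuous_pi fun i => ?_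
    induction i using Fin.lastCases with
    | last => simp only [withLast_last]; fun_prop
    | cast i => simp only [withLast_castSucc]; fun_prop
  have hW : ∀ (x : W × I) (l : Fin k), (1 - ((x.2 : ℝ) : ℂ)) * (⟨l, l⟩ : ℂ) ≠ x.1.1 := by
    intro x l h
    refine x.1.2 l (1 - x.2) ⟨by linarith [x.2.2.2], by linarith [x.2.2.1]⟩ ?_
    rw [← h]
    apply Complex.ext <;> simp
  have hinj : ∀ w : W, Function.Injective (withLast k w.1) := by
    have key : ∀ (w : W) (i : Fin k), withLast k w.1 i.castSucc ≠ withLast k w.1 (Fin.last k) := by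
      intro w i h
      rw [withLast_castSucc, withLast_last] at h
      refine hW (w, 0) i ?_
      simpa using h
    intro w i j hij
    induction i using Fin.lastCases with
    | last =>
      induction j using Fin.lastCases with
      | last => rfl
      | cast j => exact absurd hij.symm (key w j)
    | cast i =>
      induction j using Fin.lastCases with
      | last => exact absurd hij (key w i)
      | cast j =>
        rw [withLast_castSucc, withLast_castSucc] at hij
        simpa [Fin.ext_iff] using hij
  have hst : ∀ (x : W × I) i j, i ≠ j →
      s x i * withLast k x.1.1 j - s x j * withLast k x.1.1 i ≠ 0 := by
    intro x i j hij
    rw [sub_ne_zero]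
    induction i using Fin.lastCases with
    | last =>
      induction j using Fin.lastCases with
      | last => exact absurd rfl hij
      | cast j =>
        rw [hs1, hs2, withLast_last, one_mul, withLast_castSucc]
        exact hW x j
    | cast i =>
      induction j using Fin.lastCases with
      | last =>
        rw [hs1, hs2, withLast_last, one_mul, withLast_castSucc]
        exact (hW x i).symm
      | cast j =>
        rw [hs1, hs1, one_mul, one_mul]
        exact (hinj x.1).ne hij.symm
  refine c.exists_segVal_eq_sub hm (W := W) (withLast k) ?_ (fun x => ⟨_, isGood_of_mem_plane
    (s := s x) (t := withLast k x.1.1) hm (single_zero_one_independent n) (hst x)⟩) ?_ ?_ ?_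
  · intro w w' t
    funext i
    induction i using Fin.lastCases with
    | last => simp [AffineMap.lineMap_apply, withLast_last]
    | cast i => simp [AffineMap.lineMap_apply, withLast_castSucc]
  · refine Continuous.subtype_mk (continuous_pi fun i => ?_) _
    exact (((continuous_apply i).comp hs).smul continuous_const).add
      (((continuous_apply i).comp hl).smul continuous_const)
  · intro w
    refine ⟨hinj w, congrArg conf (Subtype.ext ?_)⟩
    funext i
    simp [affTuple, s]
  · intro w w'
    have hne : ∀ w : W, w.1 ≠ 0 := by
      intro w h
      refine w.2 ⟨0, hk⟩ 0 (by simp) ?_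
      rw [h]
      apply Complex.ext <;> simp
    refine conf_eq_iff.mpr ⟨1, Function.update 1 (Fin.last k)
      (Units.mk0 (w'.1 / w.1) (div_ne_zero (hne w') (hne w))), fun j => ?_⟩
    have := hne w
    induction j using Fin.lastCases with
    | last => simp [hs2, withLast_last, Units.smul_def, smul_smul, this]
    | cast j => simp [hs1, withLast_castSucc]

theorem gen_relations (hk : 0 < k) (hm : 2 ≤ k + 1) (c : PathCocycle (Cconf (k + 1) 1 (n + 2)) A) :
    ((k + 1) * k) • (permInvariant_comap_aff hm c).segmentCocycle.gen hk = 0 ∧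
      (2 * k) • (permInvariant_comap_aff hm c).segmentCocycle.gen hk = 0 := by
  constructor
  · rw [← SegmentCocycle.rotation_eq]
    have hz : Function.Injective (realLine k) := by
      intro i j hij
      simpa [realLine, Fin.ext_iff] using hij
    obtain ⟨R, hR⟩ := c.exists_segVal_rotation (n := n) hm hz
    have e1 := hR 1 Complex.I (fun t ht h => by
      have h1 := congrArg Complex.re h
      have h2 := congrArg Complex.im h
      simp [AffineMap.lineMap_apply] at h1 h2
      linarith)
    have e2 := hR Complex.I (-1) (fun t ht h => by
      have h1 := congrArg Complex.re h
      have h2 := congrArg Complex.im h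
      simp [AffineMap.lineMap_apply] at h1 h2
      linarith)
    have e3 := hR (-1) (-Complex.I) (fun t ht h => by
      have h1 := congrArg Complex.re h
      have h2 := congrArg Complex.im h
      simp [AffineMap.lineMap_apply] at h1 h2
      linarith)
    have e4 := hR (-Complex.I) 1 (fun t ht h => by
      have h1 := congrArg Complex.re h
      have h2 := congrArg Complex.im h
      simp [AffineMap.lineMap_apply] at h1 h2
      linarith)
    simp only [one_smul, neg_smul] at e1 e2 e3 e4
    simp only [PermInvariant.segmentCocycle]
    rw [e1, e2, e3, e4]
    abel
  · rw [← SegmentCocycle.square_eq]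
    obtain ⟨R, hR⟩ := c.exists_segVal_withLast (n := n) hk hm
    have hlt : ∀ (l : Fin k) (r : ℝ), r ∈ Set.Icc (0 : ℝ) 1 → 0 ≤ r * l ∧ r * l < k := by
      intro l r hr
      have h1 : ((l : ℕ) : ℝ) < k := by exact_mod_cast l.2
      exact ⟨mul_nonneg hr.1 (Nat.cast_nonneg _),
        lt_of_le_of_lt (mul_le_of_le_one_left (Nat.cast_nonneg _) hr.2) h1⟩
    have e1 := hR ⟨k, k⟩ ⟨-1, k⟩ (fun t ht l r hr h => by
      have h2 := congrArg Complex.im h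
      simp [AffineMap.lineMap_apply] at h2
      linarith [hlt l r hr])
    have e2 := hR ⟨-1, k⟩ ⟨-1, -1⟩ (fun t ht l r hr h => by
      have h2 := congrArg Complex.re h
      simp [AffineMap.lineMap_apply] at h2
      linarith [hlt l r hr])
    have e3 := hR ⟨-1, -1⟩ ⟨k, -1⟩ (fun t ht l r hr h => by
      have h2 := congrArg Complex.im h
      simp [AffineMap.lineMap_apply] at h2
      linarith [hlt l r hr])
    have e4 := hR ⟨k, -1⟩ ⟨k, k⟩ (fun t ht l r hr h => by
      have h2 := congrArg Complex.re h
      simp [AffineMap.lineMap_apply] at h2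
      linarith [hlt l r hr])
    simp only [PermInvariant.segmentCocycle]
    rw [e1, e2, e3, e4]
    abel

theorem smul_gen_eq_zero (hk : 0 < k) (hm : 2 ≤ k + 1)
    (c : PathCocycle (Cconf (k + 1) 1 (n + 2)) A) :
    (if Even k then k else 2 * k) • (permInvariant_comap_aff hm c).segmentCocycle.gen hk = 0 := by
  obtain ⟨h1, h2⟩ := c.gen_relations hk hm
  split_ifs with h
  · obtain ⟨j, hj⟩ := h
    have h3 : (k + 1) * k = k + (2 * k) * j := by rw [hj]; ring
    rw [h3, add_smul, mul_comm (2 * k), mul_smul, h2, smul_zero, add_zero] at h1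
    exact h1
  · exact h2
end PathCocycle

end

section

open scoped unitInterval Topology

/-- The permutation action on ordered configurations of the plane. -/
instance {m : ℕ} : MulAction (Equiv.Perm (Fin m)) (PlaneConf m) where
  smul τ z := permMap τ⁻¹ z
  one_smul _ := rfl
  mul_smul τ τ' z := by
    apply Subtype.ext
    change z.1 ∘ ⇑(τ * τ')⁻¹ = (z.1 ∘ ⇑τ'⁻¹) ∘ ⇑τ⁻¹
    rw [mul_inv_rev]
    rfl

instance {m : ℕ} : ContinuousConstSMul (Equiv.Perm (Fin m)) (PlaneConf m) :=
  ⟨fun τ => (permMap τ⁻¹).continuous⟩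

instance {m : ℕ} : IsCancelSMul (Equiv.Perm (Fin m)) (PlaneConf m) where
  right_cancel' τ τ' z h := by
    have h1 : z.1 ∘ ⇑τ⁻¹ = z.1 ∘ ⇑τ'⁻¹ := congrArg Subtype.val h
    have h2 : τ⁻¹ = τ'⁻¹ := Equiv.ext fun i => z.2 (congrFun h1 i)
    exact inv_injective h2

theorem isOpen_injective (m : ℕ) : IsOpen {z : Fin m → ℂ | Function.Injective z} := by
  have : {z : Fin m → ℂ | Function.Injective z} = ⋂ i, ⋂ j, {z | i ≠ j → z i ≠ z j} := by
    ext z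
    simp only [Set.mem_iInter]
    exact ⟨fun h i j hij => h.ne hij, fun h i j hij => by
      by_contra hne
      exact h i j hne hij⟩
  rw [this]
  refine isOpen_iInter_of_finite fun i => isOpen_iInter_of_finite fun j => ?_
  by_cases hij : i = j
  · simp [hij]
  · simp only [ne_eq, hij, not_false_eq_true, true_imp_iff]
    exact isOpen_ne_fun (continuous_apply i) (continuous_apply j)

instance {m : ℕ} : LocallyCompactSpace (PlaneConf m) :=
  (isOpen_injective m).locallyCompactSpace

/-- The unordered configuration space of the plane. -/
abbrev PlaneUConf (m : ℕ) := MulAction.orbitRel.Quotient (Equiv.Perm (Fin m)) (PlaneConf m)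

/-- The unordered configuration underlying an ordered one. -/
def toUConf {m : ℕ} (z : PlaneConf m) : PlaneUConf m := Quotient.mk _ z

theorem toUConf_eq_of_comp {m : ℕ} {z w : PlaneConf m} (τ : Equiv.Perm (Fin m))
    (h : w.1 = z.1 ∘ τ) : toUConf w = toUConf z := by
  refine Quotient.sound ⟨τ⁻¹, Subtype.ext ?_⟩
  change z.1 ∘ ⇑(τ⁻¹)⁻¹ = w.1
  rw [inv_inv, h]

theorem toUConf_eq_iff {m : ℕ} {z w : PlaneConf m} :
    toUConf w = toUConf z ↔ ∃ τ : Equiv.Perm (Fin m), w.1 = z.1 ∘ τ := by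
  refine ⟨fun h => ?_, fun ⟨τ, h⟩ => toUConf_eq_of_comp τ h⟩
  obtain ⟨τ, hτ⟩ := Quotient.exact h
  exact ⟨τ⁻¹, (congrArg Subtype.val hτ).symm⟩

theorem isCoveringMap_toUConf (m : ℕ) : IsCoveringMap (toUConf : PlaneConf m → PlaneUConf m) :=
  (isQuotientCoveringMap_quotientMk_of_properlyDiscontinuousSMul
    (G := Equiv.Perm (Fin m)) (E := PlaneConf m)).isCoveringMap

open Classical in
/-- The affine coordinates of a configuration in the standard chart. -/
def chartCoord {m n : ℕ} (x : Cconf m 1 (n + 2)) : PlaneUConf m :=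
  if h : InChart (LinearMap.proj 0) (LinearMap.proj 1) (tupleOf x).1 then
    toUConf ⟨_, h.injective_div⟩ else toUConf ⟨stair 1, PathCocycle.lexSorted_stair_one.injective⟩

theorem chartCoord_conf {m n : ℕ} {v : GoodTuple m (n + 2)}
    (h : InChart (LinearMap.proj 0) (LinearMap.proj 1) v.1) :
    chartCoord (conf v) = toUConf ⟨_, h.injective_div⟩ := by
  obtain ⟨τ, a, hτ⟩ := conf_eq_iff.mp (conf_tupleOf (conf v)).symm
  have h' : InChart (LinearMap.proj 0) (LinearMap.proj 1) (tupleOf (conf v)).1 := by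
    rw [funext hτ]
    exact h.smul_perm τ a
  rw [chartCoord, dif_pos h']
  refine toUConf_eq_of_comp τ ?_
  funext j
  simp only [Function.comp_apply, LinearMap.proj_apply]
  rw [hτ j]
  simp only [Units.smul_def, Pi.smul_apply, smul_eq_mul]
  exact mul_div_mul_left _ _ (a j).ne_zero

theorem continuousOn_chartCoord (m n : ℕ) :
    ContinuousOn (chartCoord : Cconf m 1 (n + 2) → PlaneUConf m) (stdChart m n) := by
  rintro _ ⟨v, hv, rfl⟩
  refine ContinuousAt.continuousWithinAt ?_
  refine (isOpenQuotientMap_conf m (n + 2)).continuousAt_comp_iff.mp ?_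
  have hopen : IsOpen (conf ⁻¹' stdChart m n) :=
    (isOpen_chart m _ _).preimage (isOpenQuotientMap_conf m (n + 2)).continuous
  have hmem : ∀ w : GoodTuple m (n + 2), w ∈ conf ⁻¹' stdChart m n →
    InChart (LinearMap.proj 0) (LinearMap.proj 1) w.1 := fun w hw => conf_mem_chart.mp hw
  refine ContinuousOn.continuousAt ?_ (hopen.mem_nhds (conf_mem_chart.mpr hv))
  rw [continuousOn_iff_continuous_domRestrict]
  have : Set.domRestrict (conf ⁻¹' stdChart m n) (chartCoord ∘ conf)
      = fun w => toUConf ⟨_, (hmem w.1 w.2).injective_div⟩ := by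
    funext w
    exact chartCoord_conf (hmem w.1 w.2)
  rw [this]
  refine (isCoveringMap_toUConf m).continuous.comp (Continuous.subtype_mk ?_ _)
  refine continuous_pi fun j => ?_
  have hc : ∀ i, Continuous fun w : (conf ⁻¹' stdChart m n : Set (GoodTuple m (n + 2))) =>
      w.1.1 j i := fun i => (continuous_apply i).comp ((continuous_apply j).comp
        (continuous_subtype_val.comp continuous_subtype_val))
  exact (hc 1).div (hc 0) fun w => (hmem w.1 w.2).1 j

namespace PathCocycle

variable {m n : ℕ} {A : Type*} [AddCommGroup A]

/-- The value on the contraction of a configuration in the standard chart. -/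
theorem exists_isPotential_stdChart (hm : 2 ≤ m) (c : PathCocycle (Cconf m 1 (n + 2)) A)
    {e : PlaneConf m → A} (he : (c.comap (affMap hm n)).IsPotential e)
    (heperm : ∀ z w : PlaneConf m, ∀ τ : Equiv.Perm (Fin m), w.1 = z.1 ∘ τ → e w = e z) :
    ∃ e₀ : Cconf m 1 (n + 2) → A, ∀ γ : C(I, Cconf m 1 (n + 2)), (∀ t, γ t ∈ stdChart m n) →
      c.toFun γ = e₀ (γ 1) - e₀ (γ 0) := by
  classical
  have hlift : ∃ e' : PlaneUConf m → A, ∀ z, e' (toUConf z) = e z :=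
    ⟨Quotient.lift e fun w z hwz => by
      obtain ⟨τ, h⟩ := toUConf_eq_iff.mp (Quotient.sound hwz : toUConf w = toUConf z)
      exact heperm _ _ τ h, fun z => rfl⟩
  obtain ⟨e', he'⟩ := hlift
  have hcontr : ∀ x ∈ stdChart m n, ∀ z : PlaneConf m, toUConf z = chartCoord x →
      act (contr n 0) x = aff hm n z := by
    rintro _ ⟨v, hv, rfl⟩ z hz
    rw [chartCoord_conf hv] at hz
    obtain ⟨τ, h⟩ := toUConf_eq_iff.mp hz
    rw [act_contr_zero hm v hv, aff_eq_of_comp hm n τ h]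
  have hcont : ∀ x ∈ stdChart m n, Continuous fun s : I => act (contr n ((s : ℝ) : ℂ)) x := by
    intro x hx
    rw [continuous_iff_continuousAt]
    intro s
    exact ContinuousAt.comp (g := fun p : ℂ × Cconf m 1 (n + 2) => act (contr n p.1) p.2)
      (f := fun s : I => (((s : ℝ) : ℂ), x)) (continuousAt_act_contr hm _ hx)
      (by fun_prop)
  refine ⟨fun x => if hx : x ∈ stdChart m n then e' (chartCoord x) + c.toFun ⟨_, hcont x hx⟩ else 0,
    fun γ hγ => ?_⟩
  have hρ : Continuous fun t => chartCoord (γ t) :=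
    (continuousOn_chartCoord m n).comp_continuous γ.continuous hγ
  obtain ⟨z₀, hz₀⟩ := Quotient.exists_rep (chartCoord (γ 0))
  obtain ⟨Γ, hΓ, -⟩ := (isCoveringMap_toUConf m).exists_path_lifts ⟨_, hρ⟩ z₀ hz₀.symm
  have hΓ' : ∀ t, toUConf (Γ t) = chartCoord (γ t) := fun t => congrFun hΓ t
  let H : C(I × I, Cconf m 1 (n + 2)) := ⟨fun p => act (contr n ((p.1 : ℝ) : ℂ)) (γ p.2), by
    rw [continuous_iff_continuousAt]
    intro p
    exact ContinuousAt.comp (g := fun p : ℂ × Cconf m 1 (n + 2) => act (contr n p.1) p.2)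
      (f := fun p : I × I => (((p.1 : ℝ) : ℂ), γ p.2)) (continuousAt_act_contr hm _ (hγ _))
      (by fun_prop)⟩
  have hsq := c.square H
  have e1 : H.comp ⟨fun t => (0, t), by fun_prop⟩ = (affMap hm n).comp Γ := by
    ext1 t
    change act (contr n (((0 : I) : ℝ) : ℂ)) (γ t) = aff hm n (Γ t)
    rw [← hcontr _ (hγ t) _ (hΓ' t)]
    simp
  have e2 : H.comp ⟨fun t => (1, t), by fun_prop⟩ = γ := by
    ext1 t
    change act (contr n (((1 : I) : ℝ) : ℂ)) (γ t) = γ t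
    simp [act_contr_one]
  have e3 : H.comp ⟨fun t => (t, 0), by fun_prop⟩ = ⟨_, hcont (γ 0) (hγ 0)⟩ := rfl
  have e4 : H.comp ⟨fun t => (t, 1), by fun_prop⟩ = ⟨_, hcont (γ 1) (hγ 1)⟩ := rfl
  rw [e1, e2, e3, e4] at hsq
  have e5 : c.toFun ((affMap hm n).comp Γ) = e (Γ 1) - e (Γ 0) := he Γ
  rw [e5, ← he', ← he', hΓ', hΓ'] at hsq
  simp only [hγ, dif_pos]
  rw [← sub_eq_iff_eq_add'] at hsq
  rw [← hsq]
  abel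
end PathCocycle

end

section

open scoped unitInterval Topology

/-- Functions of the entries of a matrix which are given by polynomials. -/
def IsMatrixPoly {n : ℕ} (f : Matrix (Fin n) (Fin n) ℂ → ℂ) : Prop :=
  ∃ p : MvPolynomial (Fin n × Fin n) ℂ, ∀ N, f N = p.eval fun x => N x.1 x.2

namespace IsMatrixPoly

variable {n : ℕ} {f g : Matrix (Fin n) (Fin n) ℂ → ℂ}

theorem const (a : ℂ) : IsMatrixPoly fun _ : Matrix (Fin n) (Fin n) ℂ => a :=
  ⟨MvPolynomial.C a, fun N => by simp⟩

theorem entry (i j : Fin n) : IsMatrixPoly fun N : Matrix (Fin n) (Fin n) ℂ => N i j :=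
  ⟨MvPolynomial.X (i, j), fun N => by simp⟩

theorem add (hf : IsMatrixPoly f) (hg : IsMatrixPoly g) : IsMatrixPoly fun N => f N + g N := by
  obtain ⟨p, hp⟩ := hf
  obtain ⟨q, hq⟩ := hg
  exact ⟨p + q, fun N => by simp [hp, hq]⟩

theorem mul (hf : IsMatrixPoly f) (hg : IsMatrixPoly g) : IsMatrixPoly fun N => f N * g N := by
  obtain ⟨p, hp⟩ := hf
  obtain ⟨q, hq⟩ := hg
  exact ⟨p * q, fun N => by simp [hp, hq]⟩

theorem sub (hf : IsMatrixPoly f) (hg : IsMatrixPoly g) : IsMatrixPoly fun N => f N - g N := by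
  obtain ⟨p, hp⟩ := hf
  obtain ⟨q, hq⟩ := hg
  exact ⟨p - q, fun N => by simp [hp, hq]⟩

theorem sum {ι : Type*} (s : Finset ι) {F : ι → Matrix (Fin n) (Fin n) ℂ → ℂ}
    (h : ∀ i, IsMatrixPoly (F i)) : IsMatrixPoly fun N => ∑ i ∈ s, F i N := by
  choose p hp using h
  exact ⟨∑ i ∈ s, p i, fun N => by simp [hp]⟩

/-- Finitely many polynomials, none identically zero, have a common non-zero. -/
theorem exists_forall_ne_zero {ι : Type*} [Fintype ι] {F : ι → Matrix (Fin n) (Fin n) ℂ → ℂ}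
    (h : ∀ i, IsMatrixPoly (F i)) (hne : ∀ i, ∃ N, F i N ≠ 0) : ∃ N, ∀ i, F i N ≠ 0 := by
  choose p hp using h
  have hp0 : ∏ i, p i ≠ 0 := by
    refine Finset.prod_ne_zero_iff.mpr fun i _ h0 => ?_
    obtain ⟨N, hN⟩ := hne i
    exact hN (by rw [hp, h0, map_zero])
  by_contra! hcon
  refine hp0 (MvPolynomial.funext fun x => ?_)
  obtain ⟨i, hi⟩ := hcon (Matrix.of fun a b => x (a, b))
  rw [hp] at hi
  rw [map_prod, map_zero]
  exact Finset.prod_eq_zero (Finset.mem_univ i) hi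

/-- The common non-zeros of finitely many polynomials can be joined along a complex line. -/
theorem joinedIn_forall_ne_zero {ι : Type*} [Fintype ι] {F : ι → Matrix (Fin n) (Fin n) ℂ → ℂ}
    (h : ∀ i, IsMatrixPoly (F i)) {N N' : Matrix (Fin n) (Fin n) ℂ} (hN : ∀ i, F i N ≠ 0)
    (hN' : ∀ i, F i N' ≠ 0) : JoinedIn {M | ∀ i, F i M ≠ 0} N N' := by
  choose p hp using h
  let q : ι → Polynomial ℂ := fun i => MvPolynomial.aeval
    (fun x => Polynomial.C (N x.1 x.2) + Polynomial.X * Polynomial.C ((N' - N) x.1 x.2)) (p i)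
  let ℓ : ℂ → Matrix (Fin n) (Fin n) ℂ := fun s => N + s • (N' - N)
  have hq : ∀ i s, (q i).eval s = F i (ℓ s) := by
    intro i s
    rw [hp]
    simp only [q]
    induction p i using MvPolynomial.induction_on with
    | C a => simp
    | add p q hp hq => rw [map_add, map_add, Polynomial.eval_add, hp, hq]
    | mul_X p x hp =>
      rw [map_mul, map_mul, Polynomial.eval_mul, hp]
      simp [ℓ]
  have h0 : ℓ 0 = N := by simp [ℓ]
  have h1 : ℓ 1 = N' := by simp [ℓ]
  have hq0 : ∏ i, q i ≠ 0 := by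
    refine Finset.prod_ne_zero_iff.mpr fun i _ hi => hN i ?_
    rw [← h0, ← hq, hi, Polynomial.eval_zero]
  have hset : ∀ s, s ∈ ((∏ i, q i).rootSet ℂ)ᶜ ↔ ∀ i, F i (ℓ s) ≠ 0 := by
    intro s
    rw [Set.mem_compl_iff, Polynomial.mem_rootSet_of_ne hq0, Polynomial.coe_aeval_eq_eval,
      Polynomial.eval_prod, Finset.prod_eq_zero_iff]
    simp [hq]
  have hpc : IsPathConnected ((∏ i, q i).rootSet ℂ)ᶜ :=
    ((∏ i, q i).rootSet_finite ℂ).countable.isPathConnected_compl_of_one_lt_rank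
      (by rw [Complex.rank_real_complex]; exact Nat.one_lt_ofNat)
  have hj := hpc.joinedIn 0 ((hset 0).mpr (by rwa [h0])) 1 ((hset 1).mpr (by rwa [h1]))
  have hℓ : Continuous ℓ := by fun_prop
  obtain ⟨γ, hγ⟩ := hj
  exact ⟨(γ.map hℓ).cast h0.symm h1.symm, fun t => (hset (γ t)).mp (hγ t)⟩

end IsMatrixPoly

theorem triMat_mulVec {n : ℕ} (N : Matrix (Fin (n + 1)) (Fin (n + 1)) ℂ) (v : Fin (n + 1) → ℂ)
    (i : Fin (n + 1)) :
    (triMat N).mulVec v i = v i + ∑ j, if i < j then N i j * v j else 0 := by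
  have : ∀ j, triMat N i j * v j
      = (if i = j then v j else 0) + if i < j then N i j * v j else 0 := by
    intro j
    by_cases h : i = j
    · simp [triMat, h]
    · by_cases h' : i < j <;> simp [triMat, h, h']
  simp only [Matrix.mulVec, dotProduct, this, Finset.sum_add_distrib]
  simp

theorem isMatrixPoly_triMat_mulVec {n : ℕ} (v : Fin (n + 1) → ℂ) (i : Fin (n + 1)) :
    IsMatrixPoly fun N => (triMat N).mulVec v i := by
  simp only [triMat_mulVec]
  refine (IsMatrixPoly.const _).add (IsMatrixPoly.sum _ fun j => ?_)
  by_cases h : i < j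
  · simp only [h, if_true]
    exact (IsMatrixPoly.entry i j).mul (IsMatrixPoly.const _)
  · simp only [h, if_false]
    exact IsMatrixPoly.const 0

theorem exists_triMat_mulVec_zero_ne_zero {n : ℕ} {v : Fin (n + 2 + 1) → ℂ} (hv : v ≠ 0) :
    ∃ N, (triMat N).mulVec v 0 ≠ 0 := by
  by_contra! h
  simp only [triMat_mulVec] at h
  have h0 : v 0 = 0 := by simpa using h 0
  refine hv (funext fun a => ?_)
  by_cases ha : a = 0
  · rw [ha, h0]; rfl
  · have := h (Matrix.single 0 a 1)
    rw [h0, zero_add, Finset.sum_eq_single a] at this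
    · simpa [Fin.pos_iff_ne_zero, ha] using this
    · intro j _ hj
      simp [Ne.symm hj]
    · simp

theorem exists_triMat_minor_ne_zero {n : ℕ} {v w : Fin (n + 2 + 1) → ℂ}
    (hvw : LinearIndependent ℂ ![v, w]) :
    ∃ N, (triMat N).mulVec v 0 * (triMat N).mulVec w 1
      - (triMat N).mulVec w 0 * (triMat N).mulVec v 1 ≠ 0 := by
  by_contra! h
  let R : Fin (n + 2 + 1) → Fin (n + 2 + 1) → ℂ → ℂ →
      Matrix (Fin (n + 2 + 1)) (Fin (n + 2 + 1)) ℂ :=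
    fun a b α β => Matrix.of fun i j => if i = 0 then if j = a then α else 0 else
      if j = b then β else 0
  have hR0 : ∀ (u : Fin (n + 2 + 1) → ℂ) a b α β, 0 < a →
      (triMat (R a b α β)).mulVec u 0 = u 0 + α * u a := by
    intro u a b α β ha
    rw [triMat_mulVec, Finset.sum_eq_single a]
    · simp [R, ha]
    · intro j _ hj
      simp [R, hj]
    · simp
  have hR1 : ∀ (u : Fin (n + 2 + 1) → ℂ) a b α β, 1 < b →
      (triMat (R a b α β)).mulVec u 1 = u 1 + β * u b := by
    intro u a b α β hb
    rw [triMat_mulVec, Finset.sum_eq_single b]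
    · simp [R, hb]
    · intro j _ hj
      simp [R, hj]
    · simp
  have key : ∀ a b α β, 0 < a → 1 < b →
      (v 0 + α * v a) * (w 1 + β * w b) - (w 0 + α * w a) * (v 1 + β * v b) = 0 := by
    intro a b α β ha hb
    have := h (R a b α β)
    rwa [hR0 _ _ _ _ _ ha, hR0 _ _ _ _ _ ha, hR1 _ _ _ _ _ hb, hR1 _ _ _ _ _ hb] at this
  have h2 : (1 : Fin (n + 2 + 1)) < 2 := by
    simp [Fin.lt_def, Nat.mod_eq_of_lt (show 2 < n + 2 + 1 by omega)]
  have h01 : v 0 * w 1 - w 0 * v 1 = 0 := by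
    simpa using key 1 2 0 0 (by simp) h2
  have h0b : ∀ b, 1 < b → v 0 * w b - w 0 * v b = 0 := by
    intro b hb
    linear_combination key 1 b 0 1 (by simp) hb - h01
  have ha1 : ∀ a, 0 < a → v a * w 1 - w a * v 1 = 0 := by
    intro a ha
    linear_combination key a 2 1 0 ha h2 - h01
  have hab : ∀ a b, 0 < a → 1 < b → v a * w b - w a * v b = 0 := by
    intro a b ha hb
    linear_combination key a b 1 1 ha hb - h01 - h0b b hb - ha1 a ha
  have h0 : ∀ b, v 0 * w b - w 0 * v b = 0 := by
    intro b
    by_cases hb0 : b = 0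
    · rw [hb0]; ring
    · by_cases hb1 : b = 1
      · rw [hb1, h01]
      · refine h0b b ?_
        simp only [Fin.ext_iff, Fin.lt_def, Fin.val_zero, Fin.val_one] at *
        omega
  have hall : ∀ a b, v a * w b - w a * v b = 0 := by
    intro a b
    by_cases ha0 : a = 0
    · rw [ha0, h0]
    · have ha : 0 < a := Fin.pos_iff_ne_zero.mpr ha0
      by_cases hb0 : b = 0
      · rw [hb0]
        linear_combination - h0 a
      · by_cases hb1 : b = 1
        · rw [hb1, ha1 a ha]
        · refine hab a b ha ?_
          simp only [Fin.ext_iff, Fin.lt_def, Fin.val_zero, Fin.val_one] at *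
          omega
  rw [LinearIndependent.pair_iff] at hvw
  by_cases hv : v = 0
  · have := hvw 1 0 (by simp [hv])
    simp at this
  · obtain ⟨a, ha⟩ := Function.ne_iff.mp hv
    have := hvw (w a) (-v a) (by
      funext b
      simp only [Pi.add_apply, Pi.smul_apply, smul_eq_mul, Pi.zero_apply]
      linear_combination - hall a b)
    exact ha (neg_eq_zero.mp this.2)

/-- The conditions for a triangular matrix to move a tuple to the standard chart. -/
def chartFun {m n : ℕ} (v : Fin m → Fin (n + 2 + 1) → ℂ)
    (ij : Fin m ⊕ {p : Fin m × Fin m // p.1 ≠ p.2})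
    (N : Matrix (Fin (n + 2 + 1)) (Fin (n + 2 + 1)) ℂ) : ℂ :=
  ij.elim (fun j => (triMat N).mulVec (v j) 0) fun p =>
    (triMat N).mulVec (v p.1.1) 0 * (triMat N).mulVec (v p.1.2) 1
      - (triMat N).mulVec (v p.1.2) 0 * (triMat N).mulVec (v p.1.1) 1

theorem isMatrixPoly_chartFun {m n : ℕ} (v : Fin m → Fin (n + 2 + 1) → ℂ) (ij) :
    IsMatrixPoly (chartFun v ij) := by
  rcases ij with j | p
  · exact isMatrixPoly_triMat_mulVec _ _
  · exact ((isMatrixPoly_triMat_mulVec _ _).mul (isMatrixPoly_triMat_mulVec _ _)).sub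
      ((isMatrixPoly_triMat_mulVec _ _).mul (isMatrixPoly_triMat_mulVec _ _))

theorem act_triMat_mem_stdChart_iff {m n : ℕ} (hm : 2 ≤ m) (v : GoodTuple m (n + 2))
    (N : Matrix (Fin (n + 2 + 1)) (Fin (n + 2 + 1)) ℂ) :
    act (triMat N) (conf v) ∈ stdChart m n ↔ ∀ ij, chartFun v.1 ij N ≠ 0 := by
  rw [act_conf (isGood_triMat hm N v), conf_mem_chart]
  simp only [Sum.forall, Subtype.forall, Prod.forall]
  rfl

theorem exists_act_triMat_mem_stdChart {m n : ℕ} (hm : 2 ≤ m) (x : Cconf m 1 (n + 2)) :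
    ∃ N, act (triMat N) x ∈ stdChart m n := by
  obtain ⟨v, rfl⟩ := (isOpenQuotientMap_conf m (n + 2)).surjective x
  simp only [act_triMat_mem_stdChart_iff hm]
  refine IsMatrixPoly.exists_forall_ne_zero (isMatrixPoly_chartFun v.1) fun ij => ?_
  rcases ij with j | p
  · exact exists_triMat_mulVec_zero_ne_zero (v.2.1 j)
  · exact exists_triMat_minor_ne_zero (v.2.2.1 _ _ p.2)

theorem joinedIn_act_triMat_mem_stdChart {m n : ℕ} (hm : 2 ≤ m) (x : Cconf m 1 (n + 2))
    {N N' : Matrix (Fin (n + 2 + 1)) (Fin (n + 2 + 1)) ℂ} (hN : act (triMat N) x ∈ stdChart m n)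
    (hN' : act (triMat N') x ∈ stdChart m n) :
    JoinedIn {M | act (triMat M) x ∈ stdChart m n} N N' := by
  obtain ⟨v, rfl⟩ := (isOpenQuotientMap_conf m (n + 2)).surjective x
  simp only [act_triMat_mem_stdChart_iff hm] at hN hN' ⊢
  exact IsMatrixPoly.joinedIn_forall_ne_zero (isMatrixPoly_chartFun v.1) hN hN'

theorem PlaneConf.joined_aff {m n : ℕ} (hm : 2 ≤ m) (z : PlaneConf m) :
    Joined (aff hm n z) (aff hm n ⟨stair 1, PathCocycle.lexSorted_stair_one.injective⟩) := by
  have hs := lexSorted_comp_lexSort z.2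
  rw [← aff_eq_of_comp hm n (z := z) (w := ⟨_, hs.injective⟩) (lexSort z.1) rfl]
  have hj : JoinedIn (lexCone (z.1 ∘ lexSort z.1)) (z.1 ∘ lexSort z.1) (stair 1) :=
    ((convex_wedge _).isPathConnected ⟨_, hs.mem_lexCone_self⟩).joinedIn _ hs.mem_lexCone_self _
      hs.stair_one_mem_lexCone
  have hinj : ∀ y ∈ lexCone (z.1 ∘ lexSort z.1), Function.Injective y :=
    fun y hy => injective_of_mem_wedge hy
  exact ((hj.joined_subtype).map (f := fun y => aff hm n ⟨y.1, hinj _ y.2⟩)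
    ((continuous_aff hm n).comp (by fun_prop)))

theorem joined_act_triMat {m n : ℕ} (hm : 2 ≤ m) (x : Cconf m 1 (n + 2))
    (N : Matrix (Fin (n + 2 + 1)) (Fin (n + 2 + 1)) ℂ) : Joined x (act (triMat N) x) := by
  have hc : Continuous fun s : ℝ => act (triMat (s • N)) x :=
    Continuous.comp (f := fun s : ℝ => (s • N, x)) (g := fun p : Matrix (Fin (n + 2 + 1))
      (Fin (n + 2 + 1)) ℂ × Cconf m 1 (n + 2) => act (triMat p.1) p.2) (continuous_act_triMat hm)
      (by fun_prop)
  have := (PathConnectedSpace.joined (0 : ℝ) 1).map hc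
  simpa only [zero_smul, one_smul, triMat_zero, act_one] using this

theorem exists_joined_aff {m n : ℕ} (hm : 2 ≤ m) {x : Cconf m 1 (n + 2)} (hx : x ∈ stdChart m n) :
    ∃ z, Joined x (aff hm n z) := by
  obtain ⟨v, rfl⟩ := (isOpenQuotientMap_conf m (n + 2)).surjective x
  refine ⟨⟨_, (conf_mem_chart.mp hx).injective_div⟩, ?_⟩
  rw [← act_contr_zero hm v (conf_mem_chart.mp hx)]
  have h : Joined (1 : ℂ) 0 := PathConnectedSpace.joined 1 0
  have hc : Continuous fun u : ℂ => act (contr n u) (conf v) := by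
    refine continuous_iff_continuousAt.mpr fun u => ?_
    exact ContinuousAt.comp (x := u) (g := fun p : ℂ × Cconf m 1 (n + 2) => act (contr n p.1) p.2)
      (f := fun u => (u, conf v)) (continuousAt_act_contr hm u hx) (by fun_prop)
  have := h.map (f := fun u => act (contr n u) (conf v)) hc
  simpa [act_contr_one] using this

theorem pathConnectedSpace_Cconf {m : ℕ} (hm : 2 ≤ m) (n : ℕ) :
    PathConnectedSpace (Cconf m 1 (n + 2)) := by
  have h : ∀ x : Cconf m 1 (n + 2),
      Joined x (aff hm n ⟨stair 1, PathCocycle.lexSorted_stair_one.injective⟩) := by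
    intro x
    obtain ⟨N, hN⟩ := exists_act_triMat_mem_stdChart hm x
    obtain ⟨z, hz⟩ := exists_joined_aff hm hN
    exact ((joined_act_triMat hm x N).trans hz).trans (PlaneConf.joined_aff hm z)
  exact ⟨⟨aff hm n ⟨stair 1, PathCocycle.lexSorted_stair_one.injective⟩⟩,
    fun x y => (h x).trans (h y).symm⟩

end

section

open scoped unitInterval Topology

theorem simplyConnectedSpace_matrix (n : ℕ) : SimplyConnectedSpace (Matrix (Fin n) (Fin n) ℂ) :=
  have : ContractibleSpace (Fin n → Fin n → ℂ) := RealTopologicalVectorSpace.contractibleSpace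
  inferInstanceAs (SimplyConnectedSpace (Fin n → Fin n → ℂ))

/-- The family of all triangular transforms of a configuration. -/
def triOrbit {m n : ℕ} (hm : 2 ≤ m) (x : Cconf m 1 n) :
    C(Matrix (Fin (n + 1)) (Fin (n + 1)) ℂ, Cconf m 1 n) where
  toFun N := act (triMat N) x
  continuous_toFun := Continuous.comp (f := fun N => (N, x))
    (g := fun p : Matrix (Fin (n + 1)) (Fin (n + 1)) ℂ × Cconf m 1 n => act (triMat p.1) p.2)
    (continuous_act_triMat hm) (by fun_prop)

/-- The segment from the zero matrix to `N`. -/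
def matrixRay {n : ℕ} (N : Matrix (Fin n) (Fin n) ℂ) : C(I, Matrix (Fin n) (Fin n) ℂ) where
  toFun s := (s : ℝ) • N
  continuous_toFun := by fun_prop

/-- Moving a path by the triangular transforms along a ray. -/
def triSquare {m n : ℕ} (hm : 2 ≤ m) (N : Matrix (Fin (n + 1)) (Fin (n + 1)) ℂ)
    (η : C(I, Cconf m 1 n)) : C(I × I, Cconf m 1 n) where
  toFun p := act (triMat (matrixRay N p.1)) (η p.2)
  continuous_toFun := Continuous.comp (f := fun p : I × I => (matrixRay N p.1, η p.2))
    (g := fun p : Matrix (Fin (n + 1)) (Fin (n + 1)) ℂ × Cconf m 1 n => act (triMat p.1) p.2)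
    (continuous_act_triMat hm) (by fun_prop)

namespace PathCocycle

variable {m n : ℕ} {A : Type*} [AddCommGroup A]

/-- The candidate for a potential on the set of configurations moved to the standard chart by
`N`. -/
def triPotential (hm : 2 ≤ m) (c : PathCocycle (Cconf m 1 (n + 2)) A) (e₀ : Cconf m 1 (n + 2) → A)
    (N : Matrix (Fin (n + 2 + 1)) (Fin (n + 2 + 1)) ℂ) (x : Cconf m 1 (n + 2)) : A :=
  e₀ (act (triMat N) x) - c.toFun ((triOrbit hm x).comp (matrixRay N))

variable {c : PathCocycle (Cconf m 1 (n + 2)) A} {e₀ : Cconf m 1 (n + 2) → A}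

theorem eq_triPotential_sub (hm : 2 ≤ m)
    (he₀ : ∀ γ : C(I, Cconf m 1 (n + 2)), (∀ t, γ t ∈ stdChart m n) →
      c.toFun γ = e₀ (γ 1) - e₀ (γ 0)) (N : Matrix (Fin (n + 2 + 1)) (Fin (n + 2 + 1)) ℂ)
    (η : C(I, Cconf m 1 (n + 2))) (hη : ∀ t, act (triMat N) (η t) ∈ stdChart m n) :
    c.toFun η = c.triPotential hm e₀ N (η 1) - c.triPotential hm e₀ N (η 0) := by
  have hsq := c.square (triSquare hm N η)
  have h0 : (triSquare hm N η).comp ⟨fun t => (0, t), by fun_prop⟩ = η := by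
    ext t
    simp [triSquare, matrixRay, triMat_zero, act_one]
  have h1 : ∀ t, (triSquare hm N η).comp ⟨fun t => (1, t), by fun_prop⟩ t
      = act (triMat N) (η t) := by
    intro t
    simp [triSquare, matrixRay]
  have h2 : ∀ t, (triSquare hm N η).comp ⟨fun s => (s, t), by fun_prop⟩
      = (triOrbit hm (η t)).comp (matrixRay N) := fun t => rfl
  have h3 := he₀ ((triSquare hm N η).comp ⟨fun t => (1, t), by fun_prop⟩)
    fun t => by rw [h1]; exact hη t
  rw [h0, h2, h2, h3, h1, h1] at hsq
  rw [triPotential, triPotential, eq_sub_of_add_eq hsq]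
  abel

theorem triPotential_eq (hm : 2 ≤ m)
    (he₀ : ∀ γ : C(I, Cconf m 1 (n + 2)), (∀ t, γ t ∈ stdChart m n) →
      c.toFun γ = e₀ (γ 1) - e₀ (γ 0)) {N N' : Matrix (Fin (n + 2 + 1)) (Fin (n + 2 + 1)) ℂ}
    {x : Cconf m 1 (n + 2)} (hN : act (triMat N) x ∈ stdChart m n)
    (hN' : act (triMat N') x ∈ stdChart m n) :
    c.triPotential hm e₀ N x = c.triPotential hm e₀ N' x := by
  have := simplyConnectedSpace_matrix (n + 2 + 1)
  obtain ⟨E, hE⟩ := (c.comap (triOrbit hm x)).exists_isPotential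
  have hray : ∀ M, c.toFun ((triOrbit hm x).comp (matrixRay M)) = E M - E 0 := by
    intro M
    have := hE (matrixRay M)
    simpa [matrixRay, comap] using this
  obtain ⟨γ, hγ⟩ := joinedIn_act_triMat_mem_stdChart hm x hN hN'
  have h1 := hE γ.toContinuousMap
  have h2 := he₀ ((triOrbit hm x).comp γ.toContinuousMap) hγ
  have h3 : E N' - E N = e₀ (act (triMat N') x) - e₀ (act (triMat N) x) := by
    have h4 := h1.symm.trans h2
    simpa [triOrbit] using h4
  rw [triPotential, triPotential, hray, hray, eq_add_of_sub_eq h3]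
  abel

/-- A cocycle whose pullback to the affine configurations vanishes on all segments is a
coboundary. -/
theorem exists_isPotential_of_segmentCocycle {k : ℕ} (hm : 2 ≤ k + 1)
    (c : PathCocycle (Cconf (k + 1) 1 (n + 2)) A)
    (h0 : ∀ τ, (permInvariant_comap_aff hm c).segmentCocycle.val τ = 0) :
    ∃ e, c.IsPotential e := by
  obtain ⟨e₀, he₀⟩ := c.exists_isPotential_stdChart hm
    ((permInvariant_comap_aff hm c).isPotential h0) (by
      intro z w τ h
      simp only [h, sortVal_comp])
  choose N hN using fun x : Cconf (k + 1) 1 (n + 2) => exists_act_triMat_mem_stdChart hm x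
  refine ⟨fun x => c.triPotential hm e₀ (N x) x, c.isPotential_of_locally _ fun x => ?_⟩
  refine ⟨{y | act (triMat (N x)) y ∈ stdChart (k + 1) n}, ?_, fun γ hγ => ?_⟩
  · refine IsOpen.mem_nhds ?_ (hN x)
    refine (isOpen_chart (k + 1) _ _).preimage (f := fun y => act (triMat (N x)) y) ?_
    exact Continuous.comp (f := fun y => (N x, y)) (g := fun p : Matrix (Fin (n + 2 + 1))
      (Fin (n + 2 + 1)) ℂ × Cconf (k + 1) 1 (n + 2) => act (triMat p.1) p.2)
      (continuous_act_triMat hm) (by fun_prop)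
  · rw [eq_triPotential_sub hm he₀ (N x) γ hγ, triPotential_eq hm he₀ (hN (γ 1)) (hγ 1),
      triPotential_eq hm he₀ (hN (γ 0)) (hγ 0)]

end PathCocycle

end

section

open scoped unitInterval Topology

namespace PathCocycle

/-- The monodromy of an abelian covering is a path cocycle. -/
theorem exists_of_covering {E X G : Type*} [TopologicalSpace E] [TopologicalSpace X] [CommGroup G]
    [MulAction G E] {f : E → X} (hf : IsQuotientCoveringMap f G) :
    ∃ c : PathCocycle X (Additive G), ∀ (Γ : C(I, E)) (g : G), Γ 1 = g • Γ 0 → ∀ γ : C(I, X),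
      (∀ t, γ t = f (Γ t)) → c.toFun γ = Additive.ofMul g := by
  have hcov := hf.isCoveringMap
  have hcancel := hf.isCancelSMul
  have hcont := hf.toContinuousConstSMul
  choose s hs using hf.surjective
  have hend : ∀ γ : C(I, X), ∃ g : G,
      g • s (γ 1) = hcov.liftPath γ (s (γ 0)) (hs _).symm 1 := fun γ =>
    hf.apply_eq_iff_mem_orbit.mp
      ((congr_fun (hcov.liftPath_lifts γ (s (γ 0)) (hs _).symm) 1).trans (hs _).symm)
  choose d hd using hend
  have key : ∀ (γ : C(I, X)) (Γ : C(I, E)), (∀ t, γ t = f (Γ t)) → ∀ a b : G,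
      Γ 0 = a • s (γ 0) → Γ 1 = b • s (γ 1) → b = a * d γ := by
    intro γ Γ hΓ a b ha hb
    let Γ' : C(I, E) := ⟨fun t => a⁻¹ • Γ t, Γ.continuous.const_smul _⟩
    have h : Γ' = hcov.liftPath γ (s (γ 0)) (hs _).symm := by
      rw [hcov.eq_liftPath_iff']
      refine ⟨funext fun t => ?_, ?_⟩
      · rw [hΓ]
        exact hf.map_smul _
      · change a⁻¹ • Γ 0 = _
        rw [ha, inv_smul_smul]
    have h1 : a⁻¹ • Γ 1 = d γ • s (γ 1) := by
      rw [hd, ← h]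
      rfl
    rw [hb, smul_smul] at h1
    rw [← IsCancelSMul.right_cancel _ _ _ h1, mul_inv_cancel_left]
  have hlift : ∀ (γ : C(I, X)) (a : G), ∃ Γ : C(I, E), (∀ t, γ t = f (Γ t)) ∧ Γ 0 = a • s (γ 0) ∧
      Γ 1 = (a * d γ) • s (γ 1) := by
    intro γ a
    refine ⟨⟨fun t => a • hcov.liftPath γ (s (γ 0)) (hs _).symm t,
      (ContinuousMap.continuous _).const_smul _⟩, fun t => ?_, ?_, ?_⟩
    · exact ((hf.map_smul a).trans (congr_fun (hcov.liftPath_lifts γ (s (γ 0)) (hs _).symm) t)).symm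
    · exact congrArg (a • ·) (hcov.liftPath_zero γ (s (γ 0)) (hs _).symm)
    · rw [← smul_smul, hd]
      rfl
  refine ⟨⟨fun γ => Additive.ofMul (d γ), ?_, ?_⟩, ?_⟩
  · intro p q r γ γ'
    obtain ⟨Γ, h1, h2, h3⟩ := hlift γ.toContinuousMap 1
    obtain ⟨Γ', h1', h2', h3'⟩ := hlift γ'.toContinuousMap (1 * d γ.toContinuousMap)
    have hmid : Γ' 0 = Γ 1 := by
      rw [h2', h3]
      change _ • s (γ' 0) = _ • s (γ 1)
      rw [γ'.source, γ.target]
    let P : Path (Γ 0) (Γ 1) := ⟨Γ, rfl, rfl⟩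
    let P' : Path (Γ 1) (Γ' 1) := ⟨Γ', hmid, rfl⟩
    have := key (γ.trans γ').toContinuousMap (P.trans P').toContinuousMap (fun t => by
      change (γ.trans γ') t = f ((P.trans P') t)
      rw [Path.trans_apply, Path.trans_apply]
      split_ifs
      · exact h1 _
      · exact h1' _) 1 (1 * d γ.toContinuousMap * d γ'.toContinuousMap)
      (by
        change (P.trans P') 0 = _ • s ((γ.trans γ') 0)
        rw [(P.trans P').source, (γ.trans γ').source, h2]
        change _ • s (γ 0) = _
        rw [γ.source])
      (by
        change (P.trans P') 1 = _ • s ((γ.trans γ') 1)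
        rw [(P.trans P').target, (γ.trans γ').target, h3']
        change _ • s (γ' 1) = _
        rw [γ'.target])
    rw [one_mul, one_mul] at this
    exact congrArg Additive.ofMul this.symm
  · intro p q γ γ' h
    congr 1
    have h0 : γ 0 = γ' 0 := by simp
    have h1 : γ 1 = γ' 1 := by simp
    have h2 : (γ'.toContinuousMap) 0 = f (s (γ 0)) := (hs _).trans h0 |>.symm
    have h3 := hcov.liftPath_apply_one_eq_of_homotopicRel h (s (γ 0)) (hs _).symm h2
    have := key γ'.toContinuousMap (hcov.liftPath γ'.toContinuousMap (s (γ 0)) h2)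
      (fun t => (congr_fun (hcov.liftPath_lifts γ'.toContinuousMap (s (γ 0)) h2) t).symm)
      1 (d γ.toContinuousMap)
      (by
        rw [hcov.liftPath_zero, one_smul, h0]
        rfl)
      (by
        refine h3.symm.trans ((hd γ.toContinuousMap).symm.trans ?_)
        change _ • s (γ 1) = _ • s (γ' 1)
        rw [h1])
    rwa [one_mul] at this
  · intro Γ g hg γ hγ
    obtain ⟨a, ha⟩ := hf.apply_eq_iff_mem_orbit.mp ((hγ 0).symm.trans (hs (γ 0)).symm)
    change a • s (γ 0) = Γ 0 at ha
    have h01 : γ 1 = γ 0 := by rw [hγ, hγ, hg, hf.map_smul]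
    have := key γ Γ hγ a (g * a) ha.symm (by rw [hg, ← ha, h01, smul_smul])
    rw [mul_comm] at this
    exact congrArg Additive.ofMul (mul_left_cancel this).symm

end PathCocycle

end

/-- The Plücker coordinates of the plane spanned by two vectors. -/
def bivec {n : ℕ} (v w : Fin n → ℂ) (p : Fin n × Fin n) : ℂ := v p.1 * w p.2 - v p.2 * w p.1

theorem bivec_smul_smul {n : ℕ} (a b : ℂ) (v w : Fin n → ℂ) :
    bivec (a • v) (b • w) = (a * b) • bivec v w := by
  funext p
  simp only [bivec, Pi.smul_apply, smul_eq_mul]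
  ring

theorem bivec_combination {n : ℕ} (s t s' t' : ℂ) (v w : Fin n → ℂ) :
    bivec (s • v + t • w) (s' • v + t' • w) = (s * t' - t * s') • bivec v w := by
  funext p
  simp only [bivec, Pi.smul_apply, Pi.add_apply, smul_eq_mul]
  ring

theorem bivec_ne_zero {n : ℕ} {v w : Fin n → ℂ} (h : LinearIndependent ℂ ![v, w]) :
    bivec v w ≠ 0 := by
  intro h0
  rw [LinearIndependent.pair_iff] at h
  by_cases hv : v = 0
  · have := h 1 0 (by simp [hv])
    simp at this
  · obtain ⟨a, ha⟩ := Function.ne_iff.mp hv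
    have := h (w a) (-v a) (by
      funext b
      have := congr_fun h0 (a, b)
      simp only [bivec, Pi.add_apply, Pi.smul_apply, smul_eq_mul, Pi.zero_apply] at this ⊢
      linear_combination - this)
    exact ha (neg_eq_zero.mp this.2)

theorem IsGood.exists_combination {m n : ℕ} {v : Fin m → Fin (n + 1) → ℂ} (hv : IsGood v)
    {a b : Fin m} (hab : a ≠ b) (i : Fin m) : ∃ s t : ℂ, v i = s • v a + t • v b := by
  have hle : span ℂ {v a, v b} ≤ span ℂ (Set.range v) :=
    span_mono (by rintro _ (rfl | rfl) <;> exact Set.mem_range_self _)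
  have hfin : finrank ℂ (span ℂ {v a, v b}) = 2 := by
    have := finrank_span_eq_card (hv.2.1 a b hab)
    rwa [Matrix.range_cons_cons_empty, Fintype.card_fin] at this
  have heq := eq_of_le_of_finrank_eq hle (hfin.trans hv.2.2.symm)
  have hi : v i ∈ span ℂ {v a, v b} := heq ▸ subset_span (Set.mem_range_self i)
  obtain ⟨s, t, h⟩ := mem_span_pair.mp hi
  exact ⟨s, t, h.symm⟩

/-- The Plücker coordinates of the first and the last vector. -/
def refBivec {k n : ℕ} (v : Fin (k + 1) → Fin n → ℂ) : Fin n × Fin n → ℂ :=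
  bivec (v 0) (v (Fin.last k))

/-- The area spanned by two vectors of a tuple, relative to the first and the last vector. -/
def areaRatio {k n : ℕ} (v : Fin (k + 1) → Fin n → ℂ) (i j : Fin (k + 1)) : ℂ :=
  (∑ p, star (refBivec v p) * bivec (v i) (v j) p) / ∑ p, star (refBivec v p) * refBivec v p

theorem sum_star_mul_self_ne_zero {ι : Type*} [Fintype ι] {x : ι → ℂ} (hx : x ≠ 0) :
    ∑ p, star (x p) * x p ≠ 0 := by
  open scoped ComplexOrder in
  have h := (dotProduct_star_self_eq_zero (v := x)).not.mpr hx
  simpa [dotProduct, mul_comm] using h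

section

variable {k n : ℕ} {v w : Fin (k + 1) → Fin (n + 1) → ℂ}

theorem IsGood.refBivec_ne_zero (hk : 0 < k) (hv : IsGood v) : refBivec v ≠ 0 :=
  bivec_ne_zero (hv.2.1 _ _ (by simp [Fin.ext_iff, hk.ne]))

theorem IsGood.bivec_eq (hk : 0 < k) (hv : IsGood v) (i j : Fin (k + 1)) :
    bivec (v i) (v j) = areaRatio v i j • refBivec v := by
  have h0 : (0 : Fin (k + 1)) ≠ Fin.last k := by simp [Fin.ext_iff, hk.ne]
  obtain ⟨s, t, hi⟩ := hv.exists_combination h0 i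
  obtain ⟨s', t', hj⟩ := hv.exists_combination h0 j
  have h : bivec (v i) (v j) = (s * t' - t * s') • refBivec v := by
    rw [hi, hj, bivec_combination, refBivec]
  have hne := sum_star_mul_self_ne_zero (hv.refBivec_ne_zero hk)
  rw [areaRatio, h]
  congr 1
  rw [eq_div_iff hne, Finset.mul_sum]
  refine Finset.sum_congr rfl fun p _ => ?_
  simp only [Pi.smul_apply, smul_eq_mul]
  ring

theorem IsGood.areaRatio_ne_zero (hk : 0 < k) (hv : IsGood v) {i j : Fin (k + 1)} (hij : i ≠ j) :
    areaRatio v i j ≠ 0 := by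
  intro h
  have := hv.bivec_eq hk i j
  rw [h, zero_smul] at this
  exact bivec_ne_zero (hv.2.1 _ _ hij) this

theorem IsGood.areaRatio_eq (hk : 0 < k) (hv : IsGood v) {i j : Fin (k + 1)} {r : ℂ}
    (h : bivec (v i) (v j) = r • refBivec v) : areaRatio v i j = r :=
  smul_left_injective ℂ (hv.refBivec_ne_zero hk) ((hv.bivec_eq hk i j).symm.trans h)

theorem continuous_bivec (i j : Fin (k + 1)) (p : Fin (n + 1) × Fin (n + 1)) :
    Continuous fun v : GoodTuple (k + 1) n => bivec (v.1 i) (v.1 j) p := by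
  have h : ∀ i a, Continuous fun v : GoodTuple (k + 1) n => v.1 i a := fun i a =>
    (continuous_apply_apply i a).comp continuous_subtype_val
  exact ((h _ _).mul (h _ _)).sub ((h _ _).mul (h _ _))

theorem continuous_areaRatio (hk : 0 < k) (i j : Fin (k + 1)) :
    Continuous fun v : GoodTuple (k + 1) n => areaRatio v.1 i j :=
  Continuous.div
    (continuous_finsetSum _ fun _ _ => (continuous_bivec _ _ _).star.mul (continuous_bivec _ _ _))
    (continuous_finsetSum _ fun _ _ => (continuous_bivec _ _ _).star.mul (continuous_bivec _ _ _))
    fun v => sum_star_mul_self_ne_zero (v.2.refBivec_ne_zero hk)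

/-- The discriminant of a tuple of vectors in a plane. -/
def disc (v : Fin (k + 1) → Fin (n + 1) → ℂ) : ℂ :=
  ∏ i, ∏ j ∈ Finset.univ.erase i, areaRatio v i j

theorem IsGood.disc_ne_zero (hk : 0 < k) (hv : IsGood v) : disc v ≠ 0 :=
  Finset.prod_ne_zero_iff.mpr fun _ _ => Finset.prod_ne_zero_iff.mpr fun _ hj =>
    hv.areaRatio_ne_zero hk (Finset.ne_of_mem_erase hj).symm

theorem continuous_disc (hk : 0 < k) : Continuous fun v : GoodTuple (k + 1) n => disc v.1 :=
  continuous_finsetProd _ fun i _ => continuous_finsetProd _ fun j _ => continuous_areaRatio hk i j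

theorem prod_prod_erase_mul (a : Fin (k + 1) → ℂˣ) :
    ∏ i, ∏ j ∈ Finset.univ.erase i, ((a i : ℂ) * a j) = (∏ i, (a i : ℂ)) ^ (2 * k) := by
  have h : ∀ i, ∏ j ∈ Finset.univ.erase i, ((a i : ℂ) * a j)
      = (a i : ℂ) ^ k * ((∏ j, (a j : ℂ)) / a i) := by
    intro i
    rw [Finset.prod_mul_distrib, Finset.prod_const, Finset.card_erase_of_mem (Finset.mem_univ i),
      Finset.card_univ, Fintype.card_fin, Nat.add_sub_cancel,
      ← Finset.mul_prod_erase _ _ (Finset.mem_univ i), mul_div_cancel_left₀ _ (a i).ne_zero]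
  have hA : ∏ i, (a i : ℂ) ≠ 0 := Finset.prod_ne_zero_iff.mpr fun i _ => (a i).ne_zero
  simp only [h]
  rw [Finset.prod_mul_distrib, Finset.prod_pow, Finset.prod_div_distrib, Finset.prod_const,
    Finset.card_univ, Fintype.card_fin, pow_succ, mul_div_cancel_right₀ _ hA, ← pow_add, two_mul]

/-- The behaviour of the discriminant under rescaling and permuting the vectors. -/
theorem IsGood.disc_smul_perm (hk : 0 < k) (hv : IsGood v) (hw : IsGood w)
    {σ : Equiv.Perm (Fin (k + 1))} {a : Fin (k + 1) → ℂˣ} (h : ∀ j, w j = a j • v (σ j)) {q : ℂ}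
    (hq : refBivec w = q • refBivec v) :
    disc w * q ^ ((k + 1) * k) = (∏ i, (a i : ℂ)) ^ (2 * k) * disc v := by
  have hr : ∀ i j, areaRatio w i j * q = (a i * a j) * areaRatio v (σ i) (σ j) := by
    intro i j
    refine smul_left_injective ℂ (hv.refBivec_ne_zero hk) ?_
    simp only
    rw [mul_smul, ← hq, ← hw.bivec_eq hk, h, h, mul_smul, ← hv.bivec_eq hk]
    exact bivec_smul_smul _ _ _ _
  have h1 : disc w * q ^ ((k + 1) * k)
      = ∏ i, ∏ j ∈ Finset.univ.erase i, (areaRatio w i j * q) := by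
    simp only [Finset.prod_mul_distrib, Finset.prod_const, disc,
      Finset.card_erase_of_mem (Finset.mem_univ _), Finset.card_univ, Fintype.card_fin,
      Nat.add_sub_cancel]
    rw [← pow_mul, mul_comm k]
  have h2 : ∏ i, ∏ j ∈ Finset.univ.erase i, areaRatio v (σ i) (σ j) = disc v := by
    refine Fintype.prod_equiv σ _ _ fun i => Finset.prod_equiv σ (fun j => ?_) fun j _ => rfl
    simp
  rw [h1, ← prod_prod_erase_mul, ← h2]
  simp only [hr, Finset.prod_mul_distrib]

end

section

open Topology

/-- Tuples of vectors in a plane, with a root of their discriminant. -/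
abbrev RootTuple (k n N : ℕ) := {x : GoodTuple (k + 1) n × ℂ // x.2 ^ N = disc x.1.1}

/-- Rescaling and permuting the vectors of a tuple changes a root of the discriminant in a
prescribed way. -/
def RootTuple.Rel {k n N : ℕ} (e₁ e₂ : ℕ) (x y : RootTuple k n N) : Prop :=
  ∃ (σ : Equiv.Perm (Fin (k + 1))) (a : Fin (k + 1) → ℂˣ) (q : ℂˣ),
    (∀ j, y.1.1.1 j = a j • x.1.1.1 (σ j)) ∧ refBivec y.1.1.1 = q • refBivec x.1.1.1 ∧
      y.1.2 * q ^ e₂ = (∏ i, (a i : ℂ)) ^ e₁ * x.1.2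

/-- The equivalence relation generated by rescaling and permuting. -/
def rootSetoid (k n N e₁ e₂ : ℕ) : Setoid (RootTuple k n N) where
  r := RootTuple.Rel e₁ e₂
  iseqv := by
    constructor
    · exact fun x => ⟨1, 1, 1, by simp, by simp, by simp⟩
    · rintro x y ⟨σ, a, q, ha, hq, hξ⟩
      refine ⟨σ⁻¹, fun j => (a (σ⁻¹ j))⁻¹, q⁻¹, fun j => ?_, ?_, ?_⟩
      · rw [ha, inv_smul_smul]
        simp
      · rw [hq, inv_smul_smul]
      · have h : ∏ i, (((a (σ⁻¹ i))⁻¹ : ℂˣ) : ℂ) = (∏ i, (a i : ℂ))⁻¹ := by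
          rw [← Finset.prod_inv_distrib]
          exact Fintype.prod_equiv σ⁻¹ _ _ fun i => by simp
        have hA : ∏ i, (a i : ℂ) ≠ 0 := Finset.prod_ne_zero_iff.mpr fun i _ => (a i).ne_zero
        rw [h, inv_pow, eq_inv_mul_iff_mul_eq₀ (pow_ne_zero _ hA), Units.val_inv_eq_inv_val,
          inv_pow, ← mul_assoc, ← hξ, mul_inv_cancel_right₀ (pow_ne_zero _ q.ne_zero)]
    · rintro x y z ⟨σ, a, q, ha, hq, hξ⟩ ⟨τ, b, r, hb, hr, hζ⟩
      refine ⟨σ * τ, fun j => b j * a (τ j), r * q, fun j => ?_, ?_, ?_⟩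
      · rw [hb, ha, smul_smul, Equiv.Perm.mul_apply]
      · rw [hr, hq, smul_smul]
      · have h : ∏ i, ((b i * a (τ i) : ℂˣ) : ℂ) = (∏ i, (b i : ℂ)) * ∏ i, (a i : ℂ) := by
          simp only [Units.val_mul, Finset.prod_mul_distrib]
          rw [Fintype.prod_equiv τ (fun i => (a (τ i) : ℂ)) (fun i => (a i : ℂ)) fun _ => rfl]
        rw [h, Units.val_mul, mul_pow, mul_pow, ← mul_assoc, hζ, mul_assoc, hξ, mul_assoc]

/-- Configurations with a root of the discriminant. -/
def RootConf (k n N e₁ e₂ : ℕ) : Type := Quotient (rootSetoid k n N e₁ e₂)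

namespace RootConf

variable {k n N e₁ e₂ : ℕ}

instance : TopologicalSpace (RootConf k n N e₁ e₂) :=
  inferInstanceAs (TopologicalSpace (Quotient (rootSetoid k n N e₁ e₂)))

/-- The class of a tuple with a root of its discriminant. -/
def mk (e₁ e₂ : ℕ) (x : RootTuple k n N) : RootConf k n N e₁ e₂ :=
  Quotient.mk (rootSetoid k n N e₁ e₂) x

theorem mk_eq_iff {x y : RootTuple k n N} : mk e₁ e₂ x = mk e₁ e₂ y ↔ x.Rel e₁ e₂ y := Quotient.eq

theorem isQuotientMap_mk : IsQuotientMap (mk e₁ e₂ : RootTuple k n N → RootConf k n N e₁ e₂) :=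
  isQuotientMap_quot_mk

/-- Forgetting the root. -/
def proj : RootConf k n N e₁ e₂ → Cconf (k + 1) 1 n :=
  Quotient.lift (fun x => conf x.1.1) fun _ _ ⟨σ, a, _, h, _⟩ => conf_eq_iff.mpr ⟨σ, a, h⟩

end RootConf

instance {k n N : ℕ} : MulAction (rootsOfUnity N ℂ) (RootTuple k n N) where
  smul ζ x := ⟨(x.1.1, (ζ : ℂˣ) * x.1.2), by
    rw [mul_pow, (mem_rootsOfUnity' N (ζ : ℂˣ)).mp ζ.2, one_mul, x.2]⟩
  one_smul x := Subtype.ext (Prod.ext rfl (one_mul _))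
  mul_smul ζ ζ' x := Subtype.ext (Prod.ext rfl (mul_assoc _ _ _))

theorem RootTuple.smul_val {k n N : ℕ} (ζ : rootsOfUnity N ℂ) (x : RootTuple k n N) :
    (ζ • x).1 = (x.1.1, (ζ : ℂˣ) * x.1.2) := rfl

namespace RootConf

variable {k n N e₁ e₂ : ℕ}

instance : MulAction (rootsOfUnity N ℂ) (RootConf k n N e₁ e₂) where
  smul ζ := Quotient.map (ζ • ·) fun x y ⟨σ, a, q, ha, hq, hξ⟩ =>
    ⟨σ, a, q, ha, hq, by
      rw [RootTuple.smul_val, RootTuple.smul_val]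
      simp only
      rw [mul_assoc, hξ]
      ring⟩
  one_smul := by
    rintro ⟨x⟩
    exact congrArg (mk e₁ e₂) (one_smul _ x)
  mul_smul := by
    rintro ζ ζ' ⟨x⟩
    exact congrArg (mk e₁ e₂) (mul_smul ζ ζ' x)

theorem smul_mk (ζ : rootsOfUnity N ℂ) (x : RootTuple k n N) :
    ζ • mk e₁ e₂ x = mk e₁ e₂ (ζ • x) := rfl

instance : ContinuousConstSMul (rootsOfUnity N ℂ) (RootTuple k n N) where
  continuous_const_smul ζ := by
    refine Continuous.subtype_mk (Continuous.prodMk ?_ ?_) _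
    · fun_prop
    · fun_prop

instance : ContinuousConstSMul (rootsOfUnity N ℂ) (RootConf k n N e₁ e₂) where
  continuous_const_smul ζ := by
    rw [isQuotientMap_mk.continuous_iff]
    exact isQuotientMap_mk.continuous.comp (continuous_const_smul ζ)

end RootConf

/-- The projection forgetting the root is open: roots of the discriminant vary continuously. -/
theorem RootTuple.isOpenMap_fst {k n N : ℕ} (hk : 0 < k) (hN : N ≠ 0) :
    IsOpenMap fun x : RootTuple k n N => x.1.1 := by
  refine IsOpenMap.of_sections fun x => ?_
  have hx : disc x.1.1.1 ≠ 0 := x.1.1.2.disc_ne_zero hk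
  refine ⟨fun v => ⟨(v, x.1.2 * (disc v.1 / disc x.1.1.1) ^ ((N : ℂ)⁻¹)), ?_⟩, ?_, ?_, fun v => rfl⟩
  · rw [mul_pow, Complex.cpow_nat_inv_pow _ hN, x.2, mul_div_cancel₀ _ hx]
  · refine Topology.IsInducing.subtypeVal.continuousAt_iff.mpr
      (continuousAt_id.prodMk (continuousAt_const.mul ?_))
    refine ContinuousAt.cpow ?_ continuousAt_const ?_
    · exact ((continuous_disc hk).div_const _).continuousAt
    · rw [div_self hx]
      simp
  · refine Subtype.ext (Prod.ext rfl ?_)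
    simp only
    rw [div_self hx, Complex.one_cpow, mul_one]

theorem RootConf.isQuotientMap_proj {k n N e₁ e₂ : ℕ} (hk : 0 < k) (hN : N ≠ 0) :
    IsQuotientMap (proj : RootConf k n N e₁ e₂ → Cconf (k + 1) 1 n) := by
  have hc : Continuous (fun x : RootTuple k n N => conf x.1.1) :=
    (isOpenQuotientMap_conf _ _).continuous.comp (by fun_prop)
  refine IsQuotientMap.of_comp (f := mk e₁ e₂) isQuotientMap_mk.continuous
    (isQuotientMap_mk.continuous_iff.mpr hc) ?_
  refine IsOpenMap.isQuotientMap (f := fun x : RootTuple k n N => conf x.1.1) ?_ hc ?_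
  · exact (isOpenQuotientMap_conf _ _).isOpenMap.comp (RootTuple.isOpenMap_fst hk hN)
  · intro x
    obtain ⟨v, rfl⟩ := (isOpenQuotientMap_conf _ _).surjective x
    exact ⟨⟨(v, disc v.1 ^ ((N : ℂ)⁻¹)), Complex.cpow_nat_inv_pow _ hN⟩, rfl⟩

end

section

open Topology

/-- The factor by which rescaling and permuting changes the first and the last vector. -/
def refFactor {k n : ℕ} (σ : Equiv.Perm (Fin (k + 1))) (a : Fin (k + 1) → ℂˣ)
    (v : Fin (k + 1) → Fin n → ℂ) : ℂ :=
  a 0 * a (Fin.last k) * areaRatio v (σ 0) (σ (Fin.last k))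

theorem IsGood.refBivec_smul_perm {k n : ℕ} {v w : Fin (k + 1) → Fin (n + 1) → ℂ} (hk : 0 < k)
    (hv : IsGood v) {σ : Equiv.Perm (Fin (k + 1))} {a : Fin (k + 1) → ℂˣ}
    (h : ∀ j, w j = a j • v (σ j)) : refBivec w = refFactor σ a v • refBivec v := by
  rw [refBivec, h, h, refFactor, mul_smul, ← hv.bivec_eq hk]
  exact bivec_smul_smul _ _ _ _

theorem IsGood.refFactor_ne_zero {k n : ℕ} {v : Fin (k + 1) → Fin (n + 1) → ℂ} (hk : 0 < k)
    (hv : IsGood v) (σ : Equiv.Perm (Fin (k + 1))) (a : Fin (k + 1) → ℂˣ) :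
    refFactor σ a v ≠ 0 :=
  mul_ne_zero (mul_ne_zero (a _).ne_zero (a _).ne_zero)
    (hv.areaRatio_ne_zero hk (σ.injective.ne (by simp [Fin.ext_iff, hk.ne])))

theorem prod_units_ne_zero {ι : Type*} [Fintype ι] (a : ι → ℂˣ) : ∏ i, (a i : ℂ) ≠ 0 :=
  Finset.prod_ne_zero_iff.mpr fun i _ => (a i).ne_zero

namespace RootTuple

variable {k n N e₁ e₂ : ℕ}

theorem root_ne_zero (hk : 0 < k) (hN : N ≠ 0) (x : RootTuple k n N) : x.1.2 ≠ 0 := by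
  intro h
  have := x.2
  rw [h, zero_pow hN] at this
  exact x.1.1.2.disc_ne_zero hk this.symm

/-- Rescaling and permuting the vectors of a tuple with a root of its discriminant. -/
def transport (hk : 0 < k) (h₁ : N * e₁ = 2 * k) (h₂ : N * e₂ = (k + 1) * k)
    (σ : Equiv.Perm (Fin (k + 1))) (a : Fin (k + 1) → ℂˣ) (x : RootTuple k n N) :
    RootTuple k n N :=
  ⟨(⟨fun j => a j • x.1.1.1 (σ j), x.1.1.2.smul_perm σ a⟩,
    (∏ i, (a i : ℂ)) ^ e₁ * x.1.2 / refFactor σ a x.1.1.1 ^ e₂), by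
    have h := x.1.1.2.disc_smul_perm hk (x.1.1.2.smul_perm σ a) (fun j => rfl)
      (x.1.1.2.refBivec_smul_perm hk fun j => rfl)
    rw [div_pow, mul_pow, ← pow_mul, ← pow_mul, mul_comm e₁, mul_comm e₂, h₁, h₂, x.2, ← h,
      mul_div_cancel_right₀ _ (pow_ne_zero _ (x.1.1.2.refFactor_ne_zero hk σ a))]⟩

variable (hk : 0 < k) (h₁ : N * e₁ = 2 * k) (h₂ : N * e₂ = (k + 1) * k)

theorem continuous_transport (σ : Equiv.Perm (Fin (k + 1))) (a : Fin (k + 1) → ℂˣ) :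
    Continuous (transport hk h₁ h₂ σ a : RootTuple k n N → _) := by
  refine Continuous.subtype_mk (Continuous.prodMk (Continuous.subtype_mk ?_ _) ?_) _
  · refine continuous_pi fun j => Continuous.const_smul ?_ _
    exact (continuous_apply (σ j)).comp
      (continuous_subtype_val.comp (continuous_fst.comp continuous_subtype_val))
  · refine Continuous.div (by fun_prop) (Continuous.pow ?_ _)
      fun x => pow_ne_zero _ (x.1.1.2.refFactor_ne_zero hk σ a)
    exact continuous_const.mul ((continuous_areaRatio hk _ _).comp
      (continuous_fst.comp continuous_subtype_val))

theorem rel_transport (σ : Equiv.Perm (Fin (k + 1))) (a : Fin (k + 1) → ℂˣ) (x : RootTuple k n N) :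
    x.Rel e₁ e₂ (transport hk h₁ h₂ σ a x) :=
  ⟨σ, a, Units.mk0 _ (x.1.1.2.refFactor_ne_zero hk σ a), fun _ => rfl,
    x.1.1.2.refBivec_smul_perm hk fun _ => rfl,
    div_mul_cancel₀ _ (pow_ne_zero _ (x.1.1.2.refFactor_ne_zero hk σ a))⟩

theorem refFactor_eq (hk : 0 < k) {v w : GoodTuple (k + 1) n} {σ : Equiv.Perm (Fin (k + 1))}
    {a : Fin (k + 1) → ℂˣ} (ha : ∀ j, w.1 j = a j • v.1 (σ j)) {q : ℂ}
    (hq : refBivec w.1 = q • refBivec v.1) : q = refFactor σ a v.1 :=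
  smul_left_injective ℂ (v.2.refBivec_ne_zero hk) (hq.symm.trans (v.2.refBivec_smul_perm hk ha))

theorem Rel.exists_transport_eq {x y : RootTuple k n N} (h : x.Rel e₁ e₂ y) :
    ∃ σ a, transport hk h₁ h₂ σ a x = y := by
  obtain ⟨σ, a, q, ha, hq, hξ⟩ := h
  refine ⟨σ, a, Subtype.ext (Prod.ext (Subtype.ext (funext fun j => (ha j).symm)) ?_)⟩
  change _ / refFactor σ a x.1.1.1 ^ e₂ = _
  rw [← refFactor_eq hk ha hq, ← hξ, mul_div_cancel_right₀ _ (pow_ne_zero _ q.ne_zero)]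

end RootTuple

namespace RootConf

variable {k n N e₁ e₂ : ℕ}

theorem isOpenMap_mk (hk : 0 < k) (h₁ : N * e₁ = 2 * k) (h₂ : N * e₂ = (k + 1) * k) :
    IsOpenMap (mk e₁ e₂ : RootTuple k n N → RootConf k n N e₁ e₂) := by
  intro W hW
  rw [← isQuotientMap_mk.isOpen_preimage]
  refine isOpen_iff_mem_nhds.mpr ?_
  rintro y ⟨x, hx, hxy⟩
  obtain ⟨σ, a, rfl⟩ := (mk_eq_iff.mp hxy.symm).exists_transport_eq hk h₁ h₂
  filter_upwards [(RootTuple.continuous_transport hk h₁ h₂ σ a).continuousAt.preimage_mem_nhds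
    (hW.mem_nhds hx)] with z hz
  exact ⟨_, hz, (mk_eq_iff.mpr (RootTuple.rel_transport hk h₁ h₂ σ a z)).symm⟩

theorem proj_eq_iff (hk : 0 < k) (h₁ : N * e₁ = 2 * k) (h₂ : N * e₂ = (k + 1) * k)
    {x y : RootConf k n N e₁ e₂} :
    proj x = proj y ↔ x ∈ MulAction.orbit (rootsOfUnity N ℂ) y := by
  obtain ⟨x, rfl⟩ := isQuotientMap_mk.surjective x
  obtain ⟨y, rfl⟩ := isQuotientMap_mk.surjective y
  constructor
  · intro h
    have hN : N ≠ 0 := by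
      rintro rfl
      omega
    obtain ⟨σ, a, ha⟩ := conf_eq_iff.mp h.symm
    have hx : x.1.1 = (RootTuple.transport hk h₁ h₂ σ a y).1.1 := Subtype.ext (funext ha)
    have hy0 := RootTuple.root_ne_zero hk hN (RootTuple.transport hk h₁ h₂ σ a y)
    set y' := RootTuple.transport hk h₁ h₂ σ a y with hy'
    have hpow : (x.1.2 / y'.1.2) ^ N = 1 := by
      rw [div_pow, x.2, y'.2, hx, div_self (y'.1.1.2.disc_ne_zero hk)]
    have : NeZero N := ⟨hN⟩
    refine ⟨rootsOfUnity.mkOfPowEq _ hpow, ?_⟩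
    change rootsOfUnity.mkOfPowEq _ hpow • mk e₁ e₂ y = mk e₁ e₂ x
    rw [mk_eq_iff.mpr (RootTuple.rel_transport hk h₁ h₂ σ a y), smul_mk]
    congr 1
    refine Subtype.ext (Prod.ext hx.symm ?_)
    rw [RootTuple.smul_val]
    simp only [rootsOfUnity.coe_mkOfPowEq]
    exact div_mul_cancel₀ _ hy0
  · rintro ⟨ζ, h⟩
    rw [← h]
    rfl

end RootConf

end

section

open Topology

/-- The factor between two proportional vectors. -/
def vecRatio {ι : Type*} [Fintype ι] (v w : ι → ℂ) : ℂ :=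
  (∑ p, star (v p) * w p) / ∑ p, star (v p) * v p

theorem vecRatio_smul {ι : Type*} [Fintype ι] {v : ι → ℂ} (hv : v ≠ 0) (a : ℂ) :
    vecRatio v (a • v) = a := by
  rw [vecRatio, div_eq_iff (sum_star_mul_self_ne_zero hv), Finset.mul_sum]
  refine Finset.sum_congr rfl fun p _ => ?_
  simp only [Pi.smul_apply, smul_eq_mul]
  ring

theorem vecRatio_self {ι : Type*} [Fintype ι] {v : ι → ℂ} (hv : v ≠ 0) : vecRatio v v = 1 := by
  simpa using vecRatio_smul hv 1

theorem continuousAt_vecRatio {ι Y : Type*} [Fintype ι] [TopologicalSpace Y] {f g : Y → ι → ℂ}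
    {y : Y} (hf : ContinuousAt f y) (hg : ContinuousAt g y) (h : f y ≠ 0) :
    ContinuousAt (fun y => vecRatio (f y) (g y)) y := by
  have hf' := fun p => continuousAt_pi.mp hf p
  have hg' := fun p => continuousAt_pi.mp hg p
  refine ContinuousAt.div ?_ ?_ (sum_star_mul_self_ne_zero h)
  · exact tendsto_finsetSum _ fun p _ => (hf' p).star.mul (hg' p)
  · exact tendsto_finsetSum _ fun p _ => (hf' p).star.mul (hf' p)

namespace RootTuple

variable {k n N e₁ e₂ : ℕ}

/-- The root of unity relating two close tuples in the same class. -/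
def deckRatio (e₁ e₂ : ℕ) (x y : RootTuple k n N) : ℂ :=
  y.1.2 * vecRatio (refBivec x.1.1.1) (refBivec y.1.1.1) ^ e₂ /
    ((∏ i, vecRatio (x.1.1.1 i) (y.1.1.1 i)) ^ e₁ * x.1.2)

theorem vec_ne_zero (x : RootTuple k n N) (i : Fin (k + 1)) : x.1.1.1 i ≠ 0 := x.1.1.2.1 i

theorem deckRatio_self (hk : 0 < k) (hN : N ≠ 0) (x : RootTuple k n N) :
    deckRatio e₁ e₂ x x = 1 := by
  rw [deckRatio, vecRatio_self (x.1.1.2.refBivec_ne_zero hk),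
    Finset.prod_eq_one fun i _ => vecRatio_self (x.vec_ne_zero i), one_pow, one_pow, mul_one,
    one_mul, div_self (x.root_ne_zero hk hN)]

theorem continuous_coord (i : Fin (k + 1)) : Continuous fun x : RootTuple k n N => x.1.1.1 i :=
  (continuous_apply i).comp
    (continuous_subtype_val.comp (continuous_fst.comp continuous_subtype_val))

theorem continuous_refBivec : Continuous fun x : RootTuple k n N => refBivec x.1.1.1 :=
  continuous_pi fun p => by
    have h := fun i q => (continuous_apply q).comp (continuous_coord (k := k) (n := n) (N := N) i)
    exact ((h _ _).mul (h _ _)).sub ((h _ _).mul (h _ _))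

theorem continuousAt_deckRatio (hk : 0 < k) (hN : N ≠ 0) (x : RootTuple k n N) :
    ContinuousAt (fun p : RootTuple k n N × RootTuple k n N => deckRatio e₁ e₂ p.1 p.2) (x, x) := by
  have hroot : Continuous fun y : RootTuple k n N => y.1.2 := by fun_prop
  have hprod : ContinuousAt (fun p : RootTuple k n N × RootTuple k n N =>
      ∏ i, vecRatio (p.1.1.1.1 i) (p.2.1.1.1 i)) (x, x) :=
    tendsto_finsetProd _ fun i _ => continuousAt_vecRatio
      ((continuous_coord i).comp continuous_fst).continuousAt
      ((continuous_coord i).comp continuous_snd).continuousAt (x.vec_ne_zero i)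
  refine ContinuousAt.div ?_ ?_ ?_
  · exact (hroot.comp continuous_snd).continuousAt.mul ((continuousAt_vecRatio
      (continuous_refBivec.comp continuous_fst).continuousAt
      (continuous_refBivec.comp continuous_snd).continuousAt
      (x.1.1.2.refBivec_ne_zero hk)).pow _)
  · exact (hprod.pow _).mul (hroot.comp continuous_fst).continuousAt
  · rw [Finset.prod_eq_one fun i _ => vecRatio_self (x.vec_ne_zero i), one_pow, one_mul]
    exact x.root_ne_zero hk hN

theorem deckRatio_eq (hk : 0 < k) (hN : N ≠ 0) {x y : RootTuple k n N} {ζ : rootsOfUnity N ℂ}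
    (h : (ζ • x).Rel e₁ e₂ y) (hxy : ∀ i j, i ≠ j → bivec (y.1.1.1 i) (x.1.1.1 j) ≠ 0) :
    deckRatio e₁ e₂ x y = (ζ : ℂˣ) := by
  obtain ⟨σ, a, q, ha, hq, hξ⟩ := h
  rw [smul_val] at ha hq hξ
  have hσ : σ = 1 := by
    ext1 i
    by_contra hi
    refine hxy i (σ i) (Ne.symm hi) ?_
    rw [ha]
    funext p
    simp only [bivec, Pi.smul_apply, Units.smul_def, smul_eq_mul, Pi.zero_apply]
    ring
  subst hσ
  have hA : ∀ i, vecRatio (x.1.1.1 i) (y.1.1.1 i) = a i := fun i => by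
    rw [ha]
    exact vecRatio_smul (x.vec_ne_zero i) _
  have hQ : vecRatio (refBivec x.1.1.1) (refBivec y.1.1.1) = q := by
    rw [hq]
    exact vecRatio_smul (x.1.1.2.refBivec_ne_zero hk) _
  rw [deckRatio, hQ, Finset.prod_congr rfl fun i _ => hA i, hξ, div_eq_iff
    (mul_ne_zero (pow_ne_zero _ (prod_units_ne_zero a)) (x.root_ne_zero hk hN))]
  ring

theorem eventually_bivec_ne_zero (x : RootTuple k n N) :
    ∀ᶠ p : RootTuple k n N × RootTuple k n N in 𝓝 (x, x),
      ∀ i j, i ≠ j → bivec (p.2.1.1.1 i) (p.1.1.1.1 j) ≠ 0 := by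
  simp only [Filter.eventually_all]
  intro i j hij
  refine ContinuousAt.eventually_ne ?_ (bivec_ne_zero (x.1.1.2.2.1 i j hij))
  refine (continuous_pi fun p => ?_).continuousAt
  have h := fun i q => (continuous_apply q).comp (continuous_coord (k := k) (n := n) (N := N) i)
  exact (((h i p.1).comp continuous_snd).mul ((h j p.2).comp continuous_fst)).sub
    (((h i p.2).comp continuous_snd).mul ((h j p.1).comp continuous_fst))

theorem eventually_eq_one_of_rel (hk : 0 < k) (hN : N ≠ 0) (x : RootTuple k n N) :
    ∀ᶠ p : RootTuple k n N × RootTuple k n N in 𝓝 (x, x),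
      ∀ ζ : rootsOfUnity N ℂ, (ζ • p.1).Rel e₁ e₂ p.2 → ζ = 1 := by
  have : NeZero N := ⟨hN⟩
  have hS : {z : ℂ | ∃ ζ : rootsOfUnity N ℂ, ζ ≠ 1 ∧ ((ζ : ℂˣ) : ℂ) = z}.Finite :=
    (Set.finite_range fun ζ : rootsOfUnity N ℂ => ((ζ : ℂˣ) : ℂ)).subset
      fun z ⟨ζ, _, hζ⟩ => ⟨ζ, hζ⟩
  have h1 : (1 : ℂ) ∉ {z : ℂ | ∃ ζ : rootsOfUnity N ℂ, ζ ≠ 1 ∧ ((ζ : ℂˣ) : ℂ) = z} := by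
    rintro ⟨ζ, hζ, h⟩
    exact hζ (Subtype.ext (Units.ext h))
  have hev := (continuousAt_deckRatio (e₁ := e₁) (e₂ := e₂) hk hN x).preimage_mem_nhds
    (by
      simp only [deckRatio_self hk hN x]
      exact hS.isClosed.isOpen_compl.mem_nhds h1)
  filter_upwards [hev, x.eventually_bivec_ne_zero] with p hp hp' ζ hζ
  by_contra hne
  exact hp ⟨ζ, hne, (deckRatio_eq hk hN hζ hp').symm⟩

end RootTuple

theorem RootConf.isQuotientCoveringMap_proj {k n N e₁ e₂ : ℕ} (hk : 0 < k) (h₁ : N * e₁ = 2 * k)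
    (h₂ : N * e₂ = (k + 1) * k) :
    IsQuotientCoveringMap (proj : RootConf k n N e₁ e₂ → Cconf (k + 1) 1 n)
      (rootsOfUnity N ℂ) := by
  have hN : N ≠ 0 := by
    rintro rfl
    omega
  exact
  { __ := RootConf.isQuotientMap_proj hk hN
    apply_eq_iff_mem_orbit := RootConf.proj_eq_iff hk h₁ h₂
    disjoint := fun e => by
      obtain ⟨x, rfl⟩ := isQuotientMap_mk.surjective e
      have hev := RootTuple.eventually_eq_one_of_rel (e₁ := e₁) (e₂ := e₂) hk hN x
      rw [nhds_prod_eq] at hev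
      obtain ⟨W, hW, hWW⟩ := Filter.mem_prod_self_iff.mp hev
      refine ⟨mk e₁ e₂ '' W, (isOpenMap_mk hk h₁ h₂).image_mem_nhds hW, ?_⟩
      rintro ζ ⟨_, ⟨_, ⟨a, ha, rfl⟩, rfl⟩, ⟨b, hb, hab⟩⟩
      exact hWW (Set.mk_mem_prod ha hb) ζ (mk_eq_iff.mp hab.symm) }

end

section

open scoped unitInterval Topology

section

variable {k : ℕ} (hm : 2 ≤ k + 1) (n : ℕ) (z : PlaneConf (k + 1))

theorem bivec_affTuple (i j : Fin (k + 1)) :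
    bivec ((affTuple hm n z).1 i) ((affTuple hm n z).1 j)
      = (z.1 j - z.1 i) • bivec (Pi.single 0 1) (Pi.single 1 1) := by
  have := bivec_combination 1 (z.1 i) 1 (z.1 j)
    (Pi.single 0 1 : Fin (n + 2 + 1) → ℂ) (Pi.single 1 1)
  rw [one_mul, mul_one] at this
  exact this

theorem PlaneConf.last_sub_ne_zero (hk : 0 < k) (z : PlaneConf (k + 1)) :
    z.1 (Fin.last k) - z.1 0 ≠ 0 :=
  sub_ne_zero.mpr (z.2.ne (by simp [Fin.ext_iff, hk.ne']))

theorem areaRatio_affTuple (hk : 0 < k) (i j : Fin (k + 1)) :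
    areaRatio (affTuple hm n z).1 i j = (z.1 j - z.1 i) / (z.1 (Fin.last k) - z.1 0) := by
  refine (affTuple hm n z).2.areaRatio_eq hk ?_
  rw [refBivec, bivec_affTuple, bivec_affTuple, smul_smul,
    div_mul_cancel₀ _ (z.last_sub_ne_zero hk)]

/-- Multiplication of a configuration by a nonzero number. -/
def PlaneConf.scale (u : ℂˣ) (z : PlaneConf (k + 1)) : PlaneConf (k + 1) :=
  ⟨fun j => u * z.1 j, fun _ _ h => z.2 (mul_left_cancel₀ u.ne_zero h)⟩

theorem disc_affTuple_scale (hk : 0 < k) (u : ℂˣ) :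
    disc (affTuple hm n (z.scale u)).1 = disc (affTuple hm n z).1 := by
  simp only [disc, areaRatio_affTuple hm n _ hk, PlaneConf.scale, ← mul_sub,
    mul_div_mul_left _ _ u.ne_zero]

theorem refBivec_affTuple_scale (u : ℂˣ) :
    refBivec (affTuple hm n (z.scale u)).1 = u • refBivec (affTuple hm n z).1 := by
  rw [refBivec, refBivec, bivec_affTuple, bivec_affTuple, Units.smul_def, smul_smul,
    PlaneConf.scale, mul_sub]

end

theorem continuous_affTuple {m : ℕ} (hm : 2 ≤ m) (n : ℕ) : Continuous (affTuple hm n) := by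
  refine Continuous.subtype_mk (continuous_pi fun j => ?_) _
  have : Continuous fun z : PlaneConf m => z.1 j :=
    (continuous_apply j).comp continuous_subtype_val
  exact continuous_const.add (this.smul continuous_const)

/-- The exponential as a unit. -/
def expUnit (x : ℂ) : ℂˣ := Units.mk0 (Complex.exp x) (Complex.exp_ne_zero x)

/-- The rotation of a configuration by the angle `α`, with a root of the discriminant. -/
def rotationLift {k N : ℕ} (hk : 0 < k) (hm : 2 ≤ k + 1) (n : ℕ) (z : PlaneConf (k + 1)) (ξ : ℂ)
    (hξ : ξ ^ N = disc (affTuple hm n z).1) (α : ℂ) : C(I, RootTuple k (n + 2) N) where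
  toFun t := ⟨(affTuple hm n (z.scale (expUnit ((t : ℝ) * α))), ξ),
    hξ.trans (disc_affTuple_scale hm n z hk _).symm⟩
  continuous_toFun := by
    refine Continuous.subtype_mk (Continuous.prodMk ?_ continuous_const) _
    refine (continuous_affTuple hm n).comp (Continuous.subtype_mk (continuous_pi fun j => ?_) _)
    change Continuous fun t : I => Complex.exp ((t : ℝ) * α) * z.1 j
    fun_prop

theorem IsPrimitiveRoot.exists_mul_pow_eq {N : ℕ} {ω : ℂ} (h : IsPrimitiveRoot ω N) (hN : N ≠ 0)
    (i : ℕ) : ∃ j : Fin N, ω * ω ^ i = ω ^ (j : ℕ) := by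
  have : NeZero N := ⟨hN⟩
  obtain ⟨j, hj, hij⟩ := h.eq_pow_of_pow_eq_one (ξ := ω * ω ^ i)
    (by rw [← pow_succ', ← pow_mul', pow_mul, h.pow_eq_one, one_pow])
  exact ⟨⟨j, hj⟩, hij.symm⟩

namespace PathCocycle

variable {k n N e₁ e₂ : ℕ}

/-- The deck transformation of a rotation permuting the points of a configuration. -/
theorem eq_of_rotation (hk : 0 < k) (hN : N ≠ 0)
    {c : PathCocycle (Cconf (k + 1) 1 (n + 2)) (Additive (rootsOfUnity N ℂ))}
    (hc : ∀ (Γ : C(I, RootConf k (n + 2) N e₁ e₂)) (g : rootsOfUnity N ℂ), Γ 1 = g • Γ 0 →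
      ∀ γ : C(I, Cconf (k + 1) 1 (n + 2)), (∀ t, γ t = RootConf.proj (Γ t)) →
        c.toFun γ = Additive.ofMul g)
    (z : PlaneConf (k + 1)) {α : ℂ} (hα : ∀ i, ∃ j, Complex.exp α * z.1 i = z.1 j)
    {g : rootsOfUnity N ℂ} (hg : ((g : ℂˣ) : ℂ) = Complex.exp α ^ e₂) :
    ∃ γ : C(I, Cconf (k + 1) 1 (n + 2)), γ 0 = γ 1 ∧ c.toFun γ = Additive.ofMul g := by
  have hm : 2 ≤ k + 1 := by omega
  choose f hf using hα
  have hinj : Function.Injective f := fun i j h => z.2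
    (mul_left_cancel₀ (Complex.exp_ne_zero α) ((hf i).trans ((congrArg z.1 h).trans (hf j).symm)))
  let τ : Equiv.Perm (Fin (k + 1)) := Equiv.ofBijective f (Finite.injective_iff_bijective.mp hinj)
  let Γ₀ := rotationLift hk hm n z _ (Complex.cpow_nat_inv_pow (disc (affTuple hm n z).1) hN) α
  let Γ : C(I, RootConf k (n + 2) N e₁ e₂) :=
    ⟨fun t => RootConf.mk e₁ e₂ (Γ₀ t), RootConf.isQuotientMap_mk.continuous.comp Γ₀.continuous⟩
  have hproj : Continuous (RootConf.proj : RootConf k (n + 2) N e₁ e₂ → _) :=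
    (RootConf.isQuotientMap_proj hk hN).continuous
  have h0 : (Γ₀ 0).1.1 = affTuple hm n z := by
    change affTuple hm n _ = _
    congr 1
    refine Subtype.ext (funext fun j => ?_)
    simp [PlaneConf.scale, expUnit]
  have h1 : (Γ₀ 1).1.1 = affTuple hm n (z.scale (expUnit α)) := by
    change affTuple hm n _ = _
    simp
  have hrel : Γ 1 = g • Γ 0 := by
    change RootConf.mk e₁ e₂ (Γ₀ 1) = RootConf.mk e₁ e₂ (g • Γ₀ 0)
    refine (RootConf.mk_eq_iff.mpr ⟨τ, 1, expUnit α, fun j => ?_, ?_, ?_⟩).symm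
    · rw [h1, RootTuple.smul_val, h0, Pi.one_apply, one_smul]
      change _ + (Complex.exp α * z.1 j) • _ = _ + z.1 (f j) • _
      rw [hf]
    · rw [h1, RootTuple.smul_val, h0]
      exact refBivec_affTuple_scale hm n z _
    · rw [RootTuple.smul_val, hg]
      simp only [Pi.one_apply, Units.val_one, Finset.prod_const_one, one_pow, one_mul]
      exact mul_comm _ _
  refine ⟨⟨fun t => RootConf.proj (Γ t), hproj.comp Γ.continuous⟩, ?_, hc Γ g hrel _ fun _ => rfl⟩
  change RootConf.proj (Γ 0) = RootConf.proj (Γ 1)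
  rw [hrel]
  rfl

/-- A cocycle with values in the roots of unity, and two loops whose values differ by a primitive
root of unity: the rotations of a regular polygon without and with its center. -/
theorem exists_primitive (hk : 0 < k) (h₁ : N * e₁ = 2 * k) (h₂ : N * e₂ = (k + 1) * k) :
    ∃ (c : PathCocycle (Cconf (k + 1) 1 (n + 2)) (Additive (rootsOfUnity N ℂ)))
      (γ γ' : C(I, Cconf (k + 1) 1 (n + 2))) (ζ : rootsOfUnity N ℂ), γ 0 = γ 1 ∧ γ' 0 = γ' 1 ∧
        IsPrimitiveRoot ζ N ∧ c.toFun γ' - c.toFun γ = Additive.ofMul ζ := by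
  have hN : N ≠ 0 := by
    rintro rfl
    omega
  have : NeZero N := ⟨hN⟩
  have hk0 : (k : ℂ) ≠ 0 := Nat.cast_ne_zero.mpr hk.ne'
  have hk1 : (k : ℂ) + 1 ≠ 0 := Nat.cast_add_one_ne_zero k
  have hN0 : (N : ℂ) ≠ 0 := Nat.cast_ne_zero.mpr hN
  have h₂' : (N : ℂ) * e₂ = (k + 1) * k := mod_cast h₂
  obtain ⟨c, hc⟩ := exists_of_covering
    (RootConf.isQuotientCoveringMap_proj (n := n + 2) hk h₁ h₂)
  have hprim := Complex.isPrimitiveRoot_exp N hN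
  have hω := Complex.isPrimitiveRoot_exp (k + 1) k.succ_ne_zero
  have hω' := Complex.isPrimitiveRoot_exp k hk.ne'
  obtain ⟨γ, hγ, hcγ⟩ := eq_of_rotation hk hN hc
    ⟨fun l => Complex.exp (2 * Real.pi * Complex.I / ((k + 1 : ℕ) : ℂ)) ^ (l : ℕ),
      fun i j h => Fin.ext (hω.pow_inj i.2 j.2 h)⟩
    (α := 2 * Real.pi * Complex.I / ((k + 1 : ℕ) : ℂ))
    (fun i => hω.exists_mul_pow_eq k.succ_ne_zero i)
    (g := hprim.toRootsOfUnity ^ k)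
    (by
      simp only [SubmonoidClass.coe_pow, Units.val_pow_eq_pow_val,
        IsPrimitiveRoot.val_toRootsOfUnity_coe]
      rw [← Complex.exp_nat_mul, ← Complex.exp_nat_mul]
      congr 1
      push_cast
      field_simp
      linear_combination -h₂')
  obtain ⟨γ', hγ', hcγ'⟩ := eq_of_rotation hk hN hc
    ⟨Fin.cons 0 fun l => Complex.exp (2 * Real.pi * Complex.I / (k : ℂ)) ^ (l : ℕ),
      Fin.cons_injective_iff.mpr ⟨by
        rintro ⟨l, hl⟩
        exact pow_ne_zero _ (Complex.exp_ne_zero _) hl,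
        fun i j h => Fin.ext (hω'.pow_inj i.2 j.2 h)⟩⟩
    (α := 2 * Real.pi * Complex.I / (k : ℂ))
    (fun i => by
      refine Fin.cases ⟨0, by simp⟩ (fun l => ?_) i
      obtain ⟨j, h⟩ := hω'.exists_mul_pow_eq hk.ne' l
      exact ⟨j.succ, h⟩)
    (g := hprim.toRootsOfUnity ^ (k + 1))
    (by
      simp only [SubmonoidClass.coe_pow, Units.val_pow_eq_pow_val,
        IsPrimitiveRoot.val_toRootsOfUnity_coe]
      rw [← Complex.exp_nat_mul, ← Complex.exp_nat_mul]
      congr 1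
      push_cast
      field_simp
      linear_combination -h₂')
  refine ⟨c, γ, γ', hprim.toRootsOfUnity, hγ, hγ', ?_, ?_⟩
  · rw [← IsPrimitiveRoot.coe_submonoidClass_iff, ← IsPrimitiveRoot.coe_units_iff]
    exact hprim
  · rw [hcγ, hcγ', pow_succ, ofMul_mul, add_sub_cancel_left]

end PathCocycle

end

section

open scoped unitInterval Topology

namespace PathCocycle

section

variable {X A : Type*} [TopologicalSpace X] [AddCommGroup A]

/-- The homomorphism from the fundamental group defined by a path cocycle. -/
def hom (c : PathCocycle X A) (x : X) : FundamentalGroup X x →* Multiplicative A where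
  toFun := Quotient.lift (fun γ : Path x x => Multiplicative.ofAdd (c.toFun γ.toContinuousMap))
    fun γ γ' h => congrArg Multiplicative.ofAdd (c.map_homotopic γ γ' h)
  map_one' := congrArg Multiplicative.ofAdd (c.map_const x)
  map_mul' := by
    rintro ⟨γ⟩ ⟨γ'⟩
    exact congrArg Multiplicative.ofAdd ((c.map_trans γ' γ).trans (add_comm _ _))

theorem hom_mk (c : PathCocycle X A) {x : X} (γ : Path x x) :
    c.hom x (FundamentalGroup.fromPath (Path.Homotopic.Quotient.mk γ))
      = Multiplicative.ofAdd (c.toFun γ.toContinuousMap) := rfl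

theorem map_symm (c : PathCocycle X A) {x y : X} (γ : Path x y) :
    c.toFun γ.symm.toContinuousMap = -c.toFun γ.toContinuousMap := by
  rw [eq_neg_iff_add_eq_zero, ← c.map_trans, ← c.map_const y]
  exact c.map_homotopic (γ.symm.trans γ) (Path.refl y) ⟨(Path.Homotopy.reflSymmTrans γ).symm⟩

theorem exists_hom_eq [PathConnectedSpace X] (c : PathCocycle X A) (x : X) {γ : C(I, X)}
    (hγ : γ 0 = γ 1) : ∃ g, c.hom x g = Multiplicative.ofAdd (c.toFun γ) := by
  let p := PathConnectedSpace.somePath x (γ 0)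
  let γ' : Path (γ 0) (γ 0) := ⟨γ, rfl, hγ.symm⟩
  refine ⟨FundamentalGroup.fromPath (Path.Homotopic.Quotient.mk ((p.trans γ').trans p.symm)), ?_⟩
  rw [hom_mk, c.map_trans, c.map_trans, c.map_symm, add_neg_cancel_comm]

end

section

variable {A B : Type*} [AddCommGroup A] [AddCommGroup B]

theorem segVal_mapCoeff {m : ℕ} (c : PathCocycle (PlaneConf m) A) (f : A →+ B) (p q : Fin m → ℂ) :
    (c.mapCoeff f).segVal p q = f (c.segVal p q) := by
  classical
  rw [segVal, segVal]
  split_ifs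
  · rfl
  · exact f.map_zero.symm

theorem val_mapCoeff {k n : ℕ} (hm : 2 ≤ k + 1) (c : PathCocycle (Cconf (k + 1) 1 (n + 2)) A)
    (f : A →+ B) (τ : Equiv.Perm (Fin (k + 1))) :
    (permInvariant_comap_aff hm (c.mapCoeff f)).segmentCocycle.val τ
      = f ((permInvariant_comap_aff hm c).segmentCocycle.val τ) := by
  change ((c.comap (affMap hm n)).mapCoeff f).segVal _ _
      - ((c.comap (affMap hm n)).mapCoeff f).segVal _ _
      + ((c.comap (affMap hm n)).mapCoeff f).segVal _ _
    = f ((c.comap (affMap hm n)).segVal _ _ - (c.comap (affMap hm n)).segVal _ _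
      + (c.comap (affMap hm n)).segVal _ _)
  rw [segVal_mapCoeff, segVal_mapCoeff, segVal_mapCoeff, map_add, map_sub]

theorem mem_zmultiples_gen {k n : ℕ} (hk : 0 < k) (hm : 2 ≤ k + 1)
    (c : PathCocycle (Cconf (k + 1) 1 (n + 2)) A) {γ : C(I, Cconf (k + 1) 1 (n + 2))}
    (hγ : γ 0 = γ 1) :
    c.toFun γ ∈ AddSubgroup.zmultiples
      ((permInvariant_comap_aff hm c).segmentCocycle.gen hk) := by
  set a := (permInvariant_comap_aff hm c).segmentCocycle.gen hk with ha
  obtain ⟨e, he⟩ := (c.mapCoeff (QuotientAddGroup.mk' (AddSubgroup.zmultiples a))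
    ).exists_isPotential_of_segmentCocycle hm fun τ => by
      rw [val_mapCoeff, SegmentCocycle.val_eq _ hk, ← ha, map_nsmul, QuotientAddGroup.mk'_apply,
        (QuotientAddGroup.eq_zero_iff a).mpr (AddSubgroup.mem_zmultiples a), smul_zero]
  have h := he γ
  rw [hγ, sub_self] at h
  exact (QuotientAddGroup.eq_zero_iff _).mp h

end

end PathCocycle

theorem nonempty_addEquiv_zmod {A B : Type*} [AddCommGroup A] [AddCommGroup B] {N : ℕ} {a : A}
    (ha : ∀ b, b ∈ AddSubgroup.zmultiples a) (hN : N • a = 0) (χ : A →+ B) {b : A}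
    (hb : addOrderOf (χ b) = N) : Nonempty (A ≃+ ZMod N) := by
  have hcyc : IsAddCyclic A := ⟨a, ha⟩
  have hdvd : N ∣ addOrderOf a := by
    rw [← hb]
    refine addOrderOf_dvd_of_nsmul_eq_zero ?_
    obtain ⟨j, rfl⟩ := ha b
    rw [← map_nsmul, smul_comm, addOrderOf_nsmul_eq_zero, smul_zero, map_zero]
  have hcard : Nat.card A = N := by
    rw [← Nat.dvd_antisymm (addOrderOf_dvd_of_nsmul_eq_zero hN) hdvd]
    exact (addOrderOf_eq_card_of_forall_mem_zmultiples ha).symm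
  have := zmodAddCyclicAddEquiv hcyc
  rw [hcard] at this
  exact ⟨this.symm⟩

end

/-- For `k ≥ 3` and `n ≥ 2`, the abelianization of `π₁(C_{k+1}^{1,n})` (the first homology
group of this path-connected space) is `ℤ/kℤ` for `k` even and `ℤ/2kℤ` for `k` odd. -/
theorem H1_Cconf_one_n (k n : ℕ) (hk : 3 ≤ k) (hn : 2 ≤ n) (x : Cconf (k + 1) 1 n) :
    Nonempty (Additive (Abelianization (FundamentalGroup (Cconf (k + 1) 1 n) x)) ≃+
      ZMod (if Even k then k else 2 * k)) := by
  obtain ⟨n, rfl⟩ := Nat.exists_eq_add_of_le' hn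
  have hk0 : 0 < k := by omega
  have hm : 2 ≤ k + 1 := by omega
  have := pathConnectedSpace_Cconf hm n
  obtain ⟨cu, hcu⟩ := PathCocycle.exists_of_hom x
    (A := Additive (Abelianization (FundamentalGroup (Cconf (k + 1) 1 (n + 2)) x)))
    (AddMonoidHom.toMultiplicativeRight (MonoidHom.toAdditive Abelianization.of))
  obtain ⟨e₁, e₂, h₁, h₂⟩ : ∃ e₁ e₂, (if Even k then k else 2 * k) * e₁ = 2 * k ∧
      (if Even k then k else 2 * k) * e₂ = (k + 1) * k := by
    split_ifs with h
    · exact ⟨2, k + 1, by ring, by ring⟩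
    · obtain ⟨j, rfl⟩ := Nat.not_even_iff_odd.mp h
      exact ⟨1, j + 1, by ring, by ring⟩
  obtain ⟨c, γ, γ', ζ, hγ, hγ', hζ, hcζ⟩ := PathCocycle.exists_primitive (n := n) hk0 h₁ h₂
  obtain ⟨g, hg⟩ := c.exists_hom_eq x hγ
  obtain ⟨g', hg'⟩ := c.exists_hom_eq x hγ'
  refine nonempty_addEquiv_zmod (fun b => ?_) (cu.smul_gen_eq_zero hk0 hm)
    (MonoidHom.toAdditiveLeft (Abelianization.lift (c.hom x)))
    (b := Additive.ofMul (Abelianization.of g' / Abelianization.of g)) ?_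
  · obtain ⟨⟨δ⟩, rfl⟩ : ∃ p, Additive.ofMul (Abelianization.of p) = b :=
      QuotientGroup.mk_surjective (Additive.toMul b)
    have hδ := cu.mem_zmultiples_gen hk0 hm (γ := δ.toContinuousMap) (by simp)
    rw [← hcu] at hδ
    exact hδ
  · have hval : MonoidHom.toAdditiveLeft (Abelianization.lift (c.hom x))
        (Additive.ofMul (Abelianization.of g' / Abelianization.of g)) = Additive.ofMul ζ := by
      rw [← hcζ, ofMul_div, map_sub]
      congr 1
    rw [hval, addOrderOf_ofMul_eq_orderOf]
    exact hζ.eq_orderOf.symm
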